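/- Let f be a non-wandering homeomorphism of 𝕋² homotopic to the identity. Then at least one of the following holds: (i) f is topologically transitive; (ii) f has two disjoint periodic circloids, i.e. there exist circloids C₁, C₂ ⊆ 𝕋² with C₁ ∩ C₂ = ∅ and integers q₁, q₂ ≥ 1 with f^{q₁}(C₁) = C₁ and f^{q₂}(C₂) = C₂; (iii) f has a periodic point. -/

import Mathlib

open Filter Topology

local notation "⟪" x ", " y "⟫" => @inner ℝ _ _ x y

noncomputable section

/-- Euclidean space `ℝ^d`. -/
abbrev Rd (d : ℕ) := EuclideanSpace ℝ (Fin d)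

/-- The `d`-torus `𝕋^d = ℝ^d/ℤ^d`, realized as a product of circles. -/
abbrev Torus (d : ℕ) := Fin d → AddCircle (1 : ℝ)

/-- The quotient map `π : ℝ^d → 𝕋^d`. -/
def projT {d : ℕ} (z : Rd d) : Torus d := fun i => (z i : AddCircle (1 : ℝ))

/-- An integer vector viewed as an element of `ℝ^d`. -/
def intVec {d : ℕ} (m : Fin d → ℤ) : Rd d := WithLp.toLp 2 (fun i => (m i : ℝ))

/-- A real vector viewed as an element of `ℝ^k`. -/
def vecR {k : ℕ} (ρ : Fin k → ℝ) : Rd k := WithLp.toLp 2 (fun i => ρ i)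

/-- `F : ℝ^d → ℝ^d` is a lift of `f : 𝕋^d → 𝕋^d`:  `π ∘ F = f ∘ π` and
`F (z + m) = F z + m` for every integer vector `m`.  The existence of such a lift
expresses that `f` is homotopic to the identity. -/
def IsLift {d : ℕ} (f : Torus d ≃ₜ Torus d) (F : Rd d ≃ₜ Rd d) : Prop :=
  (∀ z : Rd d, projT (F z) = f (projT z)) ∧
  ∀ (z : Rd d) (m : Fin d → ℤ), F (z + intVec m) = F z + intVec m

/-- The `n`-th iterate (`n ∈ ℤ`) of a homeomorphism. -/
def iterZ {X : Type*} [TopologicalSpace X] (F : X ≃ₜ X) (n : ℤ) : X → X := ⇑(F.toEquiv ^ n)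

/-- `f` is non-wandering: no nonempty open set `U` satisfies `fⁿ(U) ∩ U = ∅` for all
`n ≥ 1`. -/
def NonWandering {X : Type*} [TopologicalSpace X] (f : X → X) : Prop :=
  ∀ U : Set X, IsOpen U → U.Nonempty → ∃ n : ℕ, 1 ≤ n ∧ (f^[n] '' U ∩ U).Nonempty

/-- `f` is topologically transitive. -/
def TopTransitive {X : Type*} [TopologicalSpace X] (f : X → X) : Prop :=
  ∀ U V : Set X, IsOpen U → IsOpen V → U.Nonempty → V.Nonempty →
    ∃ n : ℕ, 1 ≤ n ∧ (f^[n] '' U ∩ V).Nonempty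

/-- `f` has a periodic point. -/
def HasPeriodicPoint {X : Type*} (f : X → X) : Prop :=
  ∃ (x : X) (q : ℕ), 1 ≤ q ∧ f^[q] x = x

/-- A subset of `𝕋²` is essential if it is not contained in any embedded topological
open disk (an open disk being homeomorphic to `ℝ²`, embedded disks in a surface are
exactly ranges of open embeddings of `ℝ²`). -/
def IsEssentialT2 (C : Set (Torus 2)) : Prop :=
  ¬ ∃ e : Rd 2 → Torus 2, IsOpenEmbedding e ∧ C ⊆ Set.range e

/-- A simple closed curve in `𝕋²`: a subset homeomorphic to the circle. -/
def IsSimpleClosedCurveT2 (Γ : Set (Torus 2)) : Prop :=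
  ∃ e : AddCircle (1 : ℝ) → Torus 2, IsEmbedding e ∧ Γ = Set.range e

/-- Properties (i)–(iii) of a circloid in `𝕋²`: compact and connected, essential, and
with connected complement containing an essential simple closed curve. -/
def CircloidPropsT2 (C : Set (Torus 2)) : Prop :=
  IsCompact C ∧ IsConnected C ∧ IsEssentialT2 C ∧ IsConnected Cᶜ ∧
  ∃ Γ : Set (Torus 2), Γ ⊆ Cᶜ ∧ IsSimpleClosedCurveT2 Γ ∧ IsEssentialT2 Γ

/-- A circloid in `𝕋²`: a set with properties (i)–(iii) containing no strictly smaller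
subset with these properties. -/
def IsCircloidT2 (C : Set (Torus 2)) : Prop :=
  CircloidPropsT2 C ∧ ∀ C' ⊆ C, CircloidPropsT2 C' → C' = C

namespace TorusCircloid

section Logarithms

open Set Filter Topology Complex

/-- A nowhere vanishing continuous function on a simply connected, locally path connected space
has a continuous logarithm. -/
theorem exists_continuous_log {X : Type*} [TopologicalSpace X] [SimplyConnectedSpace X]
    [LocallyPathConnectedSpace X] {g : X → ℂ} (hg : Continuous g) (h0 : ∀ x, g x ≠ 0) :
    ∃ l : X → ℂ, Continuous l ∧ ∀ x, exp (l x) = g x := by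
  let G : C(X, {z : ℂ // z ≠ 0}) := ⟨fun x => ⟨g x, h0 x⟩, by fun_prop⟩
  obtain ⟨a⟩ : Nonempty X := inferInstance
  obtain ⟨L, ⟨-, hL⟩, -⟩ := Complex.isCoveringMap_exp.existsUnique_continuousMap_lifts G a
    (Complex.log (g a)) (Subtype.ext (Complex.exp_log (h0 a)))
  exact ⟨L, L.continuous, fun x => congrArg Subtype.val (congrFun hL x)⟩

/-- Lifting a homotopy of nowhere vanishing functions through the exponential. -/
theorem exists_log_homotopy {A : Type*} [TopologicalSpace A] {H : unitInterval × A → ℂ}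
    (hH : Continuous H) (h0 : ∀ x, H x ≠ 0) {l₀ : A → ℂ} (hl₀ : Continuous l₀)
    (hl : ∀ a, exp (l₀ a) = H (0, a)) :
    ∃ l : unitInterval × A → ℂ, Continuous l ∧ (∀ x, exp (l x) = H x) ∧ ∀ a, l (0, a) = l₀ a := by
  let G : C(unitInterval × A, {z : ℂ // z ≠ 0}) := ⟨fun x => ⟨H x, h0 x⟩, by fun_prop⟩
  let f : C(A, ℂ) := ⟨l₀, hl₀⟩
  have h : ∀ a, G (0, a) = ⟨exp (f a), exp_ne_zero _⟩ := fun a => Subtype.ext (hl a).symm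
  refine ⟨Complex.isCoveringMap_exp.liftHomotopy G f h, ContinuousMap.continuous _, fun x => ?_,
    fun a => Complex.isCoveringMap_exp.liftHomotopy_zero G f h a⟩
  exact congrArg Subtype.val (congrFun (Complex.isCoveringMap_exp.liftHomotopy_lifts G f h) x)

theorem eq_of_exp_eq_one {X : Type*} [TopologicalSpace X] {S : Set X} (hS : IsPreconnected S)
    {d : X → ℂ} (hd : ContinuousOn d S) (h1 : ∀ x ∈ S, exp (d x) = 1) {x y : X} (hx : x ∈ S)
    (hy : y ∈ S) : d x = d y := by
  have hT : (range fun n : ℤ => (n : ℂ) * (2 * Real.pi * I)).Countable := countable_range _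
  refine hT.isTotallyDisconnected (d '' S) ?_ (hS.image d hd) ⟨x, hx, rfl⟩ ⟨y, hy, rfl⟩
  rintro _ ⟨z, hz, rfl⟩
  obtain ⟨n, hn⟩ := Complex.exp_eq_one_iff.1 (h1 z hz)
  exact ⟨n, hn.symm⟩

theorem sub_eq_sub_of_exp_eq {X : Type*} [TopologicalSpace X] {S : Set X} (hS : IsPreconnected S)
    {a b : X → ℂ} (ha : ContinuousOn a S) (hb : ContinuousOn b S)
    (h : ∀ x ∈ S, exp (a x) = exp (b x)) {x y : X} (hx : x ∈ S) (hy : y ∈ S) :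
    a x - b x = a y - b y :=
  eq_of_exp_eq_one hS (ha.sub hb) (fun z hz => by
    rw [Pi.sub_apply, exp_sub, h z hz, div_self (exp_ne_zero _)]) hx hy

/-- Two logarithms of the same function on two preconnected sets covering the plane differ by a
constant on the intersection. -/
theorem log_sub_log_eq {X Y : Set ℂ} (hX : IsPreconnected X) (hY : IsPreconnected Y)
    {g a b : ℂ → ℂ} (hg : Continuous g) (h0 : ∀ z, g z ≠ 0) (ha : ContinuousOn a X)
    (hb : ContinuousOn b Y) (hag : ∀ z ∈ X, exp (a z) = g z) (hbg : ∀ z ∈ Y, exp (b z) = g z)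
    {p q : ℂ} (hp : p ∈ X ∩ Y) (hq : q ∈ X ∩ Y) : a p - b p = a q - b q := by
  obtain ⟨l, hl, hlg⟩ := exists_continuous_log hg h0
  have h1 := sub_eq_sub_of_exp_eq hX ha hl.continuousOn
    (fun z hz => by rw [hag z hz, hlg]) hp.1 hq.1
  have h2 := sub_eq_sub_of_exp_eq hY hb hl.continuousOn
    (fun z hz => by rw [hbg z hz, hlg]) hp.2 hq.2
  linear_combination h1 - h2

theorem exp_two_pi_mul_I_mul_eq_one {t : ℝ} (ht : t = 0 ∨ t = 1) :
    exp (2 * Real.pi * I * t) = 1 := by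
  rcases ht with rfl | rfl <;> simp [Complex.exp_two_pi_mul_I]

/-- The plane is unicoherent. -/
theorem isPreconnected_inter_of_isClosed {A B : Set ℂ} (hA : IsClosed A) (hB : IsClosed B)
    (hA' : IsPreconnected A) (hB' : IsPreconnected B) (hAB : A ∪ B = univ) :
    IsPreconnected (A ∩ B) := by
  rw [isPreconnected_iff_subset_of_fully_disjoint_closed (hA.inter hB)]
  intro S T hS hT hST hd
  by_contra! hcon
  obtain ⟨⟨p, hp, hpS⟩, ⟨q, hq, hqT⟩⟩ := And.imp not_subset.1 not_subset.1 hcon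
  have hpT := (hST hp).resolve_left hpS
  have hqS := (hST hq).resolve_right hqT
  obtain ⟨u, hu0, hu1, -⟩ := exists_continuous_zero_one_of_isClosed hS hT hd
  classical
  let a : ℂ → ℂ := fun z => 2 * Real.pi * I * (u z : ℝ)
  have ha : Continuous a := by fun_prop
  have hab : ∀ z ∈ A ∩ B, exp (a z) = 1 := fun z hz => by
    refine exp_two_pi_mul_I_mul_eq_one ((hST hz).imp (fun h => hu0 h) fun h => hu1 h)
  let g : ℂ → ℂ := A.piecewise (fun z => exp (a z)) 1
  have hgA : ∀ z ∈ A, g z = exp (a z) := fun z hz => piecewise_eq_of_mem _ _ _ hz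
  have hgB : ∀ z ∈ B, g z = 1 := fun z hz => by
    by_cases hzA : z ∈ A
    · rw [hgA z hzA, hab z ⟨hzA, hz⟩]
    · exact piecewise_eq_of_notMem _ _ _ hzA
  have hg : Continuous g := by
    rw [← continuousOn_univ, ← hAB]
    refine ContinuousOn.union_of_isClosed ?_ ?_ hA hB
    · exact (ha.cexp.continuousOn).congr hgA
    · exact (continuousOn_const (c := 1)).congr hgB
  have hg0 : ∀ z, g z ≠ 0 := fun z => by
    rcases (hAB ▸ mem_univ z : z ∈ A ∪ B) with h | h
    · rw [hgA z h]; exact exp_ne_zero _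
    · rw [hgB z h]; exact one_ne_zero
  have key := log_sub_log_eq hA' hB' hg hg0 ha.continuousOn
    (continuousOn_const (c := (0 : ℂ))) (fun z hz => (hgA z hz).symm)
    (fun z hz => by rw [hgB z hz, exp_zero]) hp hq
  have h1 : (u p : ℝ) = 1 := hu1 hpT
  have h2 : (u q : ℝ) = 0 := hu0 hqS
  simp [a, h1, h2] at key

/-- The plane is unicoherent with respect to open sets. -/
theorem isPreconnected_inter_of_isOpen {X Y : Set ℂ} (hX : IsOpen X) (hY : IsOpen Y)
    (hX' : IsPreconnected X) (hY' : IsPreconnected Y) (hXY : X ∪ Y = univ) :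
    IsPreconnected (X ∩ Y) := by
  rw [isPreconnected_iff_subset_of_disjoint]
  intro S T hS hT hST hd
  by_contra! hcon
  obtain ⟨⟨p, hp, hpS⟩, ⟨q, hq, hqT⟩⟩ := And.imp not_subset.1 not_subset.1 hcon
  have hpT := (hST hp).resolve_left hpS
  have hqS := (hST hq).resolve_right hqT
  have hdis : Disjoint Xᶜ Yᶜ := by
    rw [Set.disjoint_compl_left_iff_subset]
    exact fun z hz => ((hXY ▸ mem_univ z : z ∈ X ∪ Y)).resolve_right hz
  obtain ⟨u, hu0, hu1, -⟩ :=
    exists_continuous_zero_one_of_isClosed hX.isClosed_compl hY.isClosed_compl hdis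
  classical
  let R := S ∩ (X ∩ Y)
  have hR : IsOpen R := hS.inter (hX.inter hY)
  let c : ℂ → ℂ := fun z => 2 * Real.pi * I * (u z : ℝ)
  have hc : Continuous c := by fun_prop
  have hcX : ∀ z, z ∉ X → c z = 0 := fun z hz => by
    have : (u z : ℝ) = 0 := hu0 hz
    simp [c, this]
  have hcY : ∀ z, z ∉ Y → c z = 2 * Real.pi * I := fun z hz => by
    have : (u z : ℝ) = 1 := hu1 hz
    simp [c, this]
  let a : ℂ → ℂ := R.piecewise c (fun _ => 2 * Real.pi * I)
  let b : ℂ → ℂ := R.piecewise c (fun _ => 0)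
  have hcont : ∀ (Z Z' : Set ℂ) (v : ℂ), Z ∩ Z' = X ∩ Y → (∀ z, z ∉ Z' → c z = v) →
      ∀ z ∈ Z, ContinuousAt (R.piecewise c (fun _ => v)) z := by
    intro Z Z' v hZ hv z hz
    by_cases hzZ : z ∈ Z'
    · have hzXY : z ∈ X ∩ Y := hZ ▸ ⟨hz, hzZ⟩
      rcases hST hzXY with h | h
      · refine hc.continuousAt.congr ?_
        filter_upwards [hR.mem_nhds ⟨h, hzXY⟩] with w hw
        rw [piecewise_eq_of_mem _ _ _ hw]
      · refine (continuousAt_const (y := v)).congr ?_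
        filter_upwards [(hT.inter (hX.inter hY)).mem_nhds ⟨h, hzXY⟩] with w hw
        rw [piecewise_eq_of_notMem]
        exact fun hw' => (hd ▸ ⟨hw.2, hw'.1, hw.1⟩ : w ∈ (∅ : Set ℂ))
    · have hzR : z ∉ R := fun h => hzZ ((hZ ▸ h.2 : z ∈ Z ∩ Z').2)
      have h1 : Tendsto c (𝓝 z) (𝓝 v) := hv z hzZ ▸ hc.tendsto z
      rw [ContinuousAt, piecewise_eq_of_notMem _ _ _ hzR]
      refine Tendsto.piecewise ?_ ?_
      · exact h1.mono_left inf_le_left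
      · exact tendsto_const_nhds
  have hacont := hcont X Y _ rfl hcY
  have hbcont := hcont Y X _ (inter_comm _ _) hcX
  have hab : ∀ z, exp (b z) = exp (a z) := fun z => by
    by_cases hz : z ∈ R
    · simp only [a, b, piecewise_eq_of_mem _ _ _ hz]
    · simp only [a, b, piecewise_eq_of_notMem _ _ _ hz, Complex.exp_two_pi_mul_I, exp_zero]
  have hg : Continuous fun z => exp (a z) := by
    rw [continuous_iff_continuousAt]
    intro z
    rcases (hXY ▸ mem_univ z : z ∈ X ∪ Y) with h | h
    · exact (hacont z h).cexp
    · exact (funext hab ▸ (hbcont z h).cexp :)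
  have key := log_sub_log_eq hX' hY' hg (fun _ => exp_ne_zero _)
    (fun z hz => (hacont z hz).continuousWithinAt) (fun z hz => (hbcont z hz).continuousWithinAt)
    (fun z _ => rfl) (fun z _ => hab z) hp hq
  have hp' : p ∉ R := fun h => hpS h.1
  have hq' : q ∈ R := ⟨hqS, hq⟩
  simp [hp', hq'] at key

end Logarithms

end TorusCircloid

namespace TorusCircloid

section PlaneSets

open Set Filter Topology Complex

theorem connectedComponentIn_closure_subset {X : Type*} [TopologicalSpace X] {U : Set X} {x : X}
    (hx : x ∈ U) : closure (connectedComponentIn U x) ∩ U ⊆ connectedComponentIn U x := by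
  have hsub : connectedComponentIn U x ⊆ closure (connectedComponentIn U x) ∩ U :=
    subset_inter subset_closure (connectedComponentIn_subset U x)
  exact (isPreconnected_connectedComponentIn.subset_closure hsub inter_subset_left
    ).subset_connectedComponentIn (hsub (mem_connectedComponentIn hx)) inter_subset_right

/-- If `O` is a union of components of the complement of a closed connected set, then the
complement of `O` is connected. -/
theorem isPreconnected_compl_of_components {X : Type*} [TopologicalSpace X] [PreconnectedSpace X]
    [LocallyConnectedSpace X] {W O : Set X} (hW : IsClosed W) (hWc : IsPreconnected W)
    (hWne : W.Nonempty) (hOW : Disjoint O W)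
    (hO : ∀ S, IsPreconnected S → Disjoint S W → (S ∩ O).Nonempty → S ⊆ O) :
    IsPreconnected Oᶜ := by
  obtain ⟨w, hw⟩ := hWne
  have hWO : W ⊆ Oᶜ := subset_compl_iff_disjoint_left.2 hOW
  refine isPreconnected_of_forall w fun x hx => ?_
  by_cases hxW : x ∈ W
  · exact ⟨W, hWO, hw, hxW, hWc⟩
  have hxW' : x ∈ Wᶜ := hxW
  set K := connectedComponentIn Wᶜ x with hK
  have hcl : closure K ∩ Wᶜ ⊆ K := connectedComponentIn_closure_subset hxW'
  have hKc : IsPreconnected K := isPreconnected_connectedComponentIn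
  have hxK : x ∈ K := mem_connectedComponentIn hxW'
  have hKW : Disjoint K W := disjoint_compl_left.mono_left (connectedComponentIn_subset _ _)
  have hKO : K ⊆ Oᶜ := fun y hy hyO => hx (hO K hKc hKW ⟨y, hy, hyO⟩ hxK)
  have hmeet : (closure K ∩ W).Nonempty := by
    by_contra hne
    rw [not_nonempty_iff_eq_empty, ← disjoint_iff_inter_eq_empty] at hne
    have hclosed : IsClosed K := by
      rw [← closure_subset_iff_isClosed]
      exact fun y hy => hcl ⟨hy, fun hyW => hne.le_bot ⟨hy, hyW⟩⟩
    have hopen : IsOpen K := hW.isOpen_compl.connectedComponentIn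
    have huniv : K = univ := IsClopen.eq_univ ⟨hclosed, hopen⟩ ⟨x, hxK⟩
    exact hKW.le_bot ⟨huniv ▸ mem_univ w, hw⟩
  obtain ⟨y, hyK, hyW⟩ := hmeet
  refine ⟨W ∪ closure K, union_subset hWO fun z hz => ?_, Or.inl hw,
    Or.inr (subset_closure hxK), hWc.union y hyW hyK hKc.closure⟩
  by_cases hzW : z ∈ W
  · exact hWO hzW
  · exact hKO (hcl ⟨hz, hzW⟩)

/-- A compact subset of a connected open set of the plane is contained in a compact connected
subset of it. -/
theorem exists_isCompact_isConnected_superset {O K : Set ℂ} (hO : IsOpen O) (hO' : IsConnected O)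
    (hK : IsCompact K) (hKO : K ⊆ O) :
    ∃ T, IsCompact T ∧ IsConnected T ∧ K ⊆ T ∧ T ⊆ O := by
  have hpath : IsPathConnected O := (hO.isConnected_iff_isPathConnected).1 hO'
  obtain ⟨o, ho⟩ := hO'.nonempty
  suffices h : ∃ T, IsCompact T ∧ IsPreconnected T ∧ o ∈ T ∧ K ⊆ T ∧ T ⊆ O by
    obtain ⟨T, h1, h2, h3, h4, h5⟩ := h
    exact ⟨T, h1, ⟨⟨o, h3⟩, h2⟩, h4, h5⟩
  refine hK.induction_on (p := fun s => ∃ T, IsCompact T ∧ IsPreconnected T ∧ o ∈ T ∧ s ⊆ T ∧ T ⊆ O)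
    ?_ ?_ ?_ ?_
  · exact ⟨{o}, isCompact_singleton, isPreconnected_singleton, rfl, empty_subset _,
      singleton_subset_iff.2 ho⟩
  · rintro s t hst ⟨T, h1, h2, h3, h4, h5⟩
    exact ⟨T, h1, h2, h3, hst.trans h4, h5⟩
  · rintro s t ⟨T, h1, h2, h3, h4, h5⟩ ⟨T', h1', h2', h3', h4', h5'⟩
    exact ⟨T ∪ T', h1.union h1', h2.union o h3 h3' h2', Or.inl h3, union_subset_union h4 h4',
      union_subset h5 h5'⟩
  · intro x hx
    obtain ⟨r, hr, hrO⟩ := Metric.nhds_basis_closedBall.mem_iff.1 (hO.mem_nhds (hKO hx))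
    obtain ⟨γ, hγ⟩ := hpath.joinedIn o ho x (hKO hx)
    refine ⟨Metric.closedBall x r, mem_nhdsWithin_of_mem_nhds (Metric.closedBall_mem_nhds x hr),
      range γ ∪ Metric.closedBall x r, (isCompact_range γ.continuous).union
        (isCompact_closedBall x r), ?_, Or.inl ⟨0, γ.source⟩, subset_union_right,
        union_subset (range_subset_iff.2 hγ) hrO⟩
    exact (isPreconnected_range γ.continuous).union x ⟨1, γ.target⟩
      (Metric.mem_closedBall_self hr.le) (convex_closedBall x r).isPreconnected

theorem exists_continuousOn_of_subtype {X Y : Type*} [TopologicalSpace X] [TopologicalSpace Y]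
    [Inhabited Y] {S : Set X} {l : S → Y} (hl : Continuous l) :
    ∃ l' : X → Y, ContinuousOn l' S ∧ ∀ x : S, l' x = l x := by
  refine ⟨Function.extend Subtype.val l fun _ => default, ?_,
    fun x => Subtype.val_injective.extend_apply _ _ _⟩
  rw [continuousOn_iff_continuous_domRestrict]
  convert hl using 1
  ext x
  exact Subtype.val_injective.extend_apply _ _ _

/-- If `a` can be joined in the complement of `K` to a point farther from the origin than `K`,
then `z - a` has a continuous logarithm on `K`. -/
theorem exists_log_sub {K : Set ℂ} {a c : ℂ} (hj : JoinedIn Kᶜ a c) (hc : ∀ z ∈ K, ‖z‖ < ‖c‖) :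
    ∃ l : ℂ → ℂ, ContinuousOn l K ∧ ∀ z ∈ K, exp (l z) = z - a := by
  obtain ⟨γ, hγ⟩ := hj.symm
  rcases K.eq_empty_or_nonempty with rfl | ⟨z₀, hz₀⟩
  · exact ⟨0, continuousOn_empty _, by simp⟩
  have hc0 : c ≠ 0 := norm_pos_iff.1 ((norm_nonneg _).trans_lt (hc z₀ hz₀))
  have hslit : ∀ z : K, 1 - (z : ℂ) / c ∈ slitPlane := fun z => by
    left
    have h1 : ‖(z : ℂ) / c‖ < 1 := by
      rw [norm_div, div_lt_one (norm_pos_iff.2 hc0)]; exact hc z z.2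
    have := (abs_lt.1 ((abs_re_le_norm _).trans_lt h1)).2
    simpa using this
  obtain ⟨l, hl, hlH, -⟩ := exists_log_homotopy (A := K)
    (H := fun x => (x.2 : ℂ) - γ x.1) (by fun_prop)
    (fun x => sub_ne_zero.2 fun h => hγ x.1 (h ▸ x.2.2))
    (l₀ := fun z => Complex.log (1 - (z : ℂ) / c) + Complex.log (-c))
    (by
      refine Continuous.add ?_ continuous_const
      exact Continuous.clog (by fun_prop) hslit)
    (fun z => by
      rw [exp_add, exp_log (slitPlane_ne_zero (hslit z)), exp_log (neg_ne_zero.2 hc0)]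
      simp only [Path.source]
      field_simp
      ring)
  obtain ⟨l', hl', hl'l⟩ := exists_continuousOn_of_subtype
    (l := fun z : K => l (1, z)) (by fun_prop)
  refine ⟨l', hl', fun z hz => ?_⟩
  have h1 := hl'l ⟨z, hz⟩
  have h2 := hlH (1, ⟨z, hz⟩)
  simp only [Path.target] at h1 h2
  rw [h1, h2]

end PlaneSets

end TorusCircloid

namespace TorusCircloid

section Pushes

open Set Filter Topology Complex

/-- A homeomorphism of the plane with bounded displacement. -/
def BddDisp (g : ℂ ≃ₜ ℂ) : Prop := ∃ C : ℝ, ∀ z, ‖g z - z‖ ≤ C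

theorem BddDisp.trans {g h : ℂ ≃ₜ ℂ} (hg : BddDisp g) (hh : BddDisp h) : BddDisp (g.trans h) := by
  obtain ⟨C, hC⟩ := hg
  obtain ⟨D, hD⟩ := hh
  refine ⟨D + C, fun z => ?_⟩
  calc ‖h (g z) - z‖ = ‖(h (g z) - g z) + (g z - z)‖ := by ring_nf
    _ ≤ _ := (norm_add_le _ _).trans (add_le_add (hD _) (hC _))

theorem BddDisp.symm {g : ℂ ≃ₜ ℂ} (hg : BddDisp g) : BddDisp g.symm := by
  obtain ⟨C, hC⟩ := hg
  refine ⟨C, fun z => ?_⟩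
  have := hC (g.symm z)
  rwa [g.apply_symm_apply, norm_sub_rev] at this

theorem exists_ball_push {a v : ℂ} {ρ : ℝ} (hv : ‖v‖ < ρ) :
    ∃ h : ℂ ≃ₜ ℂ, BddDisp h ∧ h a = a + v ∧ ∀ z, ρ ≤ ‖z - a‖ → h z = z := by
  have hρ : 0 < ρ := (norm_nonneg v).trans_lt hv
  let t : ℂ → ℝ := fun z => max 0 (1 - ‖z - a‖ / ρ)
  have ht : ∀ z w, |t z - t w| ≤ ‖z - w‖ / ρ := fun z w => by
    refine (abs_max_sub_max_le_max _ _ _ _).trans ?_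
    rw [sub_self, abs_zero]
    refine max_le (by positivity) ?_
    rw [show 1 - ‖z - a‖ / ρ - (1 - ‖w - a‖ / ρ) = (‖w - a‖ - ‖z - a‖) / ρ by ring, abs_div,
      abs_of_pos hρ]
    gcongr
    refine (abs_norm_sub_norm_le _ _).trans_eq ?_
    rw [← norm_neg]
    congr 1
    ring
  let φ : ℂ → ℂ := fun z => z + t z * v
  let c : NNReal := ⟨‖v‖ / ρ, by positivity⟩
  have hφ : ApproximatesLinearOn φ
      ((ContinuousLinearEquiv.refl ℝ ℂ : ℂ ≃L[ℝ] ℂ) : ℂ →L[ℝ] ℂ) univ c := by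
    intro z _ w _
    have h1 : φ z - φ w - (z - w) = ((t z - t w : ℝ) : ℂ) * v := by
      simp only [φ, ofReal_sub]; ring
    change ‖φ z - φ w - (z - w)‖ ≤ ‖v‖ / ρ * ‖z - w‖
    rw [h1, norm_mul, norm_real, Real.norm_eq_abs]
    calc |t z - t w| * ‖v‖ ≤ ‖z - w‖ / ρ * ‖v‖ := by gcongr; exact ht z w
      _ = ‖v‖ / ρ * ‖z - w‖ := by ring
  have hc : c < ‖((ContinuousLinearEquiv.refl ℝ ℂ).symm : ℂ →L[ℝ] ℂ)‖₊⁻¹ := by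
    have h1 : ((ContinuousLinearEquiv.refl ℝ ℂ).symm : ℂ →L[ℝ] ℂ) = ContinuousLinearMap.id ℝ ℂ :=
      rfl
    rw [h1, ContinuousLinearMap.nnnorm_id, inv_one, ← NNReal.coe_lt_coe]
    exact (div_lt_one hρ).2 hv
  refine ⟨hφ.toHomeomorph φ (Or.inr hc), ⟨‖v‖, fun z => ?_⟩, ?_, fun z hz => ?_⟩
  · change ‖z + t z * v - z‖ ≤ ‖v‖
    rw [add_sub_cancel_left, norm_mul, norm_real, Real.norm_eq_abs, abs_of_nonneg (le_max_left _ _)]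
    refine mul_le_of_le_one_left (norm_nonneg _) (max_le zero_le_one ?_)
    have : 0 ≤ ‖z - a‖ / ρ := by positivity
    linarith
  · change a + t a * v = a + v
    simp [t]
  · change z + t z * v = z
    have : t z = 0 := max_eq_left (by rw [sub_nonpos, le_div_iff₀ hρ]; linarith)
    simp [this]

/-- Any two points of a connected open set are exchanged by a homeomorphism of the plane supported
in that set. -/
theorem exists_push {O : Set ℂ} (hO : IsOpen O) (hO' : IsPreconnected O) {a b : ℂ} (ha : a ∈ O)
    (hb : b ∈ O) : ∃ h : ℂ ≃ₜ ℂ, BddDisp h ∧ h a = b ∧ ∀ z, z ∉ O → h z = z := by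
  refine hO'.induction₂' (fun a b => ∃ h : ℂ ≃ₜ ℂ, BddDisp h ∧ h a = b ∧ ∀ z, z ∉ O → h z = z)
    (fun x hx => ?_) ?_ ha hb
  · obtain ⟨ρ, hρ, hsub⟩ := Metric.isOpen_iff.1 hO x hx
    filter_upwards [mem_nhdsWithin_of_mem_nhds (Metric.ball_mem_nhds x hρ)] with y hy
    obtain ⟨h, h1, h2, h3⟩ := exists_ball_push (a := x) (v := y - x) (ρ := ρ)
      (by rwa [← dist_eq_norm])
    have hxy : h x = y := by rw [h2]; ring
    have hid : ∀ z, z ∉ O → h z = z := fun z hz => h3 z (by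
      by_contra hlt
      exact hz (hsub (by rw [Metric.mem_ball, dist_eq_norm]; exact not_le.1 hlt)))
    exact ⟨⟨h, h1, hxy, hid⟩, ⟨h.symm, h1.symm, by rw [← hxy, h.symm_apply_apply],
      fun z hz => by rw [Homeomorph.symm_apply_eq, hid z hz]⟩⟩
  · rintro x y z - - - ⟨h, h1, h2, h3⟩ ⟨k, k1, k2, k3⟩
    refine ⟨h.trans k, h1.trans k1, by simp [h2, k2], fun z hz => ?_⟩
    simp [h3 z hz, k3 z hz]

/-- A push supported in a free open set does not create fixed points. -/
theorem push_comp_ne {g h : ℂ ≃ₜ ℂ} {O : Set ℂ} (hfix : ∀ z, g z ≠ z)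
    (hfree : ∀ z ∈ O, g z ∉ O) (hid : ∀ z, z ∉ O → h z = z) (z : ℂ) : h (g z) ≠ z := by
  intro hz
  by_cases hgz : g z ∈ O
  · have : z ∈ O := by
      by_contra hzO
      have h1 := hid z hzO
      exact hfix z (h.injective (hz.trans h1.symm))
    exact hfree z this hgz
  · exact hfix z (by rw [← hid _ hgz, hz])

theorem exists_push_of_free {g : ℂ ≃ₜ ℂ} (hfix : ∀ z, g z ≠ z) {β E : Set ℂ} (hβ : IsCompact β)
    (hβ' : IsPreconnected β) (hfree : ∀ z ∈ β, g z ∉ β) (hE : IsClosed E) (hEβ : Disjoint β E)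
    {s t : ℂ} (hs : s ∈ β) (ht : t ∈ β) :
    ∃ h : ℂ ≃ₜ ℂ, BddDisp h ∧ h s = t ∧ (∀ z ∈ E, h z = z) ∧ ∀ z, h (g z) ≠ z := by
  have hdis : Disjoint β (g '' β) := by
    rw [Set.disjoint_left]
    rintro _ hx ⟨y, hy, rfl⟩
    exact hfree y hy hx
  obtain ⟨U, V, hU, hV, hβU, hβV, hUV⟩ :=
    SeparatedNhds.of_isCompact_isCompact hβ (hβ.image g.continuous) hdis
  let W := U ∩ g ⁻¹' V ∩ Eᶜ
  have hW : IsOpen W := (hU.inter (hV.preimage g.continuous)).inter hE.isOpen_compl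
  have hβW : β ⊆ W := fun z hz =>
    ⟨⟨hβU hz, hβV ⟨z, hz, rfl⟩⟩, fun hzE => hEβ.le_bot ⟨hz, hzE⟩⟩
  let O := connectedComponentIn W s
  have hOW : O ⊆ W := connectedComponentIn_subset _ _
  have hβO : β ⊆ O := hβ'.subset_connectedComponentIn hs hβW
  obtain ⟨h, h1, h2, h3⟩ := exists_push (O := O) hW.connectedComponentIn
    isPreconnected_connectedComponentIn (hβO hs) (hβO ht)
  refine ⟨h, h1, h2, fun z hz => h3 z fun hzO => (hOW hzO).2 hz, push_comp_ne hfix ?_ h3⟩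
  intro z hz hgz
  exact hUV.le_bot ⟨(hOW hgz).1.1, (hOW hz).1.2⟩

/-- If a free connected open set returns to itself, some perturbation without fixed points has a
periodic point. -/
theorem exists_periodic_of_return {g : ℂ ≃ₜ ℂ} (hg : BddDisp g) (hfix : ∀ z, g z ≠ z) {O : Set ℂ}
    (hO : IsOpen O) (hO' : IsPreconnected O) (hfree : ∀ z ∈ O, g z ∉ O) {j : ℕ} (hj : 1 ≤ j)
    {x : ℂ} (hx : x ∈ O) (hjx : g^[j] x ∈ O) :
    ∃ k : ℂ ≃ₜ ℂ, BddDisp k ∧ (∀ z, k z ≠ z) ∧ ∃ m y, 1 ≤ m ∧ m ≤ j ∧ k^[m] y = y := by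
  classical
  have hex : ∃ m, 1 ≤ m ∧ ∃ y ∈ O, g^[m] y ∈ O := ⟨j, hj, x, hx, hjx⟩
  obtain ⟨hm1, y, hy, hmy⟩ := Nat.find_spec hex
  set m := Nat.find hex with hm
  have hmin : ∀ i, 1 ≤ i → i < m → g^[i] y ∉ O := fun i hi him hiO =>
    Nat.find_min hex him ⟨hi, y, hy, hiO⟩
  obtain ⟨h, h1, h2, h3⟩ := exists_push hO hO' hmy hy
  refine ⟨g.trans h, hg.trans h1, push_comp_ne hfix hfree h3, m, y, hm1,
    Nat.find_min' hex ⟨hj, x, hx, hjx⟩, ?_⟩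
  have hit : ∀ i, i < m → (g.trans h)^[i] y = g^[i] y := by
    intro i
    induction i with
    | zero => simp
    | succ i ih =>
      intro hi
      rw [Function.iterate_succ_apply', ih (by lia), Function.iterate_succ_apply']
      simp only [Homeomorph.trans_apply]
      rw [h3]
      rw [← Function.iterate_succ_apply' g]
      exact hmin _ (by lia) hi
  obtain ⟨i, hi⟩ : ∃ i, m = i + 1 := ⟨m - 1, by lia⟩
  rw [hi, Function.iterate_succ_apply', hit i (by lia)]
  simp only [Homeomorph.trans_apply]
  rw [← Function.iterate_succ_apply' g, Nat.succ_eq_add_one, ← hi, h2]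

end Pushes

end TorusCircloid

namespace TorusCircloid

section Linking

open Set Filter Topology Complex

/-- A continuous logarithm of the difference quotients of a homeomorphism with bounded
displacement, in exponential coordinates. -/
theorem exists_log_slope {g : ℂ ≃ₜ ℂ} (hg : BddDisp g) :
    ∃ M : ℂ × ℂ → ℂ, Continuous M ∧
      (∀ z s, exp (M (z, s)) = (g (z + exp s) - g z) / exp s) ∧
      ∀ z s, M (z + exp s, s + Real.pi * I) = M (z, s) := by
  have hgc := g.continuous
  obtain ⟨M, hM, hexp⟩ := exists_continuous_log
    (g := fun x : ℂ × ℂ => (g (x.1 + exp x.2) - g x.1) / exp x.2)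
    (Continuous.div (by fun_prop) (by fun_prop) fun x => exp_ne_zero _)
    (fun x => div_ne_zero (sub_ne_zero.2 fun h => by
      have := g.injective h
      simp at this) (exp_ne_zero _))
  have hexp' : ∀ z s, exp (M (z, s)) = (g (z + exp s) - g z) / exp s := fun z s => hexp (z, s)
  have hpi : ∀ s, exp (s + Real.pi * I) = - exp s := fun s => by
    rw [exp_add, exp_pi_mul_I]; ring
  have hsym : ∀ z s, exp (M (z + exp s, s + Real.pi * I)) = exp (M (z, s)) := fun z s => by
    rw [hexp', hexp', hpi, add_neg_cancel_right, div_neg, ← neg_div, neg_sub]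
  have hconst : ∀ z s, M (z + exp s, s + Real.pi * I) - M (z, s) =
      M (0 + exp 0, 0 + Real.pi * I) - M (0, 0) := fun z s =>
    sub_eq_sub_of_exp_eq (S := univ) (a := fun x : ℂ × ℂ => M (x.1 + exp x.2, x.2 + Real.pi * I))
      (b := M) isPreconnected_univ (by fun_prop) (by fun_prop) (fun x _ => hsym x.1 x.2)
      (x := (z, s)) (y := (0, 0)) (mem_univ _) (mem_univ _)
  set D := M (0 + exp 0, 0 + Real.pi * I) - M (0, 0) with hD
  have htwo : ∀ z s, M (z, s + 2 * Real.pi * I) - M (z, s) = 2 * D := fun z s => by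
    have h1 := hconst z s
    have h2 := hconst (z + exp s) (s + Real.pi * I)
    rw [hpi, add_neg_cancel_right, add_assoc s, ← two_mul, ← mul_assoc] at h2
    linear_combination h1 + h2
  obtain ⟨C, hC⟩ := hg
  have hC0 : 0 ≤ C := (norm_nonneg _).trans (hC 0)
  let R : ℝ := Real.log (2 * C + 1)
  have hR : Real.exp R = 2 * C + 1 := Real.exp_log (by linarith)
  have hslit : ∀ t : ℝ, exp (M (0, R + t * I)) ∈ slitPlane := fun t => by
    have hv : ‖exp (R + t * I)‖ = 2 * C + 1 := by rw [norm_exp]; simp [hR]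
    rw [hexp']
    set v := exp (R + t * I)
    have hv0 : v ≠ 0 := exp_ne_zero _
    have h1 : (g (0 + v) - g 0) / v - 1 = ((g (0 + v) - (0 + v)) - (g 0 - 0)) / v := by
      field_simp; ring
    have h2 : ‖(g (0 + v) - g 0) / v - 1‖ < 1 := by
      rw [h1, norm_div, div_lt_one (norm_pos_iff.2 hv0), hv]
      calc _ ≤ ‖g (0 + v) - (0 + v)‖ + ‖g 0 - 0‖ := norm_sub_le _ _
        _ ≤ C + C := add_le_add (hC _) (hC _)
        _ < 2 * C + 1 := by linarith
    left
    have h3 := (abs_lt.1 ((abs_re_le_norm _).trans_lt h2)).1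
    rw [sub_re, one_re] at h3
    linarith
  have hD0 : D = 0 := by
    have hcm : Continuous fun t : ℝ => M (0, R + t * I) := by fun_prop
    have h1 := sub_eq_sub_of_exp_eq (S := (univ : Set ℝ)) (a := fun t : ℝ => M (0, R + t * I))
      (b := fun t : ℝ => Complex.log (exp (M (0, R + t * I)))) isPreconnected_univ
      hcm.continuousOn ((hcm.cexp.clog hslit).continuousOn)
      (fun t _ => by rw [exp_log (exp_ne_zero _)]) (x := 2 * Real.pi) (y := 0)
      (mem_univ _) (mem_univ _)
    have h2 := htwo 0 R
    have h3 : exp (M (0, R + 2 * Real.pi * I)) = exp (M (0, R)) := by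
      rw [hexp', hexp', exp_add, exp_two_pi_mul_I, mul_one]
    push_cast at h1
    rw [zero_mul, add_zero, h3] at h1
    linear_combination (1 / 2) * h1 - (1 / 2) * h2
  exact ⟨M, hM, hexp', fun z s => by
    have := hconst z s
    rw [hD0] at this
    exact sub_eq_zero.1 this⟩

theorem iterate_two_ne {g : ℂ ≃ₜ ℂ} (hg : BddDisp g) (hfix : ∀ z, g z ≠ z) (z : ℂ) :
    g (g z) ≠ z := by
  intro h2
  have hgc := g.continuous
  obtain ⟨M, hM, hexp, hsym⟩ := exists_log_slope hg
  obtain ⟨L, hL, hLexp⟩ := exists_continuous_log (g := fun z => g z - z) (by fun_prop)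
    (fun z => sub_ne_zero.2 (hfix z))
  have hML : ∀ w, exp (M (w, L w)) = exp (L (g w) - L w) := fun w => by
    rw [hexp, exp_sub, hLexp, hLexp, add_sub_cancel]
  have hc := sub_eq_sub_of_exp_eq (S := univ) (a := fun w => M (w, L w))
    (b := fun w => L (g w) - L w) isPreconnected_univ (by fun_prop) (by fun_prop)
    (fun w _ => hML w) (x := z) (y := g z) (mem_univ _) (mem_univ _)
  have hper : ∀ w s, M (w, s + 2 * Real.pi * I) = M (w, s) := fun w s => by
    have e1 := hsym w s
    have e2 := hsym (w + exp s) (s + Real.pi * I)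
    rw [exp_add, exp_pi_mul_I, add_assoc s, ← two_mul, ← mul_assoc] at e2
    rw [← e1, ← e2]
    congr 2
    ring
  have hperZ : ∀ (n : ℤ) w s, M (w, s + n * (2 * Real.pi * I)) = M (w, s) := by
    intro n w
    induction n using Int.induction_on with
    | zero => simp
    | succ i ih =>
      intro s
      rw [← ih s, ← hper w (s + (i : ℤ) * _)]
      congr 2
      push_cast; ring
    | pred i ih =>
      intro s
      rw [← ih s, ← hper w (s + _)]
      congr 2
      push_cast; ring
  have hexpL : exp (L (g z)) = exp (L z + Real.pi * I) := by
    rw [hLexp, exp_add, hLexp, exp_pi_mul_I, h2]; ring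
  obtain ⟨n, hn⟩ := Complex.exp_eq_exp_iff_exists_int.1 hexpL
  have hMM : M (g z, L (g z)) = M (z, L z) := by
    rw [hn, hperZ, ← hsym z (L z), hLexp, add_sub_cancel]
  simp only [h2, hMM] at hc
  have hLL : L (g z) = L z := by linear_combination (-1 / 2) * hc
  have h3 := hML z
  rw [hLL, sub_self, exp_zero, hexp, hLexp, add_sub_cancel, h2] at h3
  have h4 : z - g z ≠ 0 := sub_ne_zero.2 (hfix z).symm
  rw [div_eq_one_iff_eq (sub_ne_zero.2 (hfix z))] at h3
  exact h4 (by linear_combination (1 / 2) * h3)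

end Linking

end TorusCircloid

namespace TorusCircloid

section Brouwer

open Set Filter Topology Complex

theorem segment_subset_ball_union {c b : ℂ} {r : ℝ} (hb : ‖b - c‖ = r) {x : ℂ}
    (hx : x ∈ segment ℝ c b) :
    x ∈ Metric.ball c r ∨ x = b := by
  obtain ⟨t, ⟨ht0, ht1⟩, rfl⟩ := segment_eq_image' ℝ c b ▸ hx
  rcases ht1.lt_or_eq with h | rfl
  · rcases (norm_nonneg (b - c)).eq_or_lt with h0 | h0
    · right
      have : b - c = 0 := norm_eq_zero.1 h0.symm
      rw [this]
      simp [sub_eq_zero.1 this]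
    left
    rw [Metric.mem_ball, dist_eq_norm]
    simp only [add_sub_cancel_left, norm_smul, Real.norm_eq_abs, abs_of_nonneg ht0]
    rw [← hb]
    exact mul_lt_of_lt_one_left h0 h
  · right; simp

theorem exists_minimal_free_ball {g : ℂ ≃ₜ ℂ} (hfix : ∀ z, g z ≠ z) (c : ℂ) :
    ∃ a r, 0 < r ∧ ‖a - c‖ = r ∧ ‖g a - c‖ = r ∧ ∀ z ∈ Metric.ball c r, g z ∉ Metric.ball c r := by
  have hgc := g.continuous
  let φ : ℂ → ℝ := fun z => max ‖z - c‖ ‖g z - c‖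
  have hφ : Continuous φ := by fun_prop
  have hlim : Tendsto φ (cocompact ℂ) atTop :=
    tendsto_atTop_mono (fun z => le_max_left _ _) (by
      refine tendsto_atTop_mono (f := fun z => ‖z‖ - ‖c‖) (fun z => norm_sub_norm_le z c) ?_
      exact tendsto_atTop_add_const_right _ _ (tendsto_norm_cocompact_atTop))
  obtain ⟨a, ha⟩ := hφ.exists_forall_le hlim
  have hr : 0 < φ a := by
    by_contra hle
    have h1 : ‖a - c‖ = 0 := le_antisymm ((le_max_left _ _).trans (not_lt.1 hle)) (norm_nonneg _)
    have h2 : ‖g a - c‖ = 0 := le_antisymm ((le_max_right _ _).trans (not_lt.1 hle)) (norm_nonneg _)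
    rw [norm_eq_zero, sub_eq_zero] at h1 h2
    exact hfix a (h2.trans h1.symm)
  have hfree : ∀ z ∈ Metric.ball c (φ a), g z ∉ Metric.ball c (φ a) := fun z hz hgz => by
    rw [Metric.mem_ball, dist_eq_norm] at hz hgz
    exact (ha z).not_gt (max_lt hz hgz)
  have hcl : ∀ x, ‖x - c‖ ≤ φ a → x ∈ closure (Metric.ball c (φ a)) := fun x hx => by
    rw [closure_ball _ hr.ne', Metric.mem_closedBall, dist_eq_norm]; exact hx
  refine ⟨a, φ a, hr, ?_, ?_, hfree⟩
  · refine (le_max_left _ _).antisymm (not_lt.1 fun hlt => ?_)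
    have hopen : IsOpen (g '' Metric.ball c (φ a)) := g.isOpenMap _ Metric.isOpen_ball
    obtain ⟨_, ⟨x, hx, rfl⟩, hgx⟩ := mem_closure_iff.1 (hcl (g a) (le_max_right _ _)) _ hopen
      ⟨a, by rw [Metric.mem_ball, dist_eq_norm]; exact hlt, rfl⟩
    exact hfree x hx hgx
  · refine (le_max_right _ _).antisymm (not_lt.1 fun hlt => ?_)
    have hopen : IsOpen (g ⁻¹' Metric.ball c (φ a)) := Metric.isOpen_ball.preimage g.continuous
    obtain ⟨x, hgx, hx⟩ := mem_closure_iff.1 (hcl a (le_max_left _ _)) _ hopen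
      (by rw [mem_preimage, Metric.mem_ball, dist_eq_norm]; exact hlt)
    exact hfree x hx hgx

/-- A fixed point free homeomorphism of the plane with bounded displacement has no periodic
points. -/
theorem iterate_ne_self : ∀ (n : ℕ) (g : ℂ ≃ₜ ℂ), 1 ≤ n → BddDisp g → (∀ z, g z ≠ z) →
    ∀ z, g^[n] z ≠ z := by
  intro n
  induction n using Nat.strong_induction_on with
  | _ n ih =>
  intro g hn hg hfix z₀ hz₀
  rcases (by omega : n = 1 ∨ n = 2 ∨ 3 ≤ n) with rfl | rfl | hn3
  · exact hfix z₀ hz₀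
  · exact iterate_two_ne hg hfix z₀ hz₀
  have hgc := g.continuous
  obtain ⟨a, r, hr, har, hbr, hfree⟩ := exists_minimal_free_ball hfix z₀
  set B := Metric.ball z₀ r with hB
  set b := g a with hb
  have hBo : IsOpen B := Metric.isOpen_ball
  have hBc : IsPreconnected B := (convex_ball z₀ r).isPreconnected
  have hz₀B : z₀ ∈ B := Metric.mem_ball_self hr
  have hnorm : ∀ x ∈ B, ‖x - z₀‖ < r := fun x hx => by
    rw [← dist_eq_norm]; exact hx
  have hcl : ∀ x, ‖x - z₀‖ = r → x ∈ closure B := fun x hx => by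
    rw [closure_ball _ hr.ne', Metric.mem_closedBall, dist_eq_norm]; exact hx.le
  have haB : a ∉ B := fun h => (hnorm a h).ne har
  have hbB : b ∉ B := fun h => (hnorm b h).ne hbr
  have hab : a ≠ b := (hfix a).symm
  have hclg : ∀ x ∈ B, g x ∉ closure B := fun x hx hcx => by
    obtain ⟨_, ⟨y, hy, rfl⟩, hgy⟩ := mem_closure_iff.1 hcx (g '' B) (g.isOpenMap _ hBo) ⟨x, hx, rfl⟩
    exact hfree y hy hgy
  have hgcl : ∀ x ∈ closure B, g x ∉ B := fun x hx hgx => by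
    obtain ⟨y, hgy, hy⟩ := mem_closure_iff.1 hx (g ⁻¹' B) (hBo.preimage hgc) hgx
    exact hfree y hy hgy
  have haC := hcl a har
  have hbC := hcl b hbr
  have hret : ∀ j, 1 ≤ j → j < n → ∀ x ∈ B, g^[j] x ∉ B := fun j hj hjn x hx hjx => by
    obtain ⟨k, hk, hkfix, m, y, hm1, hmj, hmy⟩ :=
      exists_periodic_of_return hg hfix hBo hBc hfree hj hx hjx
    exact ih m (by omega) k hm1 hk hkfix y hmy
  have hret2 : ∀ x ∈ B, g (g x) ∉ B := hret 2 (by omega) (by omega)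
  set z : ℕ → ℂ := fun j => g^[j] z₀ with hz
  have hzs : ∀ j, z (j + 1) = g (z j) := fun j => Function.iterate_succ_apply' _ _ _
  have hz0 : z 0 = z₀ := rfl
  have hzn : z n = z₀ := hz₀
  have hzB : ∀ j, 1 ≤ j → j < n → z j ∉ B := fun j hj hjn => hret j hj hjn z₀ hz₀B
  have hsegb : ∀ x ∈ segment ℝ z₀ b, x ∈ B ∨ x = b := fun x hx => segment_subset_ball_union hbr hx
  have hsega : ∀ x ∈ segment ℝ z₀ a, x ∈ B ∨ x = a := fun x hx => segment_subset_ball_union har hx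
  have hz₀b : z₀ ∈ segment ℝ z₀ b := left_mem_segment _ _ _
  have hbseg : b ∈ segment ℝ z₀ b := right_mem_segment _ _ _
  have hsegc : ∀ x y : ℂ, IsCompact (segment ℝ x y) := fun x y => by
    rw [segment_eq_image]
    exact isCompact_Icc.image (by fun_prop)
  have hsegp : ∀ x y : ℂ, IsPreconnected (segment ℝ x y) := fun x y =>
    (convex_segment x y).isPreconnected
  have hfreeb : ∀ x ∈ segment ℝ z₀ b, g x ∉ segment ℝ z₀ b := fun x hx hgx => by
    rcases hsegb x hx with h | rfl <;> rcases hsegb _ hgx with h' | h'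
    · exact hfree x h h'
    · exact hclg x h (h' ▸ hbC)
    · exact hgcl _ hbC h'
    · exact hfix _ h'
  have hbz : ∀ j, 1 ≤ j → j < n → z j ≠ b := fun j hj hjn hjb => by
    have hEfin : (z '' {i | 1 ≤ i ∧ i < n ∧ z i ≠ b}).Finite :=
      ((Set.finite_lt_nat n).subset fun i hi => hi.2.1).image z
    obtain ⟨h, h1, h2, h3, h4⟩ := exists_push_of_free hfix (hsegc z₀ b) (hsegp z₀ b) hfreeb
      hEfin.isClosed (Set.disjoint_left.2 (by
        rintro _ hx ⟨i, hi, rfl⟩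
        exact (hsegb _ hx).elim (hzB i hi.1 hi.2.1) hi.2.2)) hbseg hz₀b
    classical
    have hex : ∃ i, 1 ≤ i ∧ z i = b := ⟨j, hj, hjb⟩
    obtain ⟨hm1, hmb⟩ := Nat.find_spec hex
    have hmj : Nat.find hex ≤ j := Nat.find_min' hex ⟨hj, hjb⟩
    set m := Nat.find hex with hm
    have hit : ∀ i, i < m → (g.trans h)^[i] z₀ = z i := by
      intro i
      induction i with
      | zero => intro _; rfl
      | succ i ihi =>
        intro hi
        rw [Function.iterate_succ_apply', ihi (by omega), Homeomorph.trans_apply, ← hzs]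
        exact h3 _ ⟨i + 1, ⟨by omega, by omega, fun hib => Nat.find_min hex hi ⟨by omega, hib⟩⟩, rfl⟩
    obtain ⟨i, hi⟩ : ∃ i, m = i + 1 := ⟨m - 1, by omega⟩
    refine ih m (by omega) (g.trans h) hm1 (hg.trans h1) h4 z₀ ?_
    rw [hi, Function.iterate_succ_apply', hit i (by omega), Homeomorph.trans_apply, ← hzs, ← hi, hmb,
      h2]
  set y : ℂ := midpoint ℝ a z₀ with hy
  have hyseg : y ∈ segment ℝ z₀ a := by
    rw [segment_symm]; exact midpoint_mem_segment _ _
  have hay : segment ℝ a y ⊆ segment ℝ z₀ a :=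
    (convex_segment z₀ a).segment_subset (right_mem_segment _ _ _) hyseg
  have hynorm : ‖y - z₀‖ < r := by
    have : y - z₀ = (1 / 2 : ℝ) • (a - z₀) := by
      rw [hy, midpoint_eq_smul_add]; simp only [real_smul]; push_cast; simp; ring
    rw [this, norm_smul, har]
    norm_num
    linarith
  have hyB : y ∈ B := by rw [hB, Metric.mem_ball, dist_eq_norm]; exact hynorm
  have hyz : segment ℝ y z₀ ⊆ B := (convex_ball z₀ r).segment_subset hyB hz₀B
  have houter : ∀ x ∈ segment ℝ a y, ∃ s : ℝ, 1 / 2 ≤ s ∧ x = z₀ + s • (a - z₀) := fun x hx => by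
    obtain ⟨t, ⟨ht0, ht1⟩, rfl⟩ := segment_eq_image' ℝ a y ▸ hx
    refine ⟨1 - t / 2, by linarith, ?_⟩
    rw [hy, midpoint_eq_smul_add]
    simp only [real_smul]
    push_cast
    simp
    ring
  have hz₀outer : z₀ ∉ segment ℝ a y := fun h => by
    obtain ⟨s, hs, hs'⟩ := houter _ h
    have h1 : s • (a - z₀) = 0 := by linear_combination -hs'
    rcases smul_eq_zero.1 h1 with h2 | h2
    · linarith
    · rw [h2, norm_zero] at har; exact hr.ne har
  have hdisj : ∀ x ∈ segment ℝ a y, x ∉ segment ℝ z₀ b := fun x hx hxb => by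
    obtain ⟨s, hs, rfl⟩ := houter _ hx
    obtain ⟨t, ⟨ht0, ht1⟩, hts⟩ := segment_eq_image' ℝ z₀ b ▸ hxb
    simp only at hts
    have h1 : t • (b - z₀) = s • (a - z₀) := by linear_combination hts
    have h2 := congrArg norm h1
    rw [norm_smul, norm_smul, har, hbr, Real.norm_eq_abs, Real.norm_eq_abs, abs_of_nonneg ht0,
      abs_of_nonneg (by linarith : 0 ≤ s)] at h2
    have h3 : t = s := mul_right_cancel₀ hr.ne' h2
    rw [h3] at h1
    have h4 := smul_right_injective ℂ (by linarith : s ≠ 0) h1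
    exact hab (by linear_combination -h4)
  have hayB : ∀ x ∈ segment ℝ a y, x ∈ B ∨ x = a := fun x hx => hsega x (hay hx)
  let β : Set ℂ := segment ℝ z₀ b ∪ g '' segment ℝ a y
  have hβc : IsCompact β := (hsegc _ _).union ((hsegc _ _).image hgc)
  have hβp : IsPreconnected β := (hsegp _ _).union b hbseg ⟨a, left_mem_segment _ _ _, rfl⟩
    ((hsegp _ _).image _ hgc.continuousOn)
  have hbg2 : ∀ x ∈ B, g (g x) ≠ b := fun x hx h => hclg x hx (g.injective h ▸ haC)
  have hβfree : ∀ x ∈ β, g x ∉ β := by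
    rintro x (hx | ⟨x, hx, rfl⟩) (hgx | ⟨u, hu, hux⟩)
    · exact hfreeb x hx hgx
    · exact hdisj u hu (g.injective hux ▸ hx)
    · rcases hayB x hx with h | rfl <;> rcases hsegb _ hgx with h' | h'
      · exact hret2 x h h'
      · exact hbg2 x h h'
      · exact hgcl _ hbC h'
      · exact hfix _ h'
    · have hux' := g.injective hux
      rcases hayB x hx with h | rfl <;> rcases hayB u hu with h' | h'
      · exact hfree x h (hux' ▸ h')
      · exact hclg x h (hux' ▸ h' ▸ haC)
      · exact hbB (hux' ▸ h' :)
      · exact hab (h'.symm.trans hux')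
  have hβsub : ∀ x ∈ β, x ∈ B ∨ x = b ∨ ∃ u ∈ B, u ∈ segment ℝ a y ∧ g u = x := by
    rintro x (hx | ⟨u, hu, rfl⟩)
    · exact (hsegb x hx).imp id Or.inl
    · rcases hayB u hu with h | rfl
      · exact Or.inr (Or.inr ⟨u, h, hu, rfl⟩)
      · exact Or.inr (Or.inl rfl)
  have hβz : ∀ j, 1 ≤ j → j < n → z j ∉ β := fun j hj hjn hjβ => by
    rcases hβsub _ hjβ with h | h | ⟨u, hu, hus, huz⟩
    · exact hzB j hj hjn h
    · exact hbz j hj hjn h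
    · obtain ⟨i, rfl⟩ : ∃ i, j = i + 1 := ⟨j - 1, by omega⟩
      rw [hzs] at huz
      have huz' := g.injective huz
      rcases Nat.eq_zero_or_pos i with rfl | hi
      · exact hz₀outer (hz0 ▸ huz' ▸ hus)
      · exact hzB i hi (by omega) (huz' ▸ hu)
  let β₂ : Set ℂ := (fun x => g (g x)) '' segment ℝ y z₀
  have hβ₂sub : ∀ x ∈ β₂, ∃ u ∈ B, g (g u) = x := by
    rintro _ ⟨u, hu, rfl⟩
    exact ⟨u, hyz hu, rfl⟩
  have hβ₂c : IsCompact β₂ := (hsegc _ _).image (by fun_prop)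
  have hβ₂p : IsPreconnected β₂ := (hsegp _ _).image _ (by fun_prop)
  have hβ₂free : ∀ x ∈ β₂, g x ∉ β₂ := fun x hx hgx => by
    obtain ⟨u, hu, rfl⟩ := hβ₂sub x hx
    obtain ⟨v, hv, hvu⟩ := hβ₂sub _ hgx
    exact hfree u hu (g.injective (g.injective hvu) ▸ hv)
  have hβ₂β : Disjoint β₂ β := Set.disjoint_left.2 fun x hx hxβ => by
    obtain ⟨u, hu, rfl⟩ := hβ₂sub x hx
    rcases hβsub _ hxβ with h | h | ⟨v, hv, -, hvu⟩
    · exact hret2 u hu h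
    · exact hbg2 u hu h
    · exact hfree u hu (g.injective hvu ▸ hv)
  have hβ₂z : ∀ j, j < n → j ≠ 2 → z j ∉ β₂ := fun j hjn hj2 hjβ => by
    obtain ⟨u, hu, huz⟩ := hβ₂sub _ hjβ
    rcases (show j = 0 ∨ j = 1 ∨ ∃ i, j = i + 2 ∧ 1 ≤ i by
      rcases j with _ | _ | i
      · simp
      · simp
      · exact Or.inr (Or.inr ⟨i, rfl, by omega⟩)) with rfl | rfl | ⟨i, rfl, hi⟩
    · exact hret2 u hu (huz ▸ hz₀B)
    · exact hfree u hu (g.injective huz ▸ hz₀B)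
    · rw [hzs, hzs] at huz
      exact hzB i hi (by omega) (g.injective (g.injective huz) ▸ hu)
  have hfin : ∀ p : ℕ → Prop, IsClosed (z '' {i | i < n ∧ p i}) := fun p =>
    (((Set.finite_lt_nat n).subset fun i hi => hi.1).image z).isClosed
  obtain ⟨h₂, hd₂, hp₂, hid₂, hf₂⟩ := exists_push_of_free hfix hβ₂c hβ₂p hβ₂free
    (hβc.isClosed.union (hfin fun i => i ≠ 2))
    (Set.disjoint_union_right.2 ⟨hβ₂β, Set.disjoint_left.2 (by
      rintro _ hx ⟨i, hi, rfl⟩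
      exact hβ₂z i hi.1 hi.2 hx)⟩)
    (s := g (g y)) (t := z 2) ⟨y, left_mem_segment _ _ _, rfl⟩ ⟨z₀, right_mem_segment _ _ _, rfl⟩
  have hg1free : ∀ x ∈ β, (g.trans h₂) x ∉ β := fun x hx hgx => by
    rw [Homeomorph.trans_apply] at hgx
    have h1 := hid₂ _ (Or.inl hgx)
    have h2 := h₂.injective h1
    exact hβfree x hx (h2 ▸ hgx)
  obtain ⟨h₁, hd₁, hp₁, hid₁, hf₁⟩ := exists_push_of_free (g := g.trans h₂) hf₂ hβc hβp hg1free
    (hfin fun i => 1 ≤ i)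
    (Set.disjoint_left.2 (by
      rintro _ hx ⟨i, hi, rfl⟩
      exact hβz i hi.2 hi.1 hx))
    (s := z₀) (t := g y) (Or.inl hz₀b) (Or.inr ⟨y, right_mem_segment _ _ _, rfl⟩)
  let k := (g.trans h₂).trans h₁
  have hkw : k (g y) = z 2 := by
    change h₁ (h₂ (g (g y))) = z 2
    rw [hp₂]
    exact hid₁ _ ⟨2, ⟨by omega, by omega⟩, rfl⟩
  have hkz : ∀ j, 2 ≤ j → j + 1 < n → k (z j) = z (j + 1) := fun j hj hjn => by
    change h₁ (h₂ (g (z j))) = _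
    rw [← hzs, hid₂ _ (Or.inr ⟨j + 1, ⟨hjn, by omega⟩, rfl⟩)]
    exact hid₁ _ ⟨j + 1, ⟨hjn, by omega⟩, rfl⟩
  have hklast : k (z (n - 1)) = g y := by
    change h₁ (h₂ (g (z (n - 1)))) = _
    rw [← hzs, Nat.sub_add_cancel hn, hzn, hid₂ z₀ (Or.inr ⟨0, ⟨by omega, by omega⟩, rfl⟩), hp₁]
  have hkit : ∀ j, j + 2 < n → k^[j] (z 2) = z (j + 2) := by
    intro j
    induction j with
    | zero => intro _; rfl
    | succ j ihj =>
      intro hj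
      rw [Function.iterate_succ_apply', ihj (by omega), hkz _ (by omega) (by omega)]
  refine ih (n - 1) (by omega) k (by omega) ((hg.trans hd₂).trans hd₁) hf₁ (z 2) ?_
  obtain ⟨i, rfl⟩ : ∃ i, n = i + 3 := ⟨n - 3, by omega⟩
  rw [show i + 3 - 1 = i + 1 + 1 by omega, Function.iterate_succ_apply', Function.iterate_succ_apply',
    hkit i (by omega)]
  rw [show i + 3 - 1 = i + 2 by omega] at hklast
  rw [hklast, hkw]

/-- Every point is wandering for a fixed point free homeomorphism of the plane with bounded
displacement. -/
theorem exists_wandering_ball {g : ℂ ≃ₜ ℂ} (hg : BddDisp g) (hfix : ∀ z, g z ≠ z) (x : ℂ)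
    {U : Set ℂ} (hU : U ∈ 𝓝 x) :
    ∃ r > 0, Metric.ball x r ⊆ U ∧
      ∀ j, 1 ≤ j → ∀ z ∈ Metric.ball x r, g^[j] z ∉ Metric.ball x r := by
  obtain ⟨V, W, hV, hW, hxV, hxW, hVW⟩ := t2_separation (hfix x).symm
  have hmem : U ∩ (V ∩ g ⁻¹' W) ∈ 𝓝 x := inter_mem hU
    ((hV.inter (hW.preimage g.continuous)).mem_nhds ⟨hxV, hxW⟩)
  obtain ⟨r, hr, hsub⟩ := Metric.mem_nhds_iff.1 hmem
  refine ⟨r, hr, fun z hz => (hsub hz).1, fun j hj z hz hjz => ?_⟩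
  obtain ⟨k, hk, hkfix, m, y, hm1, -, hmy⟩ := exists_periodic_of_return hg hfix Metric.isOpen_ball
    (convex_ball x r).isPreconnected
    (fun z hz hgz => hVW.le_bot ⟨(hsub hgz).2.1, (hsub hz).2.2⟩) hj hz hjz
  exact iterate_ne_self m k hm1 hk hkfix y hmy

end Brouwer

end TorusCircloid

namespace TorusCircloid

section Logarithms

open Set Filter Topology Complex Metric

theorem isPreconnected_compl_of_isPreconnected_diff {X : Type*} [TopologicalSpace X]
    [PreconnectedSpace X] [LocallyConnectedSpace X] {K V : Set X} (hK : IsClosed K)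
    (hne : K.Nonempty) (hV : IsOpen V) (hKV : K ⊆ V) (h : IsPreconnected (V \ K)) :
    IsPreconnected Kᶜ := by
  have key : ∀ x ∈ Kᶜ, (connectedComponentIn Kᶜ x ∩ (V \ K)).Nonempty := by
    intro x hx
    by_contra hcon
    have h1 : connectedComponentIn Kᶜ x ⊆ Vᶜ := fun y hy hyV =>
      hcon ⟨y, hy, hyV, connectedComponentIn_subset _ _ hy⟩
    have h2 : closure (connectedComponentIn Kᶜ x) ⊆ Kᶜ :=
      (closure_minimal h1 hV.isClosed_compl).trans (compl_subset_compl.2 hKV)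
    have h3 : IsClosed (connectedComponentIn Kᶜ x) := by
      refine isClosed_of_closure_subset fun y hy => ?_
      exact connectedComponentIn_closure_subset hx ⟨hy, h2 hy⟩
    have h4 : IsClopen (connectedComponentIn Kᶜ x) := ⟨h3, hK.isOpen_compl.connectedComponentIn⟩
    rcases isClopen_iff.1 h4 with h5 | h5
    · exact (h5 ▸ mem_connectedComponentIn hx : x ∈ (∅ : Set X))
    · obtain ⟨k, hk⟩ := hne
      exact connectedComponentIn_subset Kᶜ x (h5 ▸ mem_univ k) hk
  refine isPreconnected_of_forall_pair fun x hx y hy => ?_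
  obtain ⟨u, hu, hu'⟩ := key x hx
  obtain ⟨v, hv, hv'⟩ := key y hy
  refine ⟨connectedComponentIn Kᶜ x ∪ (V \ K) ∪ connectedComponentIn Kᶜ y, ?_,
    Or.inl (Or.inl (mem_connectedComponentIn hx)), Or.inr (mem_connectedComponentIn hy), ?_⟩
  · exact union_subset (union_subset (connectedComponentIn_subset _ _) fun z hz => hz.2)
      (connectedComponentIn_subset _ _)
  · exact IsPreconnected.union v (Or.inr hv') hv
      (IsPreconnected.union u hu hu' isPreconnected_connectedComponentIn h)
      isPreconnected_connectedComponentIn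

/-- Logarithms on compact subsets of a connected open set glue together. -/
theorem exists_log_of_forall_isCompact {O : Set ℂ} (hO : IsOpen O) (hO' : IsConnected O)
    {g : ℂ → ℂ}
    (h : ∀ L ⊆ O, IsCompact L → ∃ l : ℂ → ℂ, ContinuousOn l L ∧ ∀ z ∈ L, exp (l z) = g z) :
    ∃ l : ℂ → ℂ, ContinuousOn l O ∧ ∀ z ∈ O, exp (l z) = g z := by
  obtain ⟨z₀, hz₀⟩ := hO'.nonempty
  obtain ⟨c, hc⟩ : ∃ c, exp c = g z₀ := by
    obtain ⟨l, -, hl⟩ := h {z₀} (singleton_subset_iff.2 hz₀) isCompact_singleton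
    exact ⟨l z₀, hl _ rfl⟩
  have hnorm : ∀ L ⊆ O, IsCompact L → z₀ ∈ L →
      ∃ l : ℂ → ℂ, ContinuousOn l L ∧ (∀ z ∈ L, exp (l z) = g z) ∧ l z₀ = c := by
    intro L hL hLc hzL
    obtain ⟨l, hl, hlg⟩ := h L hL hLc
    refine ⟨fun z => l z + (c - l z₀), hl.add continuousOn_const, fun z hz => ?_, by ring⟩
    rw [exp_add, exp_sub, hc, hlg z hz, hlg z₀ hzL, div_self, mul_one]
    exact hlg z₀ hzL ▸ exp_ne_zero _
  have huniq : ∀ L M, z₀ ∈ L → L ⊆ M → IsPreconnected L → ∀ l m : ℂ → ℂ, ContinuousOn l L →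
      ContinuousOn m M → (∀ z ∈ L, exp (l z) = g z) → (∀ z ∈ M, exp (m z) = g z) →
      l z₀ = c → m z₀ = c → ∀ z ∈ L, l z = m z := by
    intro L M hzL hLM hL l m hl hm hlg hmg hl0 hm0 z hz
    have := sub_eq_sub_of_exp_eq hL hl (hm.mono hLM)
      (fun x hx => by rw [hlg x hx, hmg x (hLM hx)]) hz hzL
    rw [hl0, hm0, sub_self] at this
    exact sub_eq_zero.1 this
  have hex : ∀ z ∈ O, ∃ L, IsCompact L ∧ IsConnected L ∧ {z₀, z} ⊆ L ∧ L ⊆ O := fun z hz =>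
    exists_isCompact_isConnected_superset hO hO' (isCompact_singleton.insert z₀)
      (insert_subset hz₀ (singleton_subset_iff.2 hz))
  choose! T hTc hTconn hzT hTO using hex
  choose! l hl hlg hl0 using hnorm
  have hz₀T : ∀ z ∈ O, z₀ ∈ T z := fun z hz => hzT z hz (mem_insert _ _)
  have hzT' : ∀ z ∈ O, z ∈ T z := fun z hz => hzT z hz (mem_insert_of_mem _ rfl)
  have hagree : ∀ L ⊆ O, IsCompact L → IsConnected L → z₀ ∈ L → ∀ z ∈ L,
      l (T z) z = l L z := by
    intro L hL hLc hLconn hzL z hz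
    have hzO := hL hz
    obtain ⟨M, hM, hM', hLM, hMO⟩ := exists_isCompact_isConnected_superset hO hO'
      (hLc.union (hTc z hzO)) (union_subset hL (hTO z hzO))
    have hL' := subset_union_left.trans hLM
    have hT' := subset_union_right.trans hLM
    have hzM := hL' hzL
    rw [huniq L M hzL hL' hLconn.2 (l L) (l M) (hl _ hL hLc hzL) (hl _ hMO hM hzM)
      (hlg _ hL hLc hzL) (hlg _ hMO hM hzM) (hl0 _ hL hLc hzL) (hl0 _ hMO hM hzM) z hz,
      huniq (T z) M (hz₀T z hzO) hT' (hTconn z hzO).2 (l (T z)) (l M)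
      (hl _ (hTO z hzO) (hTc z hzO) (hz₀T z hzO)) (hl _ hMO hM hzM)
      (hlg _ (hTO z hzO) (hTc z hzO) (hz₀T z hzO)) (hlg _ hMO hM hzM)
      (hl0 _ (hTO z hzO) (hTc z hzO) (hz₀T z hzO)) (hl0 _ hMO hM hzM) z (hzT' z hzO)]
  refine ⟨fun z => l (T z) z, fun z hz => ?_, fun z hz =>
    hlg _ (hTO z hz) (hTc z hz) (hz₀T z hz) z (hzT' z hz)⟩
  obtain ⟨r, hr, hrO⟩ := nhds_basis_closedBall.mem_iff.1 (hO.mem_nhds hz)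
  obtain ⟨M, hM, hM', hLM, hMO⟩ := exists_isCompact_isConnected_superset hO hO'
      ((isCompact_closedBall z r).insert z₀) (insert_subset hz₀ hrO)
  have hzM : z₀ ∈ M := hLM (mem_insert _ _)
  have hMz : M ∈ 𝓝 z := mem_of_superset (closedBall_mem_nhds z hr)
    ((subset_insert _ _).trans hLM)
  refine ContinuousAt.continuousWithinAt ?_
  refine ((hl M hMO hM hzM).continuousAt hMz).congr ?_
  filter_upwards [hMz] with w hw
  exact (hagree M hMO hM hM' hzM w hw).symm

theorem isOpen_image_of_injOn {O : Set ℂ} (hO : IsOpen O) {g : ℂ → ℂ}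
    (hg : DifferentiableOn ℂ g O) (hinj : InjOn g O) : IsOpen (g '' O) := by
  rw [isOpen_iff_mem_nhds]
  rintro _ ⟨z, hz, rfl⟩
  have hz' : O ∈ 𝓝 z := hO.mem_nhds hz
  rcases (hg.analyticAt hz').eventually_constant_or_nhds_le_map_nhds with h | h
  · exfalso
    have h2 : ∀ᶠ w in 𝓝[≠] z, False := by
      filter_upwards [nhdsWithin_le_nhds h, nhdsWithin_le_nhds hz', self_mem_nhdsWithin]
        with w h1 h2 h3 using h3 (hinj h2 hz h1)
    exact (h2.exists).elim fun _ h => h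
  · exact h (image_mem_map hz')

theorem exists_log_of_isPreconnected_compl {O : Set ℂ} (hO : IsOpen O) (hO' : IsConnected O)
    (hb : Bornology.IsBounded O) (hOc : IsPreconnected Oᶜ) {g : ℂ → ℂ}
    (hg : DifferentiableOn ℂ g O) (hinj : InjOn g O) {a : ℂ} (ha : a ∉ g '' O) :
    ∃ l : ℂ → ℂ, ContinuousOn l O ∧ ∀ z ∈ O, exp (l z) = g z - a := by
  refine exists_log_of_forall_isCompact hO hO' fun L hLO hL => ?_
  rcases L.eq_empty_or_nonempty with rfl | ⟨z₁, hz₁⟩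
  · exact ⟨0, continuousOn_empty _, by simp⟩
  obtain ⟨c, hc⟩ : Oᶜ.Nonempty := by
    rw [nonempty_compl]
    rintro rfl
    exact NormedSpace.unbounded_univ ℝ ℂ hb
  have hcL : c ∈ Lᶜ := fun h => hc (hLO h)
  set Ω := connectedComponentIn Lᶜ c with hΩ
  have hΩo : IsOpen Ω := hL.isClosed.isOpen_compl.connectedComponentIn
  have hΩO : Oᶜ ⊆ Ω := hOc.subset_connectedComponentIn hc (compl_subset_compl.2 hLO)
  have hLΩ : L ⊆ Ωᶜ := subset_compl_comm.1 (connectedComponentIn_subset _ _)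
  have hΩO' : Ωᶜ ⊆ O := compl_subset_comm.1 hΩO
  have hcomp : IsCompact Ωᶜ :=
    isCompact_of_isClosed_isBounded hΩo.isClosed_compl (hb.subset hΩO')
  have hpre : IsPreconnected (O \ Ωᶜ) := by
    rw [sdiff_compl]
    exact isPreconnected_inter_of_isOpen hO hΩo hO'.2 isPreconnected_connectedComponentIn
      (by rw [eq_univ_iff_forall]; intro z; by_cases hz : z ∈ O
          · exact Or.inl hz
          · exact Or.inr (hΩO hz))
  have hK : IsCompact (g '' Ωᶜ) := hcomp.image_of_continuousOn (hg.continuousOn.mono hΩO')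
  have hKc : IsPreconnected (g '' Ωᶜ)ᶜ := by
    refine isPreconnected_compl_of_isPreconnected_diff hK.isClosed ⟨_, z₁, hLΩ hz₁, rfl⟩
      (isOpen_image_of_injOn hO hg hinj) (image_mono hΩO') ?_
    rw [← hinj.image_sdiff_subset hΩO']
    exact hpre.image g (hg.continuousOn.mono sdiff_subset)
  have haK : a ∈ (g '' Ωᶜ)ᶜ := fun h => ha (image_mono hΩO' h)
  obtain ⟨R, hR⟩ := hK.isBounded.exists_norm_le
  have hcfar : ∀ z ∈ g '' Ωᶜ, ‖z‖ < ‖((|R| + 1 : ℝ) : ℂ)‖ := by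
    intro z hz
    rw [norm_real, Real.norm_eq_abs, abs_of_pos (by positivity)]
    linarith [hR z hz, le_abs_self R]
  have hpath : IsPathConnected (g '' Ωᶜ)ᶜ :=
    (hK.isClosed.isOpen_compl.isConnected_iff_isPathConnected).1 ⟨⟨a, haK⟩, hKc⟩
  obtain ⟨l, hl, hlg⟩ := exists_log_sub (hpath.joinedIn a haK ((|R| + 1 : ℝ) : ℂ)
    (fun h => lt_irrefl _ (hcfar _ h))) hcfar
  exact ⟨l ∘ g, hl.comp (hg.continuousOn.mono hLO) fun z hz => ⟨z, hLΩ hz, rfl⟩,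
    fun z hz => hlg _ ⟨z, hLΩ hz, rfl⟩⟩

theorem differentiableOn_of_exp_eq {O : Set ℂ} (hO : IsOpen O) {h l : ℂ → ℂ}
    (hh : DifferentiableOn ℂ h O) (hl : ContinuousOn l O) (he : ∀ z ∈ O, exp (l z) = h z) :
    DifferentiableOn ℂ l O := by
  intro z hz
  have hO' := hO.mem_nhds hz
  have hlz := hl.continuousAt hO'
  have h0 : h z ≠ 0 := he z hz ▸ exp_ne_zero _
  have h1 : DifferentiableAt ℂ (fun w => l z + log (h w / h z)) z := by
    refine (DifferentiableAt.clog ((hh.differentiableAt hO').div_const _) ?_).const_add _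
    simp [div_self h0]
  refine (h1.congr_of_eventuallyEq ?_).differentiableWithinAt
  have h2 : ∀ᶠ w in 𝓝 z, ‖l w - l z‖ < Real.pi := by
    have : Tendsto (fun w => ‖l w - l z‖) (𝓝 z) (𝓝 ‖l z - l z‖) := (hlz.sub continuousAt_const).norm
    rw [sub_self, norm_zero] at this
    exact this.eventually (gt_mem_nhds Real.pi_pos)
  filter_upwards [h2, hO'] with w hw hwO
  rw [← he w hwO, ← he z hz, ← exp_sub, log_exp]
  · ring
  · linarith [abs_lt.1 ((abs_im_le_norm _).trans_lt hw)]
  · linarith [abs_lt.1 ((abs_im_le_norm _).trans_lt hw)]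

end Logarithms

end TorusCircloid

namespace TorusCircloid

section Riemann

open Set Filter Topology Complex Metric

/-- The Möbius transformation of the unit disc sending `a` to `0`. -/
noncomputable def discMap (a w : ℂ) : ℂ := (w - a) / (1 - (starRingEnd ℂ) a * w)

theorem one_sub_conj_mul_ne_zero {a w : ℂ} (ha : ‖a‖ < 1) (hw : ‖w‖ < 1) :
    1 - (starRingEnd ℂ) a * w ≠ 0 := by
  intro h
  have h1 : ‖(starRingEnd ℂ) a * w‖ = 1 := by rw [← sub_eq_zero.1 h, norm_one]
  rw [norm_mul, RCLike.norm_conj] at h1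
  nlinarith [norm_nonneg a, norm_nonneg w]

theorem norm_discMap_lt_one {a w : ℂ} (ha : ‖a‖ < 1) (hw : ‖w‖ < 1) : ‖discMap a w‖ < 1 := by
  have h0 := one_sub_conj_mul_ne_zero ha hw
  rw [discMap, norm_div, div_lt_one (norm_pos_iff.2 h0)]
  refine lt_of_pow_lt_pow_left₀ 2 (norm_nonneg _) ?_
  have ha' : ‖a‖ ^ 2 < 1 := by nlinarith [norm_nonneg a]
  have hw' : ‖w‖ ^ 2 < 1 := by nlinarith [norm_nonneg w]
  simp only [← normSq_eq_norm_sq, normSq_apply] at ha' hw' ⊢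
  simp
  nlinarith [mul_pos (sub_pos.2 ha') (sub_pos.2 hw')]

theorem discMap_injOn {a : ℂ} (ha : ‖a‖ < 1) : InjOn (discMap a) (ball 0 1) := by
  intro u hu v hv h
  rw [mem_ball_zero_iff] at hu hv
  have h1 := one_sub_conj_mul_ne_zero ha hu
  have h2 := one_sub_conj_mul_ne_zero ha hv
  rw [discMap, discMap, div_eq_div_iff h1 h2] at h
  have h3 : (u - v) * (1 - (starRingEnd ℂ) a * a) = 0 := by linear_combination h
  exact sub_eq_zero.1 ((mul_eq_zero.1 h3).resolve_right (one_sub_conj_mul_ne_zero ha ha))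

theorem hasDerivAt_discMap {a w : ℂ} (ha : ‖a‖ < 1) (hw : ‖w‖ < 1) :
    HasDerivAt (discMap a) ((1 - (starRingEnd ℂ) a * a) / (1 - (starRingEnd ℂ) a * w) ^ 2) w := by
  have h1 := ((hasDerivAt_id w).sub_const a).div
    (((hasDerivAt_id w).const_mul ((starRingEnd ℂ) a)).const_sub 1)
    (one_sub_conj_mul_ne_zero ha hw)
  refine HasDerivAt.congr_deriv h1 ?_
  simp only [id]
  ring

/-- Injective holomorphic maps from `O` to the unit disc sending `z₀` to `0`. -/
structure DiscFamily (O : Set ℂ) (z₀ : ℂ) (g : ℂ → ℂ) : Prop where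
  diff : DifferentiableOn ℂ g O
  inj : InjOn g O
  maps : MapsTo g O (ball 0 1)
  base : g z₀ = 0

theorem tendstoLocallyUniformlyOn_of_bounded {O : Set ℂ} (hO : IsOpen O) {ι : Type*}
    {U : Filter ι} [U.NeBot] {g : ι → ℂ → ℂ} {G : ℂ → ℂ} (hd : ∀ n, DifferentiableOn ℂ (g n) O)
    (hm : ∀ n, MapsTo (g n) O (ball 0 1)) (hG : ∀ z ∈ O, Tendsto (fun n => g n z) U (𝓝 (G z))) :
    TendstoLocallyUniformlyOn g G U O := by
  rw [Metric.tendstoLocallyUniformlyOn_iff]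
  intro ε hε z hz
  obtain ⟨r, hr, hrO⟩ := Metric.isOpen_iff.1 hO z hz
  have hlip : ∀ n, ∀ w ∈ ball z r, dist (g n w) (g n z) ≤ 2 / r * dist w z := by
    intro n w hw
    refine Complex.dist_le_div_mul_dist_of_mapsTo_ball ((hd n).mono hrO) (fun x hx => ?_) hw
    have h1 := hm n (hrO hx)
    have h2 := hm n hz
    rw [mem_ball_zero_iff] at h1 h2
    rw [mem_closedBall, dist_eq_norm]
    linarith [norm_sub_le (g n x) (g n z)]
  have hlipG : ∀ w ∈ ball z r, dist (G w) (G z) ≤ 2 / r * dist w z := fun w hw =>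
    le_of_tendsto ((hG w (hrO hw)).dist (hG z hz)) (Eventually.of_forall fun n => hlip n w hw)
  refine ⟨ball z (min r (ε * r / 8)), mem_nhdsWithin_of_mem_nhds
    (ball_mem_nhds _ (lt_min hr (by positivity))), ?_⟩
  have h1 := (Metric.tendsto_nhds.1 (hG z hz)) (ε / 4) (by positivity)
  filter_upwards [h1] with n hn w hw
  rw [mem_ball, lt_min_iff] at hw
  have h2 := hlip n w hw.1
  have h3 := hlipG w hw.1
  have h4 : 2 / r * dist w z ≤ ε / 4 := by
    rw [div_mul_eq_mul_div, div_le_iff₀ hr]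
    linarith
  have h5 := dist_triangle4 (G w) (G z) (g n z) (g n w)
  rw [dist_comm (G z) (g n z), dist_comm (g n z) (g n w)] at h5
  linarith

/-- Hurwitz: a nonconstant locally uniform limit of injective holomorphic maps is injective. -/
theorem injOn_of_tendstoLocallyUniformlyOn {O : Set ℂ} (hO : IsOpen O) (hO' : IsPreconnected O)
    {ι : Type*} {U : Filter ι} [U.NeBot] {g : ι → ℂ → ℂ} {G : ℂ → ℂ}
    (hd : ∀ n, DifferentiableOn ℂ (g n) O) (hinj : ∀ n, InjOn (g n) O)
    (hG : TendstoLocallyUniformlyOn g G U O) {z₀ : ℂ} (hz₀ : z₀ ∈ O) (hne : deriv G z₀ ≠ 0) :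
    InjOn G O := by
  have hGd : DifferentiableOn ℂ G O := hG.differentiableOn (Eventually.of_forall hd) hO
  have hGa : AnalyticOnNhd ℂ G O := hGd.analyticOnNhd hO
  intro z₁ hz₁ z₂ hz₂ heq
  by_contra hz
  have hiso : ∀ᶠ w in 𝓝[≠] z₂, G w - G z₁ ≠ 0 := by
    rcases ((hGa z₂ hz₂).sub analyticAt_const).eventually_eq_zero_or_eventually_ne_zero with h | h
    · exfalso
      have h1 : EqOn G (fun _ => G z₁) O := hGa.eqOn_of_preconnected_of_eventuallyEq
        analyticOnNhd_const hO' hz₂ (h.mono fun w hw => sub_eq_zero.1 hw)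
      refine hne ?_
      rw [(h1.eventuallyEq_of_mem (hO.mem_nhds hz₀)).deriv_eq, deriv_const]
    · exact h
  rw [eventually_nhdsWithin_iff] at hiso
  have hO2 : O ∩ {z₁}ᶜ ∈ 𝓝 z₂ := inter_mem (hO.mem_nhds hz₂) (isOpen_ne.mem_nhds (Ne.symm hz))
  obtain ⟨r, hr, hrO⟩ := nhds_basis_closedBall.mem_iff.1 (inter_mem hO2 hiso)
  have hsO : closedBall z₂ r ⊆ O := fun w hw => (hrO hw).1.1
  have hsph : ∀ w ∈ sphere z₂ r, G w - G z₁ ≠ 0 := fun w hw =>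
    (hrO (sphere_subset_closedBall hw)).2 (ne_of_mem_sphere hw hr.ne')
  obtain ⟨m, hm, hmin⟩ : ∃ m > 0, ∀ w ∈ sphere z₂ r, m ≤ ‖G w - G z₁‖ := by
    obtain ⟨w₀, hw₀, hmin⟩ := (isCompact_sphere z₂ r).exists_isMinOn
      (NormedSpace.sphere_nonempty.2 hr.le)
      (((hGd.continuousOn.mono (sphere_subset_closedBall.trans hsO)).sub
        continuousOn_const).norm (f := fun w => G w - G z₁))
    exact ⟨_, norm_pos_iff.2 (hsph w₀ hw₀), fun w hw => hmin hw⟩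
  have hunif : TendstoUniformlyOn g G U (insert z₁ (closedBall z₂ r)) :=
    (tendstoLocallyUniformlyOn_iff_forall_isCompact hO).1 hG _ (insert_subset hz₁ hsO)
      ((isCompact_closedBall z₂ r).insert z₁)
  obtain ⟨n, hn⟩ := ((Metric.tendstoUniformlyOn_iff.1 hunif) (m / 8) (by positivity)).exists
  simp only [dist_eq_norm] at hn
  have hn1 := hn z₁ (mem_insert _ _)
  have hb : ∀ w ∈ closedBall z₂ r, ‖(G w - G z₁) - (g n w - g n z₁)‖ ≤ m / 4 := by
    intro w hw
    have h1 := hn w (mem_insert_of_mem _ hw)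
    have h2 := norm_sub_le (G w - g n w) (G z₁ - g n z₁)
    calc _ = ‖(G w - g n w) - (G z₁ - g n z₁)‖ := by ring_nf
      _ ≤ _ := by linarith
  have hnz : ∀ w ∈ closedBall z₂ r, g n w - g n z₁ ≠ 0 := fun w hw h =>
    (hrO hw).1.2 (hinj n (hsO hw) hz₁ (sub_eq_zero.1 h))
  have hdd : DiffContOnCl ℂ (fun w => (g n w - g n z₁)⁻¹) (ball z₂ r) := by
    refine DifferentiableOn.diffContOnCl ?_
    rw [closure_ball _ hr.ne']
    exact (((hd n).mono hsO).sub_const _).inv hnz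
  have h3 := Complex.norm_le_of_forall_mem_frontier_norm_le isBounded_ball hdd (C := 4 / (3 * m))
    (fun w hw => ?_) (subset_closure (mem_ball_self hr))
  · rw [norm_inv, inv_le_comm₀ (norm_pos_iff.2 (hnz z₂ (mem_closedBall_self hr.le)))
      (by positivity), inv_div] at h3
    have h4 := hb z₂ (mem_closedBall_self hr.le)
    rw [heq, sub_self, zero_sub, norm_neg] at h4
    linarith
  · rw [frontier_ball _ hr.ne'] at hw
    rw [norm_inv, inv_le_comm₀ (norm_pos_iff.2 (hnz w (sphere_subset_closedBall hw)))
      (by positivity), inv_div]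
    have h4 := hb w (sphere_subset_closedBall hw)
    have h5 := hmin w hw
    have h6 := norm_sub_norm_le (G w - G z₁) (g n w - g n z₁)
    linarith

theorem exists_extremal {O : Set ℂ} (hO : IsOpen O) (hO' : IsPreconnected O)
    (hb : Bornology.IsBounded O) {z₀ : ℂ} (hz₀ : z₀ ∈ O) :
    ∃ G, DiscFamily O z₀ G ∧ deriv G z₀ ≠ 0 ∧
      ∀ g, DiscFamily O z₀ g → ‖deriv g z₀‖ ≤ ‖deriv G z₀‖ := by
  obtain ⟨r, hr, hrO⟩ := Metric.isOpen_iff.1 hO z₀ hz₀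
  set S := {t | ∃ g, DiscFamily O z₀ g ∧ t = ‖deriv g z₀‖} with hS
  have hbdd : BddAbove S := by
    refine ⟨1 / r, ?_⟩
    rintro _ ⟨g, hg, rfl⟩
    refine Complex.norm_deriv_le_div_of_mapsTo_ball (hg.diff.mono hrO) (fun z hz => ?_) hr
    rw [hg.base]
    exact ball_subset_closedBall (hg.maps (hrO hz))
  obtain ⟨t₀, ht₀, hpos⟩ : ∃ t ∈ S, 0 < t := by
    obtain ⟨R, hR, hRb⟩ := hb.subset_ball_lt 0 z₀
    have hd : ∀ z, HasDerivAt (fun w => (w - z₀) / (R : ℂ)) (1 / R) z := fun z =>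
      ((hasDerivAt_id z).sub_const z₀).div_const (R : ℂ)
    have hR' : (R : ℂ) ≠ 0 := by exact_mod_cast hR.ne'
    refine ⟨_, ⟨fun w => (w - z₀) / (R : ℂ), ⟨fun z _ =>
      (hd z).differentiableAt.differentiableWithinAt, fun u _ v _ h => ?_, fun u hu => ?_, by simp⟩,
      rfl⟩, ?_⟩
    · simpa [div_left_inj' hR'] using h
    · have := hRb hu
      rw [mem_ball, dist_eq_norm] at this
      rw [mem_ball_zero_iff, norm_div, norm_real, Real.norm_of_nonneg hR.le]
      exact (div_lt_one hR).2 this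
    · rw [(hd z₀).deriv]
      exact norm_pos_iff.2 (one_div_ne_zero hR')
  obtain ⟨u, -, hu, huS⟩ := exists_seq_tendsto_sSup ⟨t₀, ht₀⟩ hbdd
  choose g hg hgu using huS
  have hlim : ∀ z ∈ O, ∃ w ∈ closedBall (0 : ℂ) 1,
      Tendsto (fun n => g n z) (hyperfilter ℕ : Filter ℕ) (𝓝 w) := by
    intro z hz
    refine (isCompact_closedBall (0 : ℂ) 1).ultrafilter_le_nhds' ((hyperfilter ℕ).map _) ?_
    exact Ultrafilter.mem_map.2 (univ_mem' fun n => ball_subset_closedBall ((hg n).maps hz))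
  choose! G hG1 hG using hlim
  have hloc := tendstoLocallyUniformlyOn_of_bounded hO (fun n => (hg n).diff)
    (fun n => (hg n).maps) hG
  have hGd : DifferentiableOn ℂ G O :=
    hloc.differentiableOn (Eventually.of_forall fun n => (hg n).diff) hO
  have hder := (hloc.deriv (Eventually.of_forall fun n => (hg n).diff) hO).tendsto_at hz₀
  have hnorm : ‖deriv G z₀‖ = sSup S := by
    refine tendsto_nhds_unique hder.norm ?_
    simp only [Function.comp_apply, ← hgu]
    exact hu.mono_left Nat.hyperfilter_le_atTop
  have hne : deriv G z₀ ≠ 0 := by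
    rw [← norm_pos_iff, hnorm]
    exact hpos.trans_le (le_csSup hbdd ht₀)
  have hinj := injOn_of_tendstoLocallyUniformlyOn hO hO' (fun n => (hg n).diff)
    (fun n => (hg n).inj) hloc hz₀ hne
  refine ⟨G, ⟨hGd, hinj, ?_, ?_⟩, hne, fun h hh => hnorm ▸ le_csSup hbdd ⟨h, hh, rfl⟩⟩
  · have h1 : G '' O ⊆ interior (closedBall 0 1) :=
      interior_maximal (image_subset_iff.2 hG1) (isOpen_image_of_injOn hO hGd hinj)
    rw [interior_closedBall _ one_ne_zero] at h1
    exact mapsTo_iff_image_subset.2 h1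
  · refine tendsto_nhds_unique (hG z₀ hz₀) ?_
    simp only [(hg _).base]
    exact tendsto_const_nhds

theorem image_eq_ball_of_extremal {O : Set ℂ} (hO : IsOpen O) (hO' : IsConnected O)
    (hb : Bornology.IsBounded O) (hOc : IsPreconnected Oᶜ) {z₀ : ℂ} (hz₀ : z₀ ∈ O) {G : ℂ → ℂ}
    (hG : DiscFamily O z₀ G) (hne : deriv G z₀ ≠ 0)
    (hmax : ∀ g, DiscFamily O z₀ g → ‖deriv g z₀‖ ≤ ‖deriv G z₀‖) : G '' O = ball 0 1 := by
  refine (mapsTo_iff_image_subset.1 hG.maps).antisymm fun a ha => ?_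
  by_contra hcon
  rw [mem_ball_zero_iff] at ha
  have ha0 : a ≠ 0 := by
    rintro rfl
    exact hcon ⟨z₀, hz₀, hG.base⟩
  have hGn : ∀ z ∈ O, ‖G z‖ < 1 := fun z hz => mem_ball_zero_iff.1 (hG.maps hz)
  set h : ℂ → ℂ := discMap a ∘ G with hh
  have hhd : DifferentiableOn ℂ h O := fun z hz =>
    (hasDerivAt_discMap ha (hGn z hz)).differentiableAt.comp_differentiableWithinAt z
      (hG.diff z hz)
  have hhinj : InjOn h O := (discMap_injOn ha).comp hG.inj hG.maps
  have hh0 : (0 : ℂ) ∉ h '' O := by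
    rintro ⟨z, hz, hz0⟩
    have h1 := (div_eq_zero_iff.1 hz0).resolve_right (one_sub_conj_mul_ne_zero ha (hGn z hz))
    exact hcon ⟨z, hz, sub_eq_zero.1 h1⟩
  obtain ⟨l, hl, hlh⟩ := exists_log_of_isPreconnected_compl hO hO' hb hOc hhd hhinj hh0
  simp only [sub_zero] at hlh
  have hld := differentiableOn_of_exp_eq hO hhd hl hlh
  set s : ℂ → ℂ := fun z => exp (l z / 2) with hs
  have hsq : ∀ z ∈ O, s z ^ 2 = h z := fun z hz => by
    rw [← hlh z hz, hs, ← exp_nat_mul]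
    congr 1
    push_cast
    ring
  have hsd : DifferentiableOn ℂ s O := (hld.div_const 2).cexp
  have hsn : ∀ z ∈ O, ‖s z‖ < 1 := fun z hz => by
    have h1 := norm_discMap_lt_one ha (hGn z hz)
    have h2 : ‖s z‖ ^ 2 < 1 := by rw [← norm_pow, hsq z hz]; exact h1
    exact (sq_lt_one_iff₀ (norm_nonneg _)).1 h2
  have hsinj : InjOn s O := fun u hu v hv huv =>
    hhinj hu hv (by rw [← hsq u hu, ← hsq v hv, huv])
  set b := s z₀ with hbdef
  have hbn : ‖b‖ < 1 := hsn z₀ hz₀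
  have hb0 : b ≠ 0 := exp_ne_zero _
  have hbsq : b ^ 2 = -a := by
    rw [hbdef, hsq z₀ hz₀, hh, Function.comp_apply, hG.base, discMap]
    simp
  have hk : DiscFamily O z₀ (discMap b ∘ s) := by
    refine ⟨fun z hz => (hasDerivAt_discMap hbn (hsn z hz)).differentiableAt.comp_differentiableWithinAt z
      (hsd z hz), (discMap_injOn hbn).comp hsinj fun z hz => mem_ball_zero_iff.2 (hsn z hz),
      fun z hz => mem_ball_zero_iff.2 (norm_discMap_lt_one hbn (hsn z hz)), ?_⟩
    simp [discMap, hbdef]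
  have hOz := hO.mem_nhds hz₀
  have hsder : HasDerivAt s (deriv s z₀) z₀ := (hsd.differentiableAt hOz).hasDerivAt
  have hGder : HasDerivAt G (deriv G z₀) z₀ := (hG.diff.differentiableAt hOz).hasDerivAt
  have hkder : deriv (discMap b ∘ s) z₀ = (1 - (starRingEnd ℂ) b * b)⁻¹ * deriv s z₀ := by
    rw [((hasDerivAt_discMap hbn hbn).comp z₀ hsder).deriv]
    congr 1
    field_simp [one_sub_conj_mul_ne_zero hbn hbn]
  have hhder : deriv h z₀ = (1 - (starRingEnd ℂ) a * a) * deriv G z₀ := by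
    have h1 := (hasDerivAt_discMap ha (w := G z₀) (by simp [hG.base])).comp z₀ hGder
    rw [h1.deriv, hG.base]
    simp
  have hhder2 : deriv h z₀ = 2 * b * deriv s z₀ := by
    have h1 : HasDerivAt h (2 * b * deriv s z₀) z₀ := by
      refine ((hsder.pow 2).congr_of_eventuallyEq ?_).congr_deriv (by simp [hbdef])
      filter_upwards [hOz] with z hz using (hsq z hz).symm
    exact h1.deriv
  have hle := hmax _ hk
  have hconj : ∀ c : ℂ, (starRingEnd ℂ) c * c = ((‖c‖ ^ 2 : ℝ) : ℂ) := fun c => by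
    rw [conj_mul']
    push_cast
    rfl
  have hnormone : ∀ c : ℂ, ‖c‖ < 1 → ‖1 - (starRingEnd ℂ) c * c‖ = 1 - ‖c‖ ^ 2 := fun c hc => by
    rw [hconj, ← ofReal_one, ← ofReal_sub, norm_real, Real.norm_of_nonneg]
    nlinarith [norm_nonneg c]
  have hab : ‖a‖ = ‖b‖ ^ 2 := by rw [← norm_neg, ← hbsq, norm_pow]
  rw [hkder, norm_mul, norm_inv, hnormone b hbn] at hle
  have heq : 2 * ‖b‖ * ‖deriv s z₀‖ = (1 - ‖a‖ ^ 2) * ‖deriv G z₀‖ := by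
    have := congrArg norm (hhder2.symm.trans hhder)
    simpa only [norm_mul, hnormone a ha, Complex.norm_ofNat] using this
  have hbpos : 0 < ‖b‖ := norm_pos_iff.2 hb0
  have hGpos : 0 < ‖deriv G z₀‖ := norm_pos_iff.2 hne
  have hb1 : 0 < 1 - ‖b‖ ^ 2 := by nlinarith
  rw [inv_mul_le_iff₀ hb1] at hle
  rw [hab] at heq
  have h3 : (1 - (‖b‖ ^ 2) ^ 2) * ‖deriv G z₀‖ ≤ 2 * ‖b‖ * ((1 - ‖b‖ ^ 2) * ‖deriv G z₀‖) := by
    rw [← heq]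
    gcongr
  have h4 : 0 < (1 - ‖b‖ ^ 2) * ‖deriv G z₀‖ := mul_pos hb1 hGpos
  nlinarith [mul_pos h4 (pow_pos (sub_pos.2 hbn) 2)]

/-- A bounded domain with connected complement is homeomorphic to the plane. -/
theorem exists_isOpenEmbedding_range_eq {O : Set ℂ} (hO : IsOpen O) (hO' : IsConnected O)
    (hb : Bornology.IsBounded O) (hOc : IsPreconnected Oᶜ) :
    ∃ e : ℂ → ℂ, IsOpenEmbedding e ∧ range e = O := by
  obtain ⟨z₀, hz₀⟩ := hO'.nonempty
  obtain ⟨G, hG, hne, hmax⟩ := exists_extremal hO hO'.2 hb hz₀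
  have him := image_eq_ball_of_extremal hO hO' hb hOc hz₀ hG hne hmax
  let H : OpenPartialHomeomorph ℂ ℂ := by
    refine OpenPartialHomeomorph.ofContinuousOpenRestrict (hG.inj.toPartialEquiv G O)
      hG.diff.continuousOn ?_ hO
    intro W hW
    obtain ⟨W', hW', rfl⟩ := isOpen_induced_iff.1 hW
    have h1 : (O.domRestrict G) '' (Subtype.val ⁻¹' W') = G '' (O ∩ W') := by
      ext y
      simp [and_comm]
    have h2 := isOpen_image_of_injOn (hO.inter hW') (hG.diff.mono inter_subset_left)
      (hG.inj.mono inter_subset_left)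
    rw [← h1] at h2
    exact h2
  let E : OpenPartialHomeomorph ℂ ℂ :=
    OpenPartialHomeomorph.univUnitBall.trans' H.symm him.symm
  refine ⟨E, E.isOpenEmbedding rfl, ?_⟩
  rw [← image_univ]
  exact E.image_source_eq_target

theorem isPreconnected_norm_ge {R : ℝ} (hR : 0 < R) : IsPreconnected {z : ℂ | R ≤ ‖z‖} := by
  have h : {z : ℂ | R ≤ ‖z‖} = exp '' {z | Real.log R ≤ z.re} := by
    ext z
    simp only [mem_ofPred_eq, mem_image]
    constructor
    · intro hz
      have hz0 : z ≠ 0 := norm_pos_iff.1 (hR.trans_le hz)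
      exact ⟨log z, by rw [log_re]; exact Real.log_le_log hR hz, exp_log hz0⟩
    · rintro ⟨w, hw, rfl⟩
      rw [norm_exp]
      exact (Real.log_le_iff_le_exp hR).1 hw
  rw [h]
  exact (convex_halfSpace_re_ge _).isPreconnected.image _ continuous_exp.continuousOn

/-- A compact connected set with connected complement has arbitrarily small neighbourhoods which
are bounded domains with connected complement. -/
theorem exists_cell {K N : Set ℂ} (hK : IsCompact K) (hK' : IsConnected K)
    (hKc : IsPreconnected Kᶜ) (hN : IsOpen N) (hKN : K ⊆ N) :
    ∃ O, IsOpen O ∧ IsConnected O ∧ Bornology.IsBounded O ∧ IsPreconnected Oᶜ ∧ K ⊆ O ∧ O ⊆ N := by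
  obtain ⟨R, hR, hRK⟩ := hK.isBounded.subset_ball_lt 0 0
  have hRn : ‖(R : ℂ)‖ = R := by rw [norm_real, Real.norm_of_nonneg hR.le]
  have hRm : (R : ℂ) ∈ Kᶜ := fun h => by
    have := hRK h
    rw [mem_ball_zero_iff, hRn] at this
    exact lt_irrefl _ this
  obtain ⟨T, hT, hT', hsub, hTK⟩ := exists_isCompact_isConnected_superset
    hK.isClosed.isOpen_compl ⟨⟨_, hRm⟩, hKc⟩
    (((isCompact_closedBall (0 : ℂ) R).inter_right hN.isClosed_compl).insert (R : ℂ))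
    (insert_subset hRm (inter_subset_right.trans (compl_subset_compl.2 hKN)))
  set Z := T ∪ {z : ℂ | R ≤ ‖z‖} with hZ
  have hZc : IsClosed Z := hT.isClosed.union (isClosed_le continuous_const continuous_norm)
  have hZp : IsPreconnected Z := IsPreconnected.union (R : ℂ) (hsub (mem_insert _ _)) hRn.ge hT'.2
    (isPreconnected_norm_ge hR)
  have hKZ : K ⊆ Zᶜ := fun z hz h => by
    rcases h with h | h
    · exact hTK h hz
    · exact (mem_ball_zero_iff.1 (hRK hz)).not_ge h
  obtain ⟨k, hk⟩ := hK'.nonempty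
  refine ⟨connectedComponentIn Zᶜ k, hZc.isOpen_compl.connectedComponentIn,
    isConnected_connectedComponentIn_iff.2 (hKZ hk), ?_, ?_,
    hK'.2.subset_connectedComponentIn hk hKZ, fun z hz => ?_⟩
  · refine (isBounded_ball (x := (0 : ℂ)) (r := R)).subset fun z hz => ?_
    rw [mem_ball_zero_iff]
    by_contra hcon
    exact connectedComponentIn_subset _ _ hz (Or.inr (not_lt.1 hcon))
  · refine isPreconnected_compl_of_components hZc hZp ⟨_, Or.inr hRn.ge⟩
      (subset_compl_iff_disjoint_right.1 (connectedComponentIn_subset _ _)) ?_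
    rintro S hS hSZ ⟨x, hxS, hx⟩
    rw [connectedComponentIn_eq hx]
    exact hS.subset_connectedComponentIn hxS (subset_compl_iff_disjoint_right.2 hSZ)
  · by_contra hzN
    have hzZ := connectedComponentIn_subset _ _ hz
    refine hzZ (Or.inl (hsub (mem_insert_of_mem _ ⟨?_, hzN⟩)))
    rw [mem_closedBall_zero_iff]
    by_contra hcon
    exact hzZ (Or.inr (not_le.1 hcon).le)

end Riemann

end TorusCircloid

namespace TorusCircloid

section Strips

open Set Filter Topology Complex Metric
open scoped Pointwise

theorem exp_two_pi_div_eq_one {k : ℝ} (hk : 0 < k) {z : ℂ} (h : exp (2 * Real.pi * I * (z / k)) = 1) :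
    ∃ j : ℤ, z = j * k := by
  obtain ⟨n, hn⟩ := exp_eq_one_iff.1 h
  refine ⟨n, ?_⟩
  have hk' : (k : ℂ) ≠ 0 := by exact_mod_cast hk.ne'
  have h1 : (2 * Real.pi * I : ℂ) ≠ 0 := two_pi_I_ne_zero
  have h2 : z / k = n := mul_left_cancel₀ h1 (by rw [hn]; ring)
  rw [← h2, div_mul_cancel₀ _ hk']

theorem norm_exp_two_pi_div (k : ℝ) (z : ℂ) :
    ‖exp (2 * Real.pi * I * (z / k))‖ = Real.exp (-(2 * Real.pi * (z.im / k))) := by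
  rw [norm_exp]
  congr 1
  have : (2 * Real.pi * I * (z / k) : ℂ) = ((2 * Real.pi : ℝ) : ℂ) * (I * (z / k)) := by
    push_cast; ring
  rw [this, re_ofReal_mul]
  simp

/-- If a periodic set in a horizontal strip does not separate the two ends of the strip, then it
carries a continuous `2πiℤ`-valued function which detects the period. -/
theorem exists_index {M : Set ℂ} {k : ℝ} (hk : 0 < k) (hper : ∀ z ∈ M, ∀ j : ℤ, z + j * k ∈ M)
    {x y : ℂ} (hx : ∀ z ∈ M, z.im < x.im) (hy : ∀ z ∈ M, y.im < z.im) (hj : JoinedIn Mᶜ y x) :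
    ∃ d : ℂ → ℂ, ContinuousOn d M ∧ (∀ z ∈ M, exp (d z) = 1) ∧
      ∀ z ∈ M, d (z + k) = d z + 2 * Real.pi * I := by
  obtain ⟨σ, hσ⟩ := hj
  have hk' : (k : ℂ) ≠ 0 := by exact_mod_cast hk.ne'
  have hperk : ∀ z ∈ M, z + k ∈ M := fun z hz => by simpa using hper z hz 1
  let u : ℂ → ℂ → ℂ := fun s z => exp (2 * Real.pi * I * ((z - s) / k))
  have huper : ∀ s z, u s (z + k) = u s z := fun s z => by
    have : (2 * Real.pi * I * ((z + k - s) / k) : ℂ)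
        = 2 * Real.pi * I * ((z - s) / k) + 2 * Real.pi * I := by field_simp; ring
    simp only [u]
    rw [this, exp_add, exp_two_pi_mul_I, mul_one]
  let H : unitInterval × M → ℂ := fun a => 1 - u (σ a.1) a.2
  have hH : Continuous H := by fun_prop
  have hH0 : ∀ a, H a ≠ 0 := by
    rintro ⟨s, z⟩ h
    obtain ⟨j, hj⟩ := exp_two_pi_div_eq_one hk (sub_eq_zero.1 h).symm
    refine hσ s ?_
    have := hper z z.2 (-j)
    have he : (z : ℂ) + (-j : ℤ) * k = σ s := by push_cast; linear_combination hj
    rwa [he] at this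
  have hslit : ∀ w : ℂ, ‖w‖ < 1 → 1 - w ∈ slitPlane := fun w hw => by
    refine Or.inl ?_
    rw [sub_re, one_re]
    linarith [(abs_lt.1 ((abs_re_le_norm w).trans_lt hw)).2]
  have hu0 : ∀ z ∈ M, ‖u y z‖ < 1 := fun z hz => by
    simp only [u]
    rw [norm_exp_two_pi_div, Real.exp_lt_one_iff, neg_lt_zero]
    have := hy z hz
    have : 0 < (z - y).im := by rw [sub_im]; linarith
    positivity
  have hu1 : ∀ z ∈ M, ‖(u x z)⁻¹‖ < 1 := fun z hz => by
    simp only [u]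
    rw [norm_inv, norm_exp_two_pi_div, ← Real.exp_neg, Real.exp_lt_one_iff, neg_neg]
    have := hx z hz
    have : 0 < (-(z - x).im) / k := div_pos (by rw [sub_im]; linarith) hk
    have := mul_pos Real.two_pi_pos this
    rw [neg_div] at this
    linarith
  obtain ⟨l, hl, hlH, hl0⟩ := exists_log_homotopy hH hH0 (l₀ := fun z : M => log (1 - u y z))
    (Continuous.clog (by fun_prop) fun z => hslit _ (hu0 z z.2))
    (fun z => by
      have hne := slitPlane_ne_zero (hslit _ (hu0 z z.2))
      rw [exp_log hne]
      simp [H])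
  obtain ⟨l₁, hl₁, hl₁e⟩ := exists_continuousOn_of_subtype
    (hl.comp (Continuous.prodMk_right (1 : unitInterval)))
  have hl₁per : ∀ z ∈ M, l₁ (z + k) = l₁ z := by
    intro z hz
    have h1 := sub_eq_sub_of_exp_eq (X := unitInterval) isPreconnected_univ
      (a := fun s => l (s, ⟨z + k, hperk z hz⟩)) (b := fun s => l (s, ⟨z, hz⟩))
      (by fun_prop) (by fun_prop)
      (fun s _ => by
        simp only [hlH, H]
        rw [huper]) (mem_univ 1) (mem_univ 0)
    rw [hl0, hl0, huper, sub_self] at h1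
    rw [hl₁e ⟨z, hz⟩, hl₁e ⟨z + k, hperk z hz⟩]
    exact sub_eq_zero.1 h1
  let m : ℂ → ℂ := fun z => 2 * Real.pi * I * ((z - x) / k) + Real.pi * I + log (1 - (u x z)⁻¹)
  refine ⟨fun z => m z - l₁ z, ContinuousOn.sub ?_ hl₁, fun z hz => ?_, fun z hz => ?_⟩
  · refine ContinuousOn.add (by fun_prop) (ContinuousOn.clog ?_ fun z hz => hslit _ (hu1 z hz))
    refine continuousOn_const.sub (ContinuousOn.inv₀ (by fun_prop) fun z _ => exp_ne_zero _)
  · have h1 : exp (l₁ z) = 1 - u x z := by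
      rw [hl₁e ⟨z, hz⟩, Function.comp_apply, hlH]
      simp [H]
    have h2 : exp (m z) = 1 - u x z := by
      have h0 : u x z ≠ 0 := exp_ne_zero _
      simp only [m]
      rw [exp_add, exp_add, exp_pi_mul_I, exp_log (slitPlane_ne_zero (hslit _ (hu1 z hz)))]
      change u x z * -1 * (1 - (u x z)⁻¹) = _
      field_simp
      ring
    rw [exp_sub, h1, h2, div_self]
    rw [← h1]
    exact exp_ne_zero _
  · simp only [m]
    rw [hl₁per z hz, huper]
    field_simp
    ring

/-- A connected periodic subset of a strip separates the two ends of the strip. -/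
theorem not_joinedIn_of_isPreconnected {M : Set ℂ} (hM : IsPreconnected M) (hne : M.Nonempty)
    {k : ℝ} (hk : 0 < k) (hper : ∀ z ∈ M, ∀ j : ℤ, z + j * k ∈ M)
    {x y : ℂ} (hx : ∀ z ∈ M, z.im < x.im) (hy : ∀ z ∈ M, y.im < z.im) : ¬ JoinedIn Mᶜ y x := by
  intro hj
  obtain ⟨d, hd, hd1, hdk⟩ := exists_index hk hper hx hy hj
  obtain ⟨z, hz⟩ := hne
  have h1 := eq_of_exp_eq_one hM hd hd1 (by simpa using hper z hz 1) hz
  rw [hdk z hz] at h1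
  exact two_pi_I_ne_zero (add_eq_left.1 h1)

/-- A closed connected `k`-periodic set in a strip, attaining its extreme heights at `p` and
`q`. -/
structure IsLine (k : ℝ) (l : Set ℂ) (p q : ℂ) : Prop where
  pre : IsPreconnected l
  closed : IsClosed l
  per : ∀ z ∈ l, ∀ j : ℤ, z + j * k ∈ l
  top : p ∈ l
  bot : q ∈ l
  le_top : ∀ z ∈ l, z.im ≤ p.im
  bot_le : ∀ z ∈ l, q.im ≤ z.im

theorem exists_isLine {X : Set ℂ} (hX : IsOpen X) (hX' : IsConnected X) {k : ℝ} (hk : 0 < k)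
    (hper : ∀ z ∈ X, ∀ j : ℤ, z + j * k ∈ X) : ∃ l p q, IsLine k l p q ∧ l ⊆ X := by
  obtain ⟨x, hx⟩ := hX'.nonempty
  have hpath := (hX.isConnected_iff_isPathConnected).1 hX'
  have hxk : x + k ∈ X := by simpa using hper x hx 1
  obtain ⟨γ, hγ⟩ := hpath.joinedIn x hx (x + k) hxk
  have hγc : IsCompact (range γ) := isCompact_range γ.continuous
  obtain ⟨p, hp, hpmax⟩ := hγc.exists_isMaxOn (range_nonempty γ) continuous_im.continuousOn
  obtain ⟨q, hq, hqmin⟩ := hγc.exists_isMinOn (range_nonempty γ) continuous_im.continuousOn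
  let l : Set ℂ := ⋃ j : ℤ, (fun z => z + j * k) '' range γ
  have hmem : ∀ z, z ∈ l ↔ ∃ j : ℤ, ∃ w ∈ range γ, w + j * k = z := fun z => by
    simp only [l, mem_iUnion, mem_image]
  have hl0 : range γ ⊆ l := fun z hz => (hmem z).2 ⟨0, z, hz, by simp⟩
  refine ⟨l, p, q, ⟨?_, ?_, ?_, hl0 hp, hl0 hq, ?_, ?_⟩, ?_⟩
  · refine IsPreconnected.iUnion_of_chain (fun j => ?_) fun j => ?_
    · exact (isPreconnected_range γ.continuous).image _ (by fun_prop)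
    · refine ⟨x + (j + 1) * k, ⟨x + k, ⟨1, γ.target⟩, by ring⟩, ⟨x, ⟨0, γ.source⟩, by simp⟩⟩
  · have h1 : IsClosed (range fun j : ℤ => (j * k : ℂ)) := by
      have h2 : IsClosed ((fun z : ℂ => z / k) ⁻¹' (range fun j : ℤ => (j : ℂ))) :=
        Complex.isClosed_range_intCast.preimage (by fun_prop)
      convert h2 using 1
      ext z
      have hk' : (k : ℂ) ≠ 0 := by exact_mod_cast hk.ne'
      simp [eq_div_iff hk']
    convert h1.add_left_of_isCompact hγc using 1
    ext z
    rw [hmem, Set.mem_add]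
    constructor
    · rintro ⟨j, w, hw, h⟩
      exact ⟨w, hw, _, ⟨j, rfl⟩, h⟩
    · rintro ⟨w, hw, _, ⟨j, rfl⟩, h⟩
      exact ⟨j, w, hw, h⟩
  · intro z hz j
    obtain ⟨i, w, hw, rfl⟩ := (hmem z).1 hz
    exact (hmem _).2 ⟨i + j, w, hw, by push_cast; ring⟩
  · intro z hz
    obtain ⟨i, w, hw, rfl⟩ := (hmem z).1 hz
    simpa using hpmax hw
  · intro z hz
    obtain ⟨i, w, hw, rfl⟩ := (hmem z).1 hz
    simpa using hqmin hw
  · intro z hz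
    obtain ⟨i, w, ⟨s, rfl⟩, rfl⟩ := (hmem z).1 hz
    exact hper _ (hγ s) i

theorem isPreconnected_verticalRay (x : ℂ) (ε : ℝ) :
    IsPreconnected {z : ℂ | ∃ t : ℝ, 0 ≤ t ∧ z = x + ε * t * I} := by
  have h : {z : ℂ | ∃ t : ℝ, 0 ≤ t ∧ z = x + ε * t * I}
      = (fun t : ℝ => x + ε * t * I) '' Ici 0 := by
    ext z
    simp [eq_comm]
  rw [h]
  exact isPreconnected_Ici.image _ (by fun_prop)

/-- The component of the complement of `W` containing the upper (for `ε = 1`) or lower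
(for `ε = -1`) end of the plane. -/
def side (ε : ℝ) (W : Set ℂ) : Set ℂ :=
  {z | ∃ S, ∃ r : ℝ, IsPreconnected S ∧ Disjoint S W ∧ z ∈ S ∧ {w : ℂ | r < ε * w.im} ⊆ S}

theorem side_disjoint (ε : ℝ) (W : Set ℂ) : Disjoint (side ε W) W := by
  rw [Set.disjoint_left]
  rintro z ⟨S, r, -, hd, hz, -⟩ hzW
  exact Set.disjoint_left.1 hd hz hzW

theorem halfPlane_subset_side {ε r : ℝ} {S W : Set ℂ} (hS : IsPreconnected S)
    (hd : Disjoint S W) (h : {w : ℂ | r < ε * w.im} ⊆ S) : S ⊆ side ε W :=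
  fun _ hz => ⟨S, r, hS, hd, hz, h⟩

theorem exists_gt_of_sq_eq_one {ε : ℝ} (hε : ε ^ 2 = 1) (r : ℝ) : ∃ w : ℂ, r < ε * w.im := by
  refine ⟨(ε * (r + 1) : ℝ) * I, ?_⟩
  have : ε * ((ε * (r + 1) : ℝ) * I : ℂ).im = ε ^ 2 * (r + 1) := by simp; ring
  rw [this, hε]
  linarith

theorem isPreconnected_side {ε : ℝ} (hε : ε ^ 2 = 1) (W : Set ℂ) : IsPreconnected (side ε W) := by
  refine isPreconnected_of_forall_pair ?_
  rintro x ⟨S, r, hS, hd, hx, hr⟩ y ⟨T, t, hT, hd', hy, ht⟩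
  obtain ⟨w, hw⟩ := exists_gt_of_sq_eq_one hε (max r t)
  refine ⟨S ∪ T, union_subset (halfPlane_subset_side hS hd hr) (halfPlane_subset_side hT hd' ht),
    Or.inl hx, Or.inr hy, IsPreconnected.union w (hr ((le_max_left _ _).trans_lt hw))
      (ht ((le_max_right _ _).trans_lt hw)) hS hT⟩

theorem subset_side {ε : ℝ} {W S : Set ℂ} (hS : IsPreconnected S) (hd : Disjoint S W)
    (hne : (S ∩ side ε W).Nonempty) : S ⊆ side ε W := by
  obtain ⟨x, hxS, T, r, hT, hdT, hxT, hr⟩ := hne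
  exact subset_union_left.trans (halfPlane_subset_side (IsPreconnected.union x hxS hxT hS hT)
    (hd.union_left hdT) (hr.trans subset_union_right))

theorem side_anti {ε : ℝ} {W W' : Set ℂ} (h : W ⊆ W') : side ε W' ⊆ side ε W := by
  rintro z ⟨S, r, hS, hd, hz, hr⟩
  exact ⟨S, r, hS, hd.mono_right h, hz, hr⟩

theorem isOpen_side {ε : ℝ} {W : Set ℂ} (hW : IsClosed W) : IsOpen (side ε W) := by
  rw [isOpen_iff_mem_nhds]
  intro z hz
  have hzW : z ∈ Wᶜ := fun h => Set.disjoint_left.1 (side_disjoint ε W) hz h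
  refine mem_of_superset (hW.isOpen_compl.connectedComponentIn.mem_nhds
    (mem_connectedComponentIn hzW)) (subset_side isPreconnected_connectedComponentIn
    (subset_compl_iff_disjoint_right.1 (connectedComponentIn_subset _ _))
    ⟨z, mem_connectedComponentIn hzW, hz⟩)

theorem isPreconnected_halfPlane (ε r : ℝ) : IsPreconnected {w : ℂ | r < ε * w.im} :=
  (convex_halfSpace_gt (f := fun w : ℂ => ε * w.im)
    ⟨fun _ _ => by simp [mul_add], fun c _ => by simp; ring⟩ r).isPreconnected

theorem halfPlane_subset_side_of_bound {ε c : ℝ} {W : Set ℂ} (h : ∀ z ∈ W, ε * z.im ≤ c) :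
    {w : ℂ | c < ε * w.im} ⊆ side ε W :=
  halfPlane_subset_side (isPreconnected_halfPlane ε c)
    (Set.disjoint_left.2 fun z hz hzW => not_lt.2 (h z hzW) hz) subset_rfl

theorem closure_side_subset {ε : ℝ} (hε : ε ^ 2 = 1) (W : Set ℂ) :
    closure (side ε W) ⊆ side ε W ∪ W := by
  intro z hz
  by_cases hzW : z ∈ W
  · exact Or.inr hzW
  left
  have h1 : IsPreconnected (insert z (side ε W)) :=
    (isPreconnected_side hε W).subset_closure (subset_insert _ _)
      (insert_subset hz subset_closure)
  have h2 : (side ε W).Nonempty := closure_nonempty_iff.1 ⟨z, hz⟩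
  obtain ⟨w, hw⟩ := h2
  refine subset_side h1 ?_ ⟨w, mem_insert_of_mem _ hw, hw⟩ (mem_insert _ _)
  rw [Set.disjoint_left]
  rintro v (rfl | hv) hvW
  · exact hzW hvW
  · exact Set.disjoint_left.1 (side_disjoint ε W) hv hvW

theorem isPreconnected_compl_side {ε : ℝ} {W : Set ℂ} (hW : IsClosed W)
    (hW' : IsPreconnected W) (hne : W.Nonempty) : IsPreconnected (side ε W)ᶜ :=
  isPreconnected_compl_of_components hW hW' hne (side_disjoint ε W) fun _ h1 h2 h3 =>
    subset_side h1 h2 h3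

theorem abs_eq_one_of_sq {ε : ℝ} (hε : ε ^ 2 = 1) : |ε| = 1 := by
  rwa [← pow_eq_one_iff_of_nonneg (abs_nonneg ε) two_ne_zero, sq_abs]

theorem image_side_subset {ε : ℝ} (hε : ε ^ 2 = 1) {g : ℂ ≃ₜ ℂ} (hg : BddDisp g) (W : Set ℂ) :
    g '' side ε W ⊆ side ε (g '' W) := by
  rintro _ ⟨z, ⟨S, r, hS, hd, hz, hr⟩, rfl⟩
  obtain ⟨C, hC⟩ := hg
  refine ⟨g '' S, r + C, hS.image g g.continuous.continuousOn,
    (disjoint_image_iff g.injective).2 hd, ⟨z, hz, rfl⟩, fun w hw => ?_⟩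
  refine ⟨g.symm w, hr ?_, g.apply_symm_apply w⟩
  have h1 := hC (g.symm w)
  rw [g.apply_symm_apply] at h1
  have h2 : |ε * (w - g.symm w).im| ≤ C := by
    rw [abs_mul, abs_eq_one_of_sq hε, one_mul]
    exact (abs_im_le_norm _).trans h1
  rw [sub_im, mul_sub] at h2
  have h3 : r + C < ε * w.im := hw
  change r < ε * (g.symm w).im
  linarith [(abs_le.1 h2).2]

theorem image_side {ε : ℝ} (hε : ε ^ 2 = 1) {g : ℂ ≃ₜ ℂ} (hg : BddDisp g) (W : Set ℂ) :
    g '' side ε W = side ε (g '' W) := by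
  refine (image_side_subset hε hg W).antisymm fun z hz => ?_
  have h1 := image_side_subset hε hg.symm (g '' W) ⟨z, hz, rfl⟩
  rw [image_image] at h1
  simp only [Homeomorph.symm_apply_apply, image_id'] at h1
  exact ⟨g.symm z, h1, g.apply_symm_apply z⟩

end Strips

end TorusCircloid

namespace TorusCircloid

section Bands

open Set Filter Topology Complex Metric

theorem neg_one_sq_real : (-1 : ℝ) ^ 2 = 1 := by norm_num

theorem mem_side_of_forall_le {ε : ℝ} (hε : ε ^ 2 = 1) {W : Set ℂ} {x : ℂ} (hx : x ∉ W)
    (h : ∀ z ∈ W, ε * z.im ≤ ε * x.im) : x ∈ side ε W := by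
  have him : ∀ t : ℝ, ε * (x + ε * t * I).im = ε * x.im + t := fun t => by
    have : (x + ε * t * I).im = x.im + ε * t := by simp
    rw [this]
    linear_combination t * hε
  refine subset_side (isPreconnected_verticalRay x ε) ?_ ⟨x + ε * (1 : ℝ) * I,
    ⟨1, zero_le_one, rfl⟩, halfPlane_subset_side_of_bound h ?_⟩ ⟨0, le_rfl, by simp⟩
  · rw [Set.disjoint_left]
    rintro z ⟨t, ht, rfl⟩ hz
    have h1 := h _ hz
    rw [him] at h1
    obtain rfl : t = 0 := le_antisymm (by linarith) ht
    exact hx (by simpa using hz)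
  · change _ < ε * _
    rw [him]
    linarith

theorem side_nonempty_of_bound {ε c : ℝ} (hε : ε ^ 2 = 1) {W : Set ℂ}
    (h : ∀ z ∈ W, ε * z.im ≤ c) : (side ε W).Nonempty := by
  obtain ⟨w, hw⟩ := exists_gt_of_sq_eq_one hε c
  exact ⟨w, halfPlane_subset_side_of_bound h hw⟩

theorem joinedIn_of_side_inter {W : Set ℂ} (hW : IsClosed W) {x y : ℂ} (hx : x ∈ side 1 W)
    (hy : y ∈ side (-1) W) (h : (side 1 W ∩ side (-1) W).Nonempty) : JoinedIn Wᶜ y x := by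
  obtain ⟨z, hz, hz'⟩ := h
  have h1 : side (-1) W ⊆ side 1 W :=
    subset_side (isPreconnected_side neg_one_sq_real W) (side_disjoint _ _) ⟨z, hz', hz⟩
  have h2 : IsPathConnected (side 1 W) := ((isOpen_side hW).isConnected_iff_isPathConnected).1
    ⟨⟨z, hz⟩, isPreconnected_side (one_pow 2) W⟩
  exact (h2.joinedIn y (h1 hy) x hx).mono (subset_compl_iff_disjoint_right.2 (side_disjoint _ _))

theorem IsLine.disjoint_sides {k : ℝ} {l : Set ℂ} {p q : ℂ} (hk : 0 < k) (h : IsLine k l p q) :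
    Disjoint (side 1 l) (side (-1) l) := by
  rw [Set.disjoint_iff_inter_eq_empty]
  by_contra hne
  obtain ⟨x, hx⟩ := exists_gt_of_sq_eq_one (one_pow 2) p.im
  obtain ⟨y, hy⟩ := exists_gt_of_sq_eq_one neg_one_sq_real (-q.im)
  have h1 : x ∈ side 1 l := halfPlane_subset_side_of_bound
    (fun z hz => by rw [one_mul]; exact h.le_top z hz) hx
  have h2 : y ∈ side (-1) l := halfPlane_subset_side_of_bound
    (fun z hz => by linarith [h.bot_le z hz]) hy
  refine not_joinedIn_of_isPreconnected h.pre ⟨p, h.top⟩ hk h.per (fun z hz => ?_)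
    (fun z hz => ?_) (joinedIn_of_side_inter h.closed h1 h2 (nonempty_iff_ne_empty.2 hne))
  · linarith [h.le_top z hz]
  · linarith [h.bot_le z hz]

theorem inter_side_nonempty {ε : ℝ} (hε : ε ^ 2 = 1) {X W : Set ℂ} (hX : IsOpen X)
    (hWX : W ⊆ X) (hW : IsClosed W) (hne : W.Nonempty) (hs : (side ε W).Nonempty) :
    (X ∩ side ε W).Nonempty := by
  by_contra hcon
  have h1 : closure (side ε W) ⊆ Xᶜ :=
    closure_minimal (fun z hz hzX => hcon ⟨z, hzX, hz⟩) hX.isClosed_compl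
  have h2 : IsClosed (side ε W) := isClosed_of_closure_subset fun z hz =>
    (closure_side_subset hε W hz).resolve_right fun hzW => h1 hz (hWX hzW)
  rcases isClopen_iff.1 ⟨h2, isOpen_side hW⟩ with h3 | h3
  · exact hs.ne_empty h3
  · obtain ⟨w, hw⟩ := hne
    exact Set.disjoint_left.1 (side_disjoint ε W) (h3 ▸ mem_univ w) hw

/-- A domain in a horizontal strip invariant under `z ↦ z + 1`. -/
structure IsBand (X : Set ℂ) : Prop where
  isOpen : IsOpen X
  conn : IsConnected X
  per : ∀ z ∈ X, ∀ j : ℤ, z + j ∈ X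
  bdd : ∃ c : ℝ, ∀ z ∈ X, |z.im| ≤ c

theorem IsBand.exists_isLine {X : Set ℂ} (hX : IsBand X) : ∃ l p q, IsLine 1 l p q ∧ l ⊆ X :=
  TorusCircloid.exists_isLine hX.isOpen hX.conn one_pos (by simpa using hX.per)

theorem IsLine.side_nonempty {k : ℝ} {l : Set ℂ} {p q : ℂ} (h : IsLine k l p q) {ε : ℝ}
    (hε : ε ^ 2 = 1) : (side ε l).Nonempty := by
  refine side_nonempty_of_bound (c := max (|p.im|) |q.im|) hε fun z hz => ?_
  have h1 := h.le_top z hz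
  have h2 := h.bot_le z hz
  calc ε * z.im ≤ |ε * z.im| := le_abs_self _
    _ = |z.im| := by rw [abs_mul, abs_eq_one_of_sq hε, one_mul]
    _ ≤ _ := by
      rw [abs_le]
      constructor
      · linarith [neg_abs_le q.im, le_max_right (|p.im|) |q.im|]
      · linarith [le_abs_self p.im, le_max_left (|p.im|) |q.im|]

/-- The region strictly above a band. -/
def above (X : Set ℂ) : Set ℂ := side 1 (closure X)

/-- The lower complementary domain of the circloid at the top of a band. -/
def lowerDomain (X : Set ℂ) : Set ℂ := side (-1) (closure (above X))

/-- The upper complementary domain of the circloid at the top of a band. -/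
def upperDomain (X : Set ℂ) : Set ℂ := side 1 (closure (lowerDomain X))

variable {X Y l m : Set ℂ} {p q p' q' : ℂ}

theorem halfPlane_subset_above {c : ℝ} (hc : ∀ z ∈ X, |z.im| ≤ c) :
    {w : ℂ | c < 1 * w.im} ⊆ above X := by
  refine halfPlane_subset_side_of_bound fun z hz => ?_
  have : X ⊆ im ⁻¹' Iic c := fun w hw => (le_abs_self _).trans (hc w hw)
  simpa using closure_minimal this (isClosed_Iic.preimage continuous_im) hz

theorem closure_above_subset (hX : IsBand X) (hlX : l ⊆ X) :
    closure (above X) ⊆ side 1 l := by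
  have h1 : above X ⊆ side 1 l := side_anti (hlX.trans subset_closure)
  have h2 : Disjoint (closure (above X)) X := by
    refine Disjoint.closure_left ?_ hX.isOpen
    exact (side_disjoint 1 (closure X)).mono_right subset_closure
  obtain ⟨c, hc⟩ := hX.bdd
  obtain ⟨w, hw⟩ := exists_gt_of_sq_eq_one (one_pow 2) c
  have hw' := halfPlane_subset_above hc hw
  exact subset_side (isPreconnected_side (one_pow 2) _).closure (h2.mono_right hlX)
    ⟨w, subset_closure hw', h1 hw'⟩

theorem side_subset_lowerDomain (hX : IsBand X) (hl : IsLine 1 l p q) (hlX : l ⊆ X) :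
    side (-1) l ⊆ lowerDomain X := by
  refine halfPlane_subset_side (r := -q.im) (isPreconnected_side neg_one_sq_real l) ?_ ?_
  · exact ((hl.disjoint_sides one_pos).mono_left (closure_above_subset hX hlX)).symm
  · exact halfPlane_subset_side_of_bound fun z hz => by linarith [hl.bot_le z hz]

theorem subset_lowerDomain (hX : IsBand X) : X ⊆ lowerDomain X := by
  obtain ⟨l, p, q, hl, hlX⟩ := hX.exists_isLine
  refine subset_side hX.conn.2 ?_ ?_
  · refine (Disjoint.closure_left ?_ hX.isOpen).symm
    exact (side_disjoint 1 (closure X)).mono_right subset_closure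
  · obtain ⟨z, hz, hz'⟩ := inter_side_nonempty neg_one_sq_real hX.isOpen hlX hl.closed ⟨p, hl.top⟩
      (hl.side_nonempty neg_one_sq_real)
    exact ⟨z, hz, side_subset_lowerDomain hX hl hlX hz'⟩

theorem isOpen_lowerDomain : IsOpen (lowerDomain X) := isOpen_side isClosed_closure

theorem isOpen_upperDomain : IsOpen (upperDomain X) := isOpen_side isClosed_closure

theorem above_subset_upperDomain (hX : IsBand X) : above X ⊆ upperDomain X := by
  obtain ⟨c, hc⟩ := hX.bdd
  refine halfPlane_subset_side (isPreconnected_side (one_pow 2) _) ?_ (halfPlane_subset_above hc)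
  refine (Disjoint.closure_left ?_ (isOpen_side isClosed_closure)).symm
  exact (side_disjoint _ _).mono_right subset_closure

/-- Two disjoint connected open sets cutting the plane along a periodic continuum in a strip,
each a full component of the complement of the closure of the other one. -/
structure IsSplit (L P : Set ℂ) : Prop where
  openL : IsOpen L
  openP : IsOpen P
  preL : IsPreconnected L
  preP : IsPreconnected P
  disj : Disjoint L P
  preLc : IsPreconnected Lᶜ
  prePc : IsPreconnected Pᶜ
  perL : ∀ z ∈ L, ∀ j : ℤ, z + j ∈ L
  perP : ∀ z ∈ P, ∀ j : ℤ, z + j ∈ P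
  bound : ∃ c : ℝ, (∀ z : ℂ, z.im < -c → z ∈ L) ∧ ∀ z : ℂ, c < z.im → z ∈ P
  sideL : side (-1) (closure P) ⊆ L
  sideP : side 1 (closure L) ⊆ P
  shift : ∀ z, z ∉ P → z - I ∈ L

theorem bddDisp_addRight (v : ℂ) : BddDisp (Homeomorph.addRight v) :=
  ⟨‖v‖, fun z => by simp⟩

theorem image_above {g : ℂ ≃ₜ ℂ} (hg : BddDisp g) (X : Set ℂ) :
    g '' above X = above (g '' X) := by
  rw [above, image_side (one_pow 2) hg, g.image_closure, above]

theorem image_lowerDomain {g : ℂ ≃ₜ ℂ} (hg : BddDisp g) (X : Set ℂ) :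
    g '' lowerDomain X = lowerDomain (g '' X) := by
  rw [lowerDomain, image_side neg_one_sq_real hg, g.image_closure, image_above hg, lowerDomain]

theorem image_upperDomain {g : ℂ ≃ₜ ℂ} (hg : BddDisp g) (X : Set ℂ) :
    g '' upperDomain X = upperDomain (g '' X) := by
  rw [upperDomain, image_side (one_pow 2) hg, g.image_closure, image_lowerDomain hg, upperDomain]

theorem lowerDomain_translate (v : ℂ) (X : Set ℂ) :
    lowerDomain ((· + v) '' X) = (· + v) '' lowerDomain X :=
  (image_lowerDomain (bddDisp_addRight v) X).symm

theorem upperDomain_translate (v : ℂ) (X : Set ℂ) :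
    upperDomain ((· + v) '' X) = (· + v) '' upperDomain X :=
  (image_upperDomain (bddDisp_addRight v) X).symm

theorem IsBand.translate (hX : IsBand X) (v : ℂ) : IsBand ((· + v) '' X) := by
  refine ⟨(Homeomorph.addRight v).isOpenMap _ hX.isOpen,
    hX.conn.image _ (by fun_prop), ?_, ?_⟩
  · rintro _ ⟨z, hz, rfl⟩ j
    exact ⟨z + j, hX.per z hz j, by ring⟩
  · obtain ⟨c, hc⟩ := hX.bdd
    refine ⟨c + |v.im|, ?_⟩
    rintro _ ⟨z, hz, rfl⟩
    rw [add_im]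
    exact (abs_add_le _ _).trans (by linarith [hc z hz])

theorem IsBand.image_add_intCast (hX : IsBand X) (j : ℤ) : (· + (j : ℂ)) '' X = X := by
  refine Subset.antisymm ?_ fun z hz => ⟨z + (-j : ℤ), hX.per z hz _, by push_cast; ring⟩
  rintro _ ⟨z, hz, rfl⟩
  exact hX.per z hz j

theorem IsLine.translate (hl : IsLine 1 l p q) (v : ℂ) :
    IsLine 1 ((· + v) '' l) (p + v) (q + v) := by
  refine ⟨hl.pre.image _ (by fun_prop), (Homeomorph.addRight v).isClosedMap _ hl.closed, ?_,
    ⟨p, hl.top, rfl⟩, ⟨q, hl.bot, rfl⟩, ?_, ?_⟩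
  · rintro _ ⟨z, hz, rfl⟩ j
    exact ⟨_, hl.per z hz j, by ring⟩
  · rintro _ ⟨z, hz, rfl⟩
    simpa using hl.le_top z hz
  · rintro _ ⟨z, hz, rfl⟩
    simpa using hl.bot_le z hz

theorem subset_side_of_top_le (hY : IsBand Y) (hd : Disjoint X Y)
    (hl : IsLine 1 l p q) (hlX : l ⊆ X) (hm : IsLine 1 m p' q') (hmY : m ⊆ Y)
    (hpp : p.im ≤ p'.im) : Y ⊆ side 1 l := by
  refine subset_side hY.conn.2 (hd.symm.mono_right hlX) ⟨p', hmY hm.top, ?_⟩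
  refine mem_side_of_forall_le (one_pow 2)
    (fun h => Set.disjoint_left.1 hd (hlX h) (hmY hm.top)) fun z hz => ?_
  linarith [hl.le_top z hz]

theorem subset_above_of_top_le (hX : IsBand X) (hY : IsBand Y) (hd : Disjoint X Y)
    (hl : IsLine 1 l p q) (hlX : l ⊆ X) (hm : IsLine 1 m p' q') (hmY : m ⊆ Y)
    (hpp : p.im ≤ p'.im) : Y ⊆ above X := by
  have hYl := subset_side_of_top_le hY hd hl hlX hm hmY hpp
  have hsep := hl.disjoint_sides one_pos
  have hqq : q.im ≤ q'.im := by
    by_contra! hlt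
    refine Set.disjoint_left.1 hsep (hYl (hmY hm.bot)) (mem_side_of_forall_le neg_one_sq_real
      (fun h => Set.disjoint_left.1 hd (hlX h) (hmY hm.bot)) fun z hz => ?_)
    linarith [hl.bot_le z hz]
  have hXm : X ⊆ side (-1) m := by
    refine subset_side hX.conn.2 (hd.mono_right hmY) ⟨q, hlX hl.bot, ?_⟩
    refine mem_side_of_forall_le neg_one_sq_real
      (fun h => Set.disjoint_left.1 hd (hlX hl.bot) (hmY h)) fun z hz => ?_
    linarith [hm.bot_le z hz]
  have h1 : side 1 m ⊆ above X := by
    refine halfPlane_subset_side (r := p'.im) (isPreconnected_side (one_pow 2) m) ?_ ?_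
    · exact (((hm.disjoint_sides one_pos).mono_right hXm).closure_right (isOpen_side hm.closed))
    · exact halfPlane_subset_side_of_bound fun z hz => by linarith [hm.le_top z hz]
  obtain ⟨z, hz, hz'⟩ := inter_side_nonempty (one_pow 2) hY.isOpen hmY hm.closed ⟨p', hm.top⟩
    (hm.side_nonempty (one_pow 2))
  exact subset_side hY.conn.2 (hd.symm.closure_right hY.isOpen) ⟨z, hz, h1 hz'⟩

theorem lowerDomain_lower_bound {c : ℝ} (hX : IsBand X) (hc : ∀ z ∈ X, |z.im| ≤ c) :
    {w : ℂ | c < -1 * w.im} ⊆ lowerDomain X := by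
  obtain ⟨l, p, q, hl, hlX⟩ := hX.exists_isLine
  refine Subset.trans ?_ (side_subset_lowerDomain hX hl hlX)
  exact halfPlane_subset_side_of_bound fun z hz => by linarith [neg_abs_le z.im, hc z (hlX hz)]

theorem disjoint_lowerDomain_upperDomain (X : Set ℂ) :
    Disjoint (lowerDomain X) (upperDomain X) :=
  ((side_disjoint 1 (closure (lowerDomain X))).mono_right subset_closure).symm

theorem isPreconnected_compl_upperDomain (hX : IsBand X) : IsPreconnected (upperDomain X)ᶜ :=
  isPreconnected_compl_side isClosed_closure (isPreconnected_side neg_one_sq_real _).closure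
    ((hX.conn.nonempty.mono (subset_lowerDomain hX)).closure)

/-- Circloids of bands above each other are disjoint. -/
theorem compl_upperDomain_subset (hX : IsBand X) (hY : IsBand Y) (hYX : Y ⊆ above X) :
    (upperDomain X)ᶜ ⊆ lowerDomain Y := by
  obtain ⟨l, p, q, hl, hlY⟩ := hY.exists_isLine
  obtain ⟨c, hc⟩ := hX.bdd
  refine Subset.trans ?_ (side_subset_lowerDomain hY hl hlY)
  refine halfPlane_subset_side (r := c) (isPreconnected_compl_upperDomain hX) ?_ ?_
  · exact disjoint_compl_left.mono_right
      (hlY.trans (hYX.trans (above_subset_upperDomain hX)))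
  · exact (lowerDomain_lower_bound hX hc).trans
      (subset_compl_iff_disjoint_right.2 (disjoint_lowerDomain_upperDomain X))

theorem IsBand.isSplit (hX : IsBand X) (hXI : Disjoint X ((· + I) '' X)) :
    IsSplit (lowerDomain X) (upperDomain X) := by
  obtain ⟨c, hc⟩ := hX.bdd
  obtain ⟨l, p, q, hl, hlX⟩ := hX.exists_isLine
  obtain ⟨w, hw⟩ := exists_gt_of_sq_eq_one (one_pow 2) c
  refine ⟨isOpen_lowerDomain, isOpen_upperDomain, isPreconnected_side neg_one_sq_real _,
    isPreconnected_side (one_pow 2) _, disjoint_lowerDomain_upperDomain X, ?_,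
    isPreconnected_compl_upperDomain hX, ?_, ?_, ⟨c, fun z hz => ?_, fun z hz => ?_⟩,
    ?_, subset_rfl, fun z hz => ?_⟩
  · exact isPreconnected_compl_side isClosed_closure (isPreconnected_side (one_pow 2) _).closure
      ⟨w, subset_closure (halfPlane_subset_above hc hw)⟩
  · intro z hz j
    rw [← hX.image_add_intCast j, lowerDomain_translate]
    exact ⟨z, hz, rfl⟩
  · intro z hz j
    rw [← hX.image_add_intCast j, upperDomain_translate]
    exact ⟨z, hz, rfl⟩
  · refine lowerDomain_lower_bound hX hc ?_
    change c < -1 * z.im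
    linarith
  · refine above_subset_upperDomain hX (halfPlane_subset_above hc ?_)
    change c < 1 * z.im
    linarith
  · exact side_anti (closure_mono (above_subset_upperDomain hX))
  · have h1 := subset_above_of_top_le hX (hX.translate I) hXI hl hlX (hl.translate I)
      (image_mono hlX) (by simp)
    have h2 := compl_upperDomain_subset hX (hX.translate I) h1 hz
    rw [lowerDomain_translate] at h2
    obtain ⟨v, hv, rfl⟩ := h2
    simpa using hv

/-- The circloids at the top of two disjoint bands are disjoint. -/
theorem disjoint_of_disjoint_bands (hX : IsBand X) (hY : IsBand Y) (hd : Disjoint X Y) :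
    Disjoint (lowerDomain X ∪ upperDomain X)ᶜ (lowerDomain Y ∪ upperDomain Y)ᶜ := by
  have key : ∀ X Y : Set ℂ, IsBand X → IsBand Y → Y ⊆ above X →
      Disjoint (lowerDomain X ∪ upperDomain X)ᶜ (lowerDomain Y ∪ upperDomain Y)ᶜ := by
    intro X Y hX hY h
    refine Disjoint.mono (compl_subset_compl.2 subset_union_right)
      (compl_subset_compl.2 subset_union_left) ?_
    exact disjoint_compl_right.mono_left (compl_upperDomain_subset hX hY h)
  obtain ⟨l, p, q, hl, hlX⟩ := hX.exists_isLine
  obtain ⟨m, p', q', hm, hmY⟩ := hY.exists_isLine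
  rcases le_total p.im p'.im with h | h
  · exact key X Y hX hY (subset_above_of_top_le hX hY hd hl hlX hm hmY h)
  · exact (key Y X hY hX (subset_above_of_top_le hY hX hd.symm hm hmY hl hlX h)).symm

end Bands

end TorusCircloid

namespace TorusCircloid

section Cover

open Set Filter Topology Complex Metric

/-- A universal covering of the torus by the complex plane, with deck group the Gaussian
integers. -/
structure IsPlaneCover (p : ℂ → Torus 2) : Prop where
  continuous : Continuous p
  isOpenMap : IsOpenMap p
  surjective : Function.Surjective p
  eq_iff : ∀ z w, p z = p w ↔ ∃ a b : ℤ, w = z + a + b * I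
  lift : ∀ e : Rd 2 → Torus 2, Continuous e → ∃ l : Rd 2 → ℂ, Continuous l ∧ ∀ x, p (l x) = e x

theorem projT_eq_iff {d : ℕ} (x y : Rd d) :
    projT x = projT y ↔ ∃ m : Fin d → ℤ, y = x + intVec m := by
  constructor
  · intro h
    have h1 : ∀ i, ∃ n : ℤ, y i = x i + n := fun i => by
      have h2 : (x i : AddCircle (1 : ℝ)) = (y i : AddCircle (1 : ℝ)) := congrFun h i
      obtain ⟨n, hn⟩ := AddSubgroup.mem_zmultiples_iff.1 (QuotientAddGroup.eq.1 h2)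
      refine ⟨n, ?_⟩
      simp only [zsmul_eq_mul, mul_one] at hn
      linarith
    choose m hm using h1
    refine ⟨m, ?_⟩
    ext i
    simpa [intVec] using hm i
  · rintro ⟨m, rfl⟩
    funext i
    simp [projT, intVec]

theorem continuous_projT {d : ℕ} : Continuous (projT : Rd d → Torus d) :=
  continuous_pi fun i => (AddCircle.continuous_mk' 1).comp (by fun_prop)

theorem isOpenMap_projT {d : ℕ} : IsOpenMap (projT : Rd d → Torus d) := by
  have h1 : IsOpenMap (Pi.map fun (_ : Fin d) (t : ℝ) => (t : AddCircle (1 : ℝ))) :=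
    IsOpenMap.piMap (fun _ => QuotientAddGroup.isOpenMap_coe)
      (Eventually.of_forall fun _ => QuotientAddGroup.mk_surjective)
  exact h1.comp (PiLp.homeomorph 2 fun _ : Fin d => ℝ).isOpenMap

theorem projT_surjective {d : ℕ} : Function.Surjective (projT : Rd d → Torus d) := by
  intro x
  choose y hy using fun i => QuotientAddGroup.mk_surjective (x i)
  exact ⟨WithLp.toLp 2 y, funext hy⟩

theorem exists_lift_projT (e : Rd 2 → Torus 2) (he : Continuous e) :
    ∃ l : Rd 2 → Rd 2, Continuous l ∧ ∀ x, projT (l x) = e x := by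
  have h1 : ∀ i, ∃ l : Rd 2 → ℝ, Continuous l ∧ ∀ x, (l x : AddCircle (1 : ℝ)) = e x i := by
    intro i
    obtain ⟨t, ht⟩ := QuotientAddGroup.mk_surjective (e 0 i)
    obtain ⟨l, ⟨-, hl⟩, -⟩ := (AddCircle.isCoveringMap_coe (1 : ℝ)).existsUnique_continuousMap_lifts
      ⟨fun x => e x i, by fun_prop⟩ 0 t ht
    exact ⟨l, l.continuous, fun x => congrFun hl x⟩
  choose l hl hl' using h1
  exact ⟨fun x => WithLp.toLp 2 fun i => l i x, by fun_prop, fun x => funext fun i => hl' i x⟩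

/-- The real-linear identification of `ℂ` with the plane sending `1` to `(a, c)` and `I` to
`(b, d)`. -/
noncomputable def latticeChart (a b c d : ℤ) (h : a * d - b * c = 1) : ℂ ≃ₜ Rd 2 where
  toFun z := !₂[a * z.re + b * z.im, c * z.re + d * z.im]
  invFun v := ⟨d * v 0 - b * v 1, a * v 1 - c * v 0⟩
  left_inv z := by
    have h' : (a * d - b * c : ℝ) = 1 := mod_cast h
    apply Complex.ext
    · simp
      linear_combination z.re * h'
    · simp
      linear_combination z.im * h'
  right_inv v := by
    have h' : (a * d - b * c : ℝ) = 1 := mod_cast h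
    ext i
    fin_cases i
    · simp
      linear_combination v 0 * h'
    · simp
      linear_combination v 1 * h'
  continuous_toFun := by
    refine (PiLp.continuous_toLp 2 _).comp (continuous_pi fun i => ?_)
    fin_cases i <;> simp <;> fun_prop
  continuous_invFun := by
    have : (fun v : Rd 2 => (⟨d * v 0 - b * v 1, a * v 1 - c * v 0⟩ : ℂ)) =
      fun v : Rd 2 => ((d * v 0 - b * v 1 : ℝ) : ℂ) + ((a * v 1 - c * v 0 : ℝ) : ℂ) * I := by
      funext v
      apply Complex.ext <;> simp
    rw [this]
    fun_prop

theorem latticeChart_add (a b c d : ℤ) (h : a * d - b * c = 1) (z : ℂ) (m n : ℤ) :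
    latticeChart a b c d h (z + m + n * I) =
      latticeChart a b c d h z + intVec ![a * m + b * n, c * m + d * n] := by
  ext i
  fin_cases i
  · simp [latticeChart, intVec]; ring
  · simp [latticeChart, intVec]; ring

theorem isPlaneCover_latticeChart (a b c d : ℤ) (h : a * d - b * c = 1) :
    IsPlaneCover (projT ∘ latticeChart a b c d h) where
  continuous := continuous_projT.comp (latticeChart a b c d h).continuous
  isOpenMap := isOpenMap_projT.comp (latticeChart a b c d h).isOpenMap
  surjective := projT_surjective.comp (latticeChart a b c d h).surjective
  eq_iff z w := by
    rw [Function.comp_apply, Function.comp_apply, projT_eq_iff]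
    constructor
    · rintro ⟨m, hm⟩
      refine ⟨d * m 0 - b * m 1, a * m 1 - c * m 0, (latticeChart a b c d h).injective ?_⟩
      rw [latticeChart_add, hm]
      congr 2
      funext i
      fin_cases i
      · simp
        linear_combination (-m 0) * h
      · simp
        linear_combination (-m 1) * h
    · rintro ⟨m, n, rfl⟩
      exact ⟨_, latticeChart_add ..⟩
  lift e he := by
    obtain ⟨l, hl, hl'⟩ := exists_lift_projT e he
    exact ⟨fun x => (latticeChart a b c d h).symm (l x),
      (latticeChart a b c d h).symm.continuous.comp hl, fun x => by simp [hl']⟩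

theorem bddDisp_of_commute {g : ℂ ≃ₜ ℂ} (h : ∀ z (m n : ℤ), g (z + m + n * I) = g z + m + n * I) :
    BddDisp g := by
  have h1 : IsCompact (Icc (0:ℝ) 1 ×ℂ Icc (0:ℝ) 1) := isCompact_Icc.reProdIm isCompact_Icc
  obtain ⟨C, hC⟩ := h1.exists_bound_of_continuousOn (f := fun z => g z - z) (by fun_prop)
  refine ⟨C, fun z => ?_⟩
  have h2 := hC (z + (-⌊z.re⌋ : ℤ) + (-⌊z.im⌋ : ℤ) * I) (by
    rw [Complex.mem_reProdIm]
    constructor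
    · simp only [add_re, mul_re, I_re, I_im, intCast_re, intCast_im, mem_Icc]
      push_cast
      constructor <;> linarith [Int.floor_le z.re, Int.lt_floor_add_one z.re]
    · simp only [add_im, mul_im, I_re, I_im, intCast_re, intCast_im, mem_Icc]
      push_cast
      constructor <;> linarith [Int.floor_le z.im, Int.lt_floor_add_one z.im])
  rw [h] at h2
  have h3 : ∀ u v a b : ℂ, u + a + b - (v + a + b) = u - v := fun u v a b => by ring
  rwa [h3] at h2

end Cover

end TorusCircloid

namespace TorusCircloid

section Essential

open Set Filter Topology Complex Metric

namespace IsPlaneCover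

variable {p : ℂ → Torus 2}

theorem map_add (hp : IsPlaneCover p) (z : ℂ) (a b : ℤ) : p (z + a + b * I) = p z :=
  ((hp.eq_iff _ _).2 ⟨a, b, rfl⟩).symm

theorem map_add_intCast (hp : IsPlaneCover p) (z : ℂ) (a : ℤ) : p (z + a) = p z := by
  simpa using hp.map_add z a 0

theorem exists_section (hp : IsPlaneCover p) {C : Set (Torus 2)} (h : ¬IsEssentialT2 C) :
    ∃ s : Torus 2 → ℂ, ContinuousOn s C ∧ ∀ x ∈ C, p (s x) = x := by
  obtain ⟨e, he, hC⟩ := not_not.1 h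
  obtain ⟨l, hl, hl'⟩ := hp.lift e he.continuous
  have h1 : Function.extend e l 0 ∘ e = l := Function.extend_comp he.injective l 0
  refine ⟨Function.extend e l 0, fun x hx => ?_, fun x hx => ?_⟩
  · obtain ⟨y, rfl⟩ := hC hx
    exact (he.continuousAt_iff.1 (by rw [h1]; exact hl.continuousAt)).continuousWithinAt
  · obtain ⟨y, rfl⟩ := hC hx
    rw [he.injective.extend_apply, hl']

theorem isEssential_image (hp : IsPlaneCover p) {S : Set ℂ} (hS : IsPreconnected S) {z w : ℂ}
    (hz : z ∈ S) (hw : w ∈ S) (hne : z ≠ w) (hzw : p z = p w) : IsEssentialT2 (p '' S) := by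
  by_contra h
  obtain ⟨s, hs, hs'⟩ := hp.exists_section h
  have hT : (range fun n : ℤ × ℤ => (n.1 : ℂ) + n.2 * I).Countable := countable_range _
  have hd : ContinuousOn (fun z => s (p z) - z) S :=
    (hs.comp hp.continuous.continuousOn (mapsTo_image _ _)).sub continuousOn_id
  have h1 : s (p z) - z = s (p w) - w := by
    refine hT.isTotallyDisconnected ((fun z => s (p z) - z) '' S) ?_ (hS.image _ hd)
      ⟨z, hz, rfl⟩ ⟨w, hw, rfl⟩
    rintro _ ⟨v, hv, rfl⟩
    obtain ⟨a, b, hab⟩ := (hp.eq_iff _ _).1 (hs' _ (mem_image_of_mem p hv)).symm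
    refine ⟨(a, b), ?_⟩
    simp only
    rw [hab]
    ring
  rw [hzw] at h1
  exact hne (by simpa using h1)

end IsPlaneCover

theorem isEmpty_log_of_injective {e : ℂ → ℂ} (he : Continuous e) (hinj : Function.Injective e)
    {z₀ : ℂ} {r : ℝ} (hr : ‖z₀‖ < r) {l₀ : AddCircle (1 : ℝ) → ℂ} (hl₀ : Continuous l₀)
    (hl : ∀ θ, exp (l₀ θ) = e (r * AddCircle.toCircle θ) - e z₀) : False := by
  have hr0 : 0 < r := (norm_nonneg _).trans_lt hr
  have hc : Continuous fun θ : AddCircle (1 : ℝ) => (AddCircle.toCircle θ : ℂ) :=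
    continuous_subtype_val.comp AddCircle.continuous_toCircle
  obtain ⟨l, hlc, hl1, -⟩ := exists_log_homotopy
    (H := fun x : unitInterval × AddCircle (1 : ℝ) => e (r * AddCircle.toCircle x.2) -
      e ((1 - ((x.1 : ℝ) : ℂ)) * z₀ - (x.1 : ℝ) * (r * AddCircle.toCircle x.2)))
    (by fun_prop) (fun x h => by
      have h1 := hinj (sub_eq_zero.1 h)
      have h2 : ((1 + (x.1 : ℝ) : ℝ) : ℂ) * (r * AddCircle.toCircle x.2) =
          ((1 - (x.1 : ℝ) : ℝ) : ℂ) * z₀ := by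
        push_cast
        linear_combination h1
      have h3 := congrArg norm h2
      rw [norm_mul, norm_mul, norm_mul, Complex.norm_real, Complex.norm_real, Complex.norm_real,
        Circle.norm_coe, Real.norm_of_nonneg hr0.le,
        Real.norm_of_nonneg (r := 1 + (x.1 : ℝ)) (by linarith [x.1.2.1]),
        Real.norm_of_nonneg (r := 1 - (x.1 : ℝ)) (by linarith [x.1.2.2])] at h3
      nlinarith [x.1.2.1, x.1.2.2, norm_nonneg z₀]) hl₀ (fun θ => by rw [hl]; simp)
  have hhalf : ∀ θ : AddCircle (1 : ℝ),
      (AddCircle.toCircle (θ + ((1 / 2 : ℝ) : AddCircle (1 : ℝ))) : ℂ) =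
        -AddCircle.toCircle θ := fun θ => by
    rw [AddCircle.toCircle_add, Circle.coe_mul, AddCircle.toCircle_apply_mk, Circle.coe_exp]
    have : ((2 * Real.pi / 1 * (1 / 2) : ℝ) : ℂ) * I = Real.pi * I := by push_cast; ring
    rw [this, exp_pi_mul_I]
    ring
  have hone : ∀ θ : AddCircle (1 : ℝ), θ + ((1 / 2 : ℝ) : AddCircle (1 : ℝ)) +
      ((1 / 2 : ℝ) : AddCircle (1 : ℝ)) = θ := fun θ => by
    rw [add_assoc, ← AddCircle.coe_add]
    norm_num
  set d : AddCircle (1 : ℝ) → ℂ := fun θ =>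
    l (1, θ) - l (1, θ + ((1 / 2 : ℝ) : AddCircle (1 : ℝ))) with hd
  have hexp : ∀ θ, exp (d θ) = -1 := fun θ => by
    have hne : exp (l (1, θ + ((1 / 2 : ℝ) : AddCircle (1 : ℝ)))) ≠ 0 := exp_ne_zero _
    rw [hd]
    simp only
    rw [exp_sub, div_eq_iff hne, hl1, hl1]
    simp only [hhalf]
    simp
  have h2 := eq_of_exp_eq_one (d := fun θ => d θ - d 0) isPreconnected_univ
    (by fun_prop) (fun θ _ => by rw [exp_sub, hexp, hexp]; norm_num)
    (mem_univ (0 : AddCircle (1 : ℝ))) (mem_univ (((1 / 2 : ℝ) : AddCircle (1 : ℝ))))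
  have h3 : d ((1 / 2 : ℝ) : AddCircle (1 : ℝ)) = - d 0 := by
    have h4 := hone 0
    rw [zero_add] at h4
    rw [hd]
    simp only [zero_add]
    rw [h4]
    ring
  have h5 : d 0 = 0 := by
    simp only [sub_self] at h2
    rw [h3] at h2
    linear_combination (1 / 2 : ℂ) * h2
  have h6 := hexp 0
  rw [h5, exp_zero] at h6
  norm_num at h6

end Essential

end TorusCircloid

namespace TorusCircloid

section Split

open Set Filter Topology Complex Metric

/-- The part of the plane strictly between the separator of a split and its upward translate. -/
def gap (L P : Set ℂ) : Set ℂ := P ∩ {z | z - I ∈ L}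

namespace IsSplit

variable {p : ℂ → Torus 2} {L P : Set ℂ}

theorem add_I_mem (h : IsSplit L P) {z : ℂ} (hz : z ∈ P) : z + I ∈ P := by
  by_contra h1
  have h2 := h.shift _ h1
  rw [add_sub_cancel_right] at h2
  exact Set.disjoint_left.1 h.disj h2 hz

theorem sub_I_mem (h : IsSplit L P) {z : ℂ} (hz : z ∈ L) : z - I ∈ L :=
  h.shift _ (Set.disjoint_left.1 h.disj hz)

theorem add_mul_I_mem (h : IsSplit L P) {z : ℂ} (hz : z ∈ P) (n : ℕ) : z + n * I ∈ P := by
  induction n with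
  | zero => simpa using hz
  | succ n ih =>
    have : z + (n + 1 : ℕ) * I = z + n * I + I := by push_cast; ring
    rw [this]
    exact h.add_I_mem ih

theorem sub_mul_I_mem (h : IsSplit L P) {z : ℂ} (hz : z ∈ L) (n : ℕ) : z - n * I ∈ L := by
  induction n with
  | zero => simpa using hz
  | succ n ih =>
    have : z - (n + 1 : ℕ) * I = z - n * I - I := by push_cast; ring
    rw [this]
    exact h.sub_I_mem ih

theorem add_mem (h : IsSplit L P) {z : ℂ} (hz : z ∈ P) (a : ℤ) {b : ℤ} (hb : 0 ≤ b) :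
    z + a + b * I ∈ P := by
  lift b to ℕ using hb
  exact_mod_cast h.add_mul_I_mem (h.perP z hz a) b

theorem add_mem_of_nonpos (h : IsSplit L P) {z : ℂ} (hz : z ∈ L) (a : ℤ) {b : ℤ} (hb : b ≤ 0) :
    z + a + b * I ∈ L := by
  obtain ⟨n, rfl⟩ := Int.exists_eq_neg_ofNat hb
  have := h.sub_mul_I_mem (h.perL z hz a) n
  rw [sub_eq_add_neg] at this
  simpa using this

theorem isClosed_compl_union (h : IsSplit L P) : IsClosed (L ∪ P)ᶜ :=
  (h.openL.union h.openP).isClosed_compl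

theorem isPreconnected_compl_union (h : IsSplit L P) : IsPreconnected (L ∪ P)ᶜ := by
  rw [compl_union]
  refine isPreconnected_inter_of_isClosed h.openL.isClosed_compl h.openP.isClosed_compl h.preLc
    h.prePc ?_
  rw [← compl_inter, h.disj.inter_eq, compl_empty]

theorem nonempty_L (h : IsSplit L P) : L.Nonempty := by
  obtain ⟨c, hc, -⟩ := h.bound
  exact ⟨⟨0, -c - 1⟩, hc _ (by simp)⟩

theorem nonempty_P (h : IsSplit L P) : P.Nonempty := by
  obtain ⟨c, -, hc⟩ := h.bound
  exact ⟨⟨0, c + 1⟩, hc _ (by simp)⟩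

theorem nonempty_compl_union (h : IsSplit L P) : (L ∪ P)ᶜ.Nonempty := by
  by_contra h1
  rw [not_nonempty_iff_eq_empty, compl_empty_iff] at h1
  obtain ⟨z, -, hz, hz'⟩ := isPreconnected_univ L P h.openL h.openP h1.ge
    (by simpa using h.nonempty_L) (by simpa using h.nonempty_P)
  exact Set.disjoint_left.1 h.disj hz hz'

theorem add_intCast_mem (h : IsSplit L P) {z : ℂ} (hz : z ∈ (L ∪ P)ᶜ) (a : ℤ) :
    z + a ∈ (L ∪ P)ᶜ := by
  rintro (h1 | h1)
  · exact hz (Or.inl (by simpa using h.perL _ h1 (-a)))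
  · exact hz (Or.inr (by simpa using h.perP _ h1 (-a)))

theorem exists_abs_im_le (h : IsSplit L P) : ∃ c, ∀ z ∈ (L ∪ P)ᶜ, |z.im| ≤ c := by
  obtain ⟨c, hc, hc'⟩ := h.bound
  refine ⟨c, fun z hz => abs_le.2 ⟨?_, ?_⟩⟩
  · by_contra! h1
    exact hz (Or.inl (hc z h1))
  · by_contra! h1
    exact hz (Or.inr (hc' z h1))

theorem isCompact_image (h : IsSplit L P) (hp : IsPlaneCover p) : IsCompact (p '' (L ∪ P)ᶜ) := by
  obtain ⟨c, hc⟩ := h.exists_abs_im_le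
  have h1 : IsCompact ((Icc (0:ℝ) 1 ×ℂ Icc (-c) c) ∩ (L ∪ P)ᶜ) :=
    (isCompact_Icc.reProdIm isCompact_Icc).inter_right h.isClosed_compl_union
  convert h1.image hp.continuous using 1
  refine subset_antisymm ?_ (image_mono inter_subset_right)
  rintro _ ⟨z, hz, rfl⟩
  refine ⟨z + (-⌊z.re⌋ : ℤ), ⟨?_, h.add_intCast_mem hz _⟩, hp.map_add_intCast _ _⟩
  rw [Complex.mem_reProdIm]
  constructor
  · simp only [add_re, intCast_re, mem_Icc]
    push_cast
    constructor <;> linarith [Int.floor_le z.re, Int.lt_floor_add_one z.re]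
  · simpa using abs_le.1 (hc z hz)

theorem isConnected_image (h : IsSplit L P) (hp : IsPlaneCover p) :
    IsConnected (p '' (L ∪ P)ᶜ) :=
  ⟨h.nonempty_compl_union.image p, h.isPreconnected_compl_union.image p hp.continuous.continuousOn⟩

theorem isEssential_image (h : IsSplit L P) (hp : IsPlaneCover p) :
    IsEssentialT2 (p '' (L ∪ P)ᶜ) := by
  obtain ⟨z, hz⟩ := h.nonempty_compl_union
  refine hp.isEssential_image h.isPreconnected_compl_union hz (h.add_intCast_mem hz 1) (by simp)
    (hp.map_add_intCast _ _).symm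

theorem isPreconnected_gap (h : IsSplit L P) : IsPreconnected (gap L P) := by
  have h1 : {z | z - I ∈ L} = (fun z => z + I) '' L := by
    ext z
    constructor
    · exact fun hz => ⟨z - I, hz, by simp⟩
    · rintro ⟨w, hw, rfl⟩
      simpa using hw
  refine isPreconnected_inter_of_isOpen h.openP (h.openL.preimage (by fun_prop)) h.preP ?_ ?_
  · rw [h1]
    exact h.preL.image _ (by fun_prop)
  · rw [eq_univ_iff_forall]
    exact fun z => or_iff_not_imp_left.2 (h.shift z)

theorem compl_image_eq (h : IsSplit L P) (hp : IsPlaneCover p) :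
    (p '' (L ∪ P)ᶜ)ᶜ = p '' gap L P := by
  apply subset_antisymm
  · intro x hx
    obtain ⟨z, rfl⟩ := hp.surjective x
    have hz : ∀ b : ℤ, z - b * I ∈ L ∪ P := fun b => by
      by_contra h1
      refine hx ⟨_, h1, ?_⟩
      have := hp.map_add z 0 (-b)
      rw [← this]
      congr 1
      push_cast
      ring
    obtain ⟨c, hc, hc'⟩ := h.bound
    obtain ⟨b, hb, hmax⟩ := Int.exists_greatest_of_bdd (P := fun b : ℤ => z - b * I ∈ P)
      ⟨⌈z.im + c⌉ + 1, fun b hb => by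
        by_contra! h1
        have h2 : ((⌈z.im + c⌉ + 1 : ℤ) : ℝ) < b := mod_cast h1
        push_cast at h2
        refine Set.disjoint_left.1 h.disj (hc _ ?_) hb
        simp
        linarith [Int.le_ceil (z.im + c)]⟩
      ⟨⌊z.im - c⌋ - 1, hc' _ (by simp; linarith [Int.floor_le (z.im - c)])⟩
    refine ⟨z - b * I, ⟨hb, ?_⟩, ?_⟩
    · rcases hz (b + 1) with h1 | h1
      · change _ ∈ L
        convert h1 using 1
        push_cast
        ring
      · exact absurd (hmax _ h1) (by omega)
    · have := hp.map_add z 0 (-b)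
      rw [← this]
      congr 1
      push_cast
      ring
  · rintro _ ⟨z, ⟨hz, hz'⟩, rfl⟩ ⟨w, hw, hwz⟩
    obtain ⟨a, b, rfl⟩ := (hp.eq_iff _ _).1 hwz.symm
    rcases le_or_gt 0 b with hb | hb
    · exact hw (Or.inr (h.add_mem hz a hb))
    · refine hw (Or.inl ?_)
      convert h.add_mem_of_nonpos (z := z - I) hz' a (b := b + 1) (by omega) using 1
      push_cast
      ring

theorem nonempty_gap (h : IsSplit L P) : (gap L P).Nonempty := by
  obtain ⟨z, hz⟩ := h.nonempty_L
  have h1 := isPreconnected_univ P {z | z - I ∈ L} h.openP (h.openL.preimage (by fun_prop))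
    (fun z _ => or_iff_not_imp_left.2 (h.shift z)) (by simpa using h.nonempty_P)
    ⟨z + I, mem_univ _, by simpa using hz⟩
  rwa [univ_inter] at h1

theorem eq_of_mem_gap (h : IsSplit L P) {z : ℂ} {a b : ℤ} (hz : z ∈ gap L P)
    (hw : z + a + b * I ∈ gap L P) : b = 0 := by
  rcases lt_trichotomy b 0 with hb | hb | hb
  · refine absurd hw.1 (Set.disjoint_left.1 h.disj ?_)
    convert h.add_mem_of_nonpos (z := z - I) hz.2 a (b := b + 1) (by omega) using 1
    push_cast
    ring
  · exact hb
  · refine absurd (h.add_mem hz.1 a (b := b - 1) (by omega)) (Set.disjoint_left.1 h.disj ?_)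
    have h2 : z + a + b * I - I ∈ L := hw.2
    convert h2 using 1
    push_cast
    ring

end IsSplit

end Split

end TorusCircloid

namespace TorusCircloid

section Curve

open Set Filter Topology Complex Metric

/-- The exponential `z ↦ exp (2πiz)`, whose fibres are the orbits of integer translations. -/
noncomputable def expI (z : ℂ) : ℂ := exp (2 * Real.pi * I * z)

theorem continuous_expI : Continuous expI := by unfold expI; fun_prop

theorem expI_ne_zero (z : ℂ) : expI z ≠ 0 := exp_ne_zero _

theorem expI_eq_iff {z w : ℂ} : expI z = expI w ↔ ∃ j : ℤ, z = w + j := by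
  have h : (2 * Real.pi * I : ℂ) ≠ 0 := two_pi_I_ne_zero
  rw [expI, expI, Complex.exp_eq_exp_iff_exists_int]
  refine exists_congr fun j => ⟨fun h1 => mul_left_cancel₀ h (by rw [h1]; ring), ?_⟩
  rintro rfl
  ring

theorem exists_expI_eq {w : ℂ} (hw : w ≠ 0) : ∃ z, expI z = w := by
  refine ⟨log w / (2 * Real.pi * I), ?_⟩
  rw [expI, mul_div_cancel₀ _ two_pi_I_ne_zero, exp_log hw]

theorem norm_expI (z : ℂ) : ‖expI z‖ = Real.exp (-2 * Real.pi * z.im) := by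
  rw [expI, Complex.norm_exp]
  simp

theorem isOpenMap_expI : IsOpenMap expI := by
  have h1 : expI = exp ∘ (Homeomorph.mulLeft₀ (2 * Real.pi * I) two_pi_I_ne_zero) := rfl
  rw [h1]
  exact Complex.isOpenMap_exp.comp (Homeomorph.isOpenMap _)

theorem im_lt_of_norm_expI_lt {z : ℂ} {c : ℝ} (h : ‖expI z‖ < Real.exp (-2 * Real.pi * c)) :
    c < z.im := by
  rw [norm_expI, Real.exp_lt_exp] at h
  nlinarith [Real.pi_pos]

theorem lt_im_of_lt_norm_expI {z : ℂ} {c : ℝ} (h : Real.exp (-2 * Real.pi * c) < ‖expI z‖) :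
    z.im < c := by
  rw [norm_expI, Real.exp_lt_exp] at h
  nlinarith [Real.pi_pos]

theorem mem_of_expI_mem_image {S : Set ℂ} (hS : ∀ z ∈ S, ∀ j : ℤ, z + j ∈ S) {z : ℂ}
    (h : expI z ∈ expI '' S) : z ∈ S := by
  obtain ⟨w, hw, hwz⟩ := h
  obtain ⟨j, rfl⟩ := expI_eq_iff.1 hwz.symm
  exact hS w hw j

namespace IsSplit

variable {p : ℂ → Torus 2} {L P : Set ℂ}

theorem exists_embedding (h : IsSplit L P) :
    ∃ e : ℂ → ℂ, IsOpenEmbedding e ∧ range e = expI '' P ∪ {0} := by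
  obtain ⟨c, hc, hc'⟩ := h.bound
  set δ := Real.exp (-2 * Real.pi * c) with hδ
  have hδ0 : 0 < δ := Real.exp_pos _
  have hball : ball 0 δ ⊆ expI '' P ∪ {0} := fun w hw => by
    by_cases h0 : w = 0
    · exact Or.inr h0
    · obtain ⟨z, rfl⟩ := exists_expI_eq h0
      exact Or.inl ⟨z, hc' z (im_lt_of_norm_expI_lt (mem_ball_zero_iff.1 hw)), rfl⟩
  have heq : expI '' P ∪ {0} = expI '' P ∪ ball 0 δ :=
    subset_antisymm (union_subset_union_right _ (by simpa using hδ0))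
      (union_subset subset_union_left hball)
  have hopen : IsOpen (expI '' P ∪ {0}) := by
    rw [heq]
    exact (isOpenMap_expI _ h.openP).union isOpen_ball
  have hpre : IsPreconnected (expI '' P ∪ {0}) := by
    rw [heq]
    have h1 : c < (⟨0, c + 1⟩ : ℂ).im := by simp
    refine IsPreconnected.union (expI ⟨0, c + 1⟩) ⟨_, hc' _ h1, rfl⟩ ?_
      (h.preP.image _ continuous_expI.continuousOn) (convex_ball 0 δ).isPreconnected
    rw [mem_ball_zero_iff, norm_expI, hδ, Real.exp_lt_exp]
    nlinarith [Real.pi_pos]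
  have hbdd : Bornology.IsBounded (expI '' P ∪ {0}) := by
    refine (Metric.isBounded_ball (x := (0 : ℂ)) (r := Real.exp (-2 * Real.pi * (-c - 1)))).subset ?_
    rintro _ (⟨z, hz, rfl⟩ | rfl)
    · rw [mem_ball_zero_iff]
      by_contra! h1
      have h2 : z.im < -c := by
        have : Real.exp (-2 * Real.pi * (-c)) < ‖expI z‖ := lt_of_lt_of_le (by
          rw [Real.exp_lt_exp]
          nlinarith [Real.pi_pos]) h1
        exact lt_im_of_lt_norm_expI this
      exact Set.disjoint_left.1 h.disj (hc z h2) hz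
    · simpa using Real.exp_pos _
  have hcompl : (expI '' P ∪ {0})ᶜ = expI '' Pᶜ := by
    ext w
    constructor
    · intro hw
      obtain ⟨z, rfl⟩ := exists_expI_eq (w := w) (fun h0 => hw (Or.inr h0))
      exact ⟨z, fun hz => hw (Or.inl ⟨z, hz, rfl⟩), rfl⟩
    · rintro ⟨z, hz, rfl⟩ (hw | hw)
      · exact hz (mem_of_expI_mem_image h.perP hw)
      · exact expI_ne_zero z hw
  refine exists_isOpenEmbedding_range_eq hopen ⟨⟨0, Or.inr rfl⟩, hpre⟩ hbdd ?_
  rw [hcompl]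
  exact h.prePc.image _ continuous_expI.continuousOn

theorem mem_gap_of_expI (h : IsSplit L P) {z : ℂ} (h1 : expI z ∈ expI '' P)
    (h2 : expI z ∈ expI '' {z | z - I ∈ L}) : z ∈ gap L P := by
  refine ⟨mem_of_expI_mem_image h.perP h1, mem_of_expI_mem_image (fun w hw j => ?_) h2⟩
  have h3 := h.perL _ hw j
  change _ ∈ L
  convert h3 using 1
  ring

theorem exists_radius (h : IsSplit L P) {e : ℂ → ℂ} (he : IsOpenEmbedding e)
    (hr : range e = expI '' P ∪ {0}) :
    ∃ z₀ : ℂ, ∃ r : ℝ, e z₀ = 0 ∧ ‖z₀‖ < r ∧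
      ∀ u : ℂ, ‖u‖ = r → ∀ z, expI z = e u → z ∈ gap L P := by
  obtain ⟨c, hc, hc'⟩ := h.bound
  set K : Set ℂ := (expI '' {z | z - I ∈ L})ᶜ with hK
  have hKc : IsClosed K :=
    (isOpenMap_expI _ (h.openL.preimage (by fun_prop : Continuous fun z : ℂ => z - I))).isClosed_compl
  have hKb : Bornology.IsBounded K := by
    refine (Metric.isBounded_closedBall (x := (0 : ℂ)) (r := Real.exp (-2 * Real.pi * (-c)))).subset ?_
    intro w hw
    rw [mem_closedBall_zero_iff]
    by_contra! h1
    have h0 : w ≠ 0 := norm_pos_iff.1 ((Real.exp_pos _).trans h1)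
    obtain ⟨z, rfl⟩ := exists_expI_eq h0
    refine hw ⟨z, hc _ ?_, rfl⟩
    have := lt_im_of_lt_norm_expI h1
    simp
    linarith
  have hKr : K ⊆ range e := by
    intro w hw
    rw [hr]
    by_cases h0 : w = 0
    · exact Or.inr h0
    · obtain ⟨z, rfl⟩ := exists_expI_eq h0
      left
      refine ⟨z, ?_, rfl⟩
      by_contra hz
      exact hw ⟨z, h.shift z hz, rfl⟩
  have hcomp : IsCompact (e ⁻¹' K) :=
    (he.isInducing.isCompact_preimage_iff hKr).2 (Metric.isCompact_of_isClosed_isBounded hKc hKb)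
  obtain ⟨r, hr0⟩ := hcomp.isBounded.subset_ball 0
  have h0 : (0 : ℂ) ∈ K := by
    rintro ⟨z, -, hz⟩
    exact expI_ne_zero z hz
  obtain ⟨z₀, hz₀⟩ := hKr h0
  refine ⟨z₀, r, hz₀, mem_ball_zero_iff.1 (hr0 (by rw [mem_preimage, hz₀]; exact h0)), ?_⟩
  intro u hu z hz
  have h1 : e u ∉ K := fun h1 => by
    have := mem_ball_zero_iff.1 (hr0 h1)
    exact absurd hu this.ne
  have h2 : e u ∈ expI '' P ∪ {0} := by
    rw [← hr]
    exact mem_range_self u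
  rw [← hz] at h1 h2
  exact h.mem_gap_of_expI (h2.resolve_right (expI_ne_zero z)) (not_not.1 h1)

theorem exists_curve (h : IsSplit L P) (hp : IsPlaneCover p) :
    ∃ Γ : Set (Torus 2), Γ ⊆ p '' gap L P ∧ IsSimpleClosedCurveT2 Γ ∧ IsEssentialT2 Γ := by
  obtain ⟨e, he, hr⟩ := h.exists_embedding
  obtain ⟨z₀, r, hz₀, hzr, hgap⟩ := h.exists_radius he hr
  have hr0 : 0 < r := (norm_nonneg _).trans_lt hzr
  set w : AddCircle (1 : ℝ) → ℂ := fun θ => e (r * AddCircle.toCircle θ) with hw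
  have hc : Continuous fun θ : AddCircle (1 : ℝ) => (AddCircle.toCircle θ : ℂ) :=
    continuous_subtype_val.comp AddCircle.continuous_toCircle
  have hwc : Continuous w := he.continuous.comp (by fun_prop)
  have hnorm : ∀ θ : AddCircle (1 : ℝ), ‖(r * AddCircle.toCircle θ : ℂ)‖ = r := fun θ => by
    rw [norm_mul, Circle.norm_coe, Complex.norm_real, Real.norm_of_nonneg hr0.le, mul_one]
  have hw0 : ∀ θ, w θ ≠ 0 := fun θ h0 => by
    have h1 := he.injective ((hz₀.trans h0.symm))
    rw [h1, hnorm] at hzr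
    exact lt_irrefl _ hzr
  have hwinj : Function.Injective w := fun θ θ' hθ => by
    have h1 := mul_left_cancel₀ (by exact_mod_cast hr0.ne') (he.injective hθ)
    exact AddCircle.injective_toCircle one_ne_zero (Subtype.ext h1)
  obtain ⟨l, hl, hl'⟩ := exists_continuous_log (g := fun t : ℝ => w (t : AddCircle (1 : ℝ)))
    (hwc.comp (AddCircle.continuous_mk' 1)) (fun t => hw0 _)
  set m : ℝ → ℂ := fun t => l t / (2 * Real.pi * I) with hm
  have hmc : Continuous m := by fun_prop
  have hmE : ∀ t : ℝ, expI (m t) = w t := fun t => by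
    rw [expI, hm, mul_div_cancel₀ _ two_pi_I_ne_zero, hl']
  have hmgap : ∀ t, m t ∈ gap L P := fun t => hgap _ (hnorm t) _ (hmE t)
  have hper : Function.Periodic (p ∘ m) 1 := fun t => by
    have h1 : expI (m (t + 1)) = expI (m t) := by
      rw [hmE, hmE]
      simp
    obtain ⟨j, hj⟩ := expI_eq_iff.1 h1
    rw [Function.comp_apply, hj, hp.map_add_intCast, Function.comp_apply]
  set γ : AddCircle (1 : ℝ) → Torus 2 := hper.lift with hγ
  have hγm : ∀ t : ℝ, γ t = p (m t) := fun t => rfl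
  have hγc : Continuous γ :=
    continuous_quot_lift _ (hp.continuous.comp hmc)
  have hγinj : Function.Injective γ := by
    intro θ θ' hθ
    obtain ⟨t, rfl⟩ := QuotientAddGroup.mk_surjective θ
    obtain ⟨t', rfl⟩ := QuotientAddGroup.mk_surjective θ'
    obtain ⟨a, b, hab⟩ := (hp.eq_iff (m t) (m t')).1 hθ
    have h1 := hmgap t'
    rw [hab] at h1
    obtain rfl := h.eq_of_mem_gap (hmgap t) h1
    apply hwinj
    rw [← hmE t, ← hmE t', expI_eq_iff]
    exact ⟨-a, by rw [hab]; simp⟩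
  refine ⟨range γ, ?_, ⟨γ, (hγc.isClosedEmbedding hγinj).isEmbedding, rfl⟩, ?_⟩
  · rintro _ ⟨θ, rfl⟩
    obtain ⟨t, rfl⟩ := QuotientAddGroup.mk_surjective θ
    exact ⟨m t, hmgap t, rfl⟩
  · by_contra hess
    obtain ⟨s, hs, hs'⟩ := hp.exists_section hess
    have hsc : Continuous fun θ => s (γ θ) := hs.comp_continuous hγc fun θ => mem_range_self θ
    refine isEmpty_log_of_injective he.continuous he.injective hzr
      (l₀ := fun θ => (Real.log ‖w θ‖ : ℝ) + 2 * Real.pi * I * ((s (γ θ)).re : ℂ)) ?_ fun θ => ?_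
    · have h1 : Continuous fun θ => Real.log ‖w θ‖ :=
        hwc.norm.log fun θ => (norm_pos_iff.2 (hw0 θ)).ne'
      exact (continuous_ofReal.comp h1).add
        (continuous_const.mul (continuous_ofReal.comp (continuous_re.comp hsc)))
    · obtain ⟨t, rfl⟩ := QuotientAddGroup.mk_surjective θ
      rw [hz₀, sub_zero]
      change _ = w t
      obtain ⟨a, b, hab⟩ := (hp.eq_iff (m t) (s (γ t))).1 (hs' (γ t) (mem_range_self _)).symm
      have h2 : (s (γ t)).re = (m t).re + a := by
        rw [hab]
        simp
      change exp ((Real.log ‖w t‖ : ℝ) + 2 * Real.pi * I * ((s (γ t)).re : ℂ)) = w t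
      rw [← hmE t, norm_expI, Real.log_exp, h2, expI, Complex.exp_eq_exp_iff_exists_int]
      refine ⟨a, ?_⟩
      conv_rhs => rw [← re_add_im (m t)]
      push_cast
      linear_combination (-2 * Real.pi * (m t).im : ℂ) * I_mul_I

end IsSplit

end Curve

end TorusCircloid

namespace TorusCircloid

section Fill

open Set Filter Topology Complex Metric

theorem exists_unbounded_component {K : Set ℂ} (hK : IsCompact K) :
    ∃ Ω, IsOpen Ω ∧ IsPreconnected Ω ∧ Disjoint Ω K ∧ (∃ R : ℝ, {z : ℂ | R ≤ ‖z‖} ⊆ Ω) ∧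
      ∀ S, IsPreconnected S → Disjoint S K → (S ∩ Ω).Nonempty → S ⊆ Ω := by
  obtain ⟨R, hR, hRK⟩ := hK.isBounded.subset_ball_lt 0 0
  have hRn : ‖(R : ℂ)‖ = R := by rw [norm_real, Real.norm_of_nonneg hR.le]
  have hT : {z : ℂ | R ≤ ‖z‖} ⊆ Kᶜ := fun z hz h => by
    have h1 := mem_ball_zero_iff.1 (hRK h)
    exact absurd hz h1.not_ge
  refine ⟨connectedComponentIn Kᶜ R, hK.isClosed.isOpen_compl.connectedComponentIn,
    isPreconnected_connectedComponentIn,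
    subset_compl_iff_disjoint_right.1 (connectedComponentIn_subset _ _),
    ⟨R, (isPreconnected_norm_ge hR).subset_connectedComponentIn hRn.ge hT⟩, ?_⟩
  rintro S hS hSK ⟨z, hz, hz'⟩
  rw [connectedComponentIn_eq hz']
  exact hS.subset_connectedComponentIn hz (subset_compl_iff_disjoint_right.2 hSK)

/-- The unbounded component of the complement of a compact set contains the translate of some
point of the set by any nonzero vector. -/
theorem exists_add_mem_of_unbounded {K Ω : Set ℂ} (hK : IsCompact K) (hne : K.Nonempty)
    (hΩ : ∃ R : ℝ, {z : ℂ | R ≤ ‖z‖} ⊆ Ω)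
    (hmax : ∀ S, IsPreconnected S → Disjoint S K → (S ∩ Ω).Nonempty → S ⊆ Ω) {m : ℂ}
    (hm : m ≠ 0) : ∃ z ∈ K, z + m ∈ Ω := by
  obtain ⟨R, hR⟩ := hΩ
  let φ : ℂ →ₗ[ℝ] ℝ := m.re • reLm + m.im • imLm
  have hφ : ∀ z, φ z = m.re * z.re + m.im * z.im := fun z => rfl
  have hφc : Continuous φ := by
    have : ⇑φ = fun z : ℂ => m.re * z.re + m.im * z.im := funext hφ
    rw [this]
    fun_prop
  obtain ⟨z, hz, hzmax⟩ := hK.exists_isMaxOn hne hφc.continuousOn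
  have hmm : 0 < φ m := by
    rw [hφ]
    have := normSq_pos.2 hm
    rwa [normSq_apply] at this
  have hH : IsPreconnected {w | φ z < φ w} := ((convex_Ioi (φ z)).linear_preimage φ).isPreconnected
  refine ⟨z, hz, hmax _ hH ?_ ?_ ?_⟩
  · rw [Set.disjoint_left]
    intro w hw hwK
    exact absurd (show φ w ≤ φ z from hzmax hwK) (not_le.2 hw)
  · obtain ⟨n, hn⟩ := exists_nat_gt ((R + ‖z‖) / ‖m‖)
    refine ⟨z + (((n : ℝ) + 1) • m), ?_, hR ?_⟩
    · change φ z < _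
      rw [_root_.map_add, map_smul, smul_eq_mul]
      have : 0 < ((n : ℝ) + 1) * φ m := by positivity
      linarith
    · have hm0 := norm_pos_iff.2 hm
      rw [div_lt_iff₀ hm0] at hn
      have h1 := norm_sub_le (z + ((n : ℝ) + 1) • m) z
      rw [add_sub_cancel_left, norm_smul, Real.norm_of_nonneg (by positivity)] at h1
      change R ≤ _
      nlinarith
  · change φ z < _
    rw [_root_.map_add]
    linarith

theorem disjoint_fill_translate {K Ω : Set ℂ} (hK : IsCompact K) (hK' : IsConnected K)
    (hΩd : Disjoint Ω K) (hΩ : ∃ R : ℝ, {z : ℂ | R ≤ ‖z‖} ⊆ Ω)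
    (hmax : ∀ S, IsPreconnected S → Disjoint S K → (S ∩ Ω).Nonempty → S ⊆ Ω) {m : ℂ}
    (hm : m ≠ 0) (hd : ∀ z ∈ K, z + m ∉ K) : ∀ z ∉ Ω, z + m ∈ Ω := by
  have htr : ∀ v : ℂ, v ≠ 0 → (∀ z ∈ K, z + v ∉ K) → ∀ z ∈ K, z + v ∈ Ω := by
    intro v hv hvK z hz
    refine hmax ((fun z => z + v) '' K) (hK'.isPreconnected.image _ (by fun_prop)) ?_ ?_ ⟨z, hz, rfl⟩
    · rw [Set.disjoint_left]
      rintro _ ⟨w, hw, rfl⟩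
      exact hvK w hw
    · obtain ⟨w, hw, hw'⟩ := exists_add_mem_of_unbounded hK hK'.nonempty hΩ hmax hv
      exact ⟨w + v, ⟨w, hw, rfl⟩, hw'⟩
  have h1 := htr m hm hd
  have h2 := htr (-m) (neg_ne_zero.2 hm) fun z hz h => hd _ h (by simpa using hz)
  have hpre : IsPreconnected Ωᶜ :=
    isPreconnected_compl_of_components hK.isClosed hK'.isPreconnected hK'.nonempty hΩd hmax
  intro z hz
  refine hmax ((fun z => z + m) '' Ωᶜ) (hpre.image _ (by fun_prop)) ?_ ?_ ⟨z, hz, rfl⟩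
  · rw [Set.disjoint_left]
    rintro _ ⟨w, hw, rfl⟩ h3
    exact hw (by simpa using h2 _ h3)
  · obtain ⟨w, hw⟩ := hK'.nonempty
    exact ⟨w + m, ⟨w, Set.disjoint_right.1 hΩd hw, rfl⟩, h1 w hw⟩

namespace IsPlaneCover

variable {p : ℂ → Torus 2}

theorem injOn_ball (hp : IsPlaneCover p) (z : ℂ) : InjOn p (ball z (1 / 2)) := by
  intro x hx y hy hxy
  obtain ⟨a, b, rfl⟩ := (hp.eq_iff _ _).1 hxy
  have h1 : ‖(a : ℂ) + b * I‖ < 1 := by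
    have h2 := dist_triangle_right (x + a + b * I) x z
    rw [mem_ball] at hx hy
    rw [dist_eq_norm, show x + a + b * I - x = (a : ℂ) + b * I by ring] at h2
    linarith
  have h3 : |(a : ℝ)| < 1 := by
    have := abs_re_le_norm ((a : ℂ) + b * I)
    simp at this
    linarith
  have h4 : |(b : ℝ)| < 1 := by
    have := abs_im_le_norm ((a : ℂ) + b * I)
    simp at this
    linarith
  have h5 : a = 0 := Int.abs_lt_one_iff.1 (by exact_mod_cast h3)
  have h6 : b = 0 := Int.abs_lt_one_iff.1 (by exact_mod_cast h4)
  simp [h5, h6]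

theorem not_isEssential_image (hp : IsPlaneCover p) {K : Set ℂ} (hK : IsCompact K)
    (hK' : IsConnected K) (hinj : InjOn p K) : ¬IsEssentialT2 (p '' K) := by
  obtain ⟨Ω, hΩo, hΩp, hΩd, hΩ, hmax⟩ := exists_unbounded_component hK
  have hpre : IsPreconnected Ωᶜ :=
    isPreconnected_compl_of_components hK.isClosed hK'.isPreconnected hK'.nonempty hΩd hmax
  have hKΩ : K ⊆ Ωᶜ := subset_compl_iff_disjoint_left.2 hΩd
  have hcomp : IsCompact Ωᶜ := by
    obtain ⟨R, hR⟩ := hΩ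
    refine Metric.isCompact_of_isClosed_isBounded hΩo.isClosed_compl
      ((Metric.isBounded_ball (x := (0 : ℂ)) (r := R)).subset fun z hz => ?_)
    rw [mem_ball_zero_iff]
    by_contra! h1
    exact hz (hR h1)
  have hinj' : InjOn p Ωᶜ := by
    intro x hx y hy hxy
    obtain ⟨a, b, rfl⟩ := (hp.eq_iff _ _).1 hxy
    by_contra hne
    have hm : (a : ℂ) + b * I ≠ 0 := fun h0 => hne (by rw [add_assoc, h0, add_zero])
    refine hy ?_
    rw [add_assoc]
    refine disjoint_fill_translate hK hK' hΩd hΩ hmax hm (fun z hz h => hm ?_) x hx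
    have h1 := hinj hz h (by rw [← add_assoc, hp.map_add])
    simpa using h1
  obtain ⟨N, hN, hKN, hNinj⟩ := hinj'.exists_isOpen_superset hcomp
    (fun x _ => hp.continuous.continuousAt)
    (fun x _ => ⟨_, ball_mem_nhds x one_half_pos, hp.injOn_ball x⟩)
  obtain ⟨O, hO, hO', hb, hOc, hKO, hON⟩ :=
    exists_cell hcomp ⟨hK'.nonempty.mono hKΩ, hpre⟩ (by rwa [compl_compl]) hN hKN
  obtain ⟨e, he, hr⟩ := exists_isOpenEmbedding_range_eq hO hO' hb hOc
  have hemb : IsOpenEmbedding (p ∘ e) := by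
    refine .of_continuous_injective_isOpenMap (hp.continuous.comp he.continuous) ?_
      (hp.isOpenMap.comp he.isOpenMap)
    intro x y hxy
    exact he.injective (hNinj (hON (hr ▸ mem_range_self x)) (hON (hr ▸ mem_range_self y)) hxy)
  let χ := (latticeChart 1 0 0 1 (by norm_num)).symm
  refine not_not.2 ⟨p ∘ e ∘ χ, hemb.comp χ.isOpenEmbedding, ?_⟩
  rintro _ ⟨z, hz, rfl⟩
  have h1 : z ∈ range e := by
    rw [hr]
    exact hKO (hKΩ hz)
  obtain ⟨w, rfl⟩ := h1
  exact ⟨χ.symm w, by simp⟩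

end IsPlaneCover

end Fill

end TorusCircloid

namespace TorusCircloid

section Circloid

open Set Filter Topology Complex Metric

theorem map_add_intCast_of_map_add_one {M : Set ℂ} (hM : ∀ z ∈ M, ∀ j : ℤ, z + j ∈ M) {d : ℂ → ℂ}
    {v : ℂ} (hd : ∀ z ∈ M, d (z + (1 : ℝ)) = d z + v) {z : ℂ} (hz : z ∈ M) (j : ℤ) :
    d (z + j) = d z + j * v := by
  have h1 : ∀ z ∈ M, d (z + 1) = d z + v := fun z hz => by simpa using hd z hz
  induction j with
  | zero => simp
  | succ n ih =>
    have := h1 _ (hM z hz n)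
    rw [ih] at this
    push_cast at this ⊢
    rw [← add_assoc, this]
    ring
  | pred n ih =>
    have := h1 _ (hM z hz (-n - 1))
    push_cast at this ih ⊢
    rw [show z + (-(n : ℂ) - 1) + 1 = z + -n by ring, ih] at this
    linear_combination -this

namespace IsSplit

variable {p : ℂ → Torus 2} {L P : Set ℂ}

theorem eq_zero_of_mem_compl (h : IsSplit L P) {z : ℂ} {a b : ℤ} (hz : z ∈ (L ∪ P)ᶜ)
    (hw : z + a + b * I ∈ (L ∪ P)ᶜ) : b = 0 := by
  have key : ∀ {z : ℂ} {a b : ℤ}, z ∈ (L ∪ P)ᶜ → z + a + b * I ∈ (L ∪ P)ᶜ → 0 ≤ b := by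
    intro z a b hz hw
    by_contra! hb
    refine hw (Or.inl ?_)
    have h1 := h.add_mem_of_nonpos (h.shift z fun hP => hz (Or.inr hP)) a (b := b + 1) (by omega)
    convert h1 using 1
    push_cast
    ring
  refine le_antisymm ?_ (key hz hw)
  have h2 := key (a := -a) (b := -b) hw (by
    convert hz using 1
    push_cast
    ring)
  omega

theorem not_isEssential_of_sides (h : IsSplit L P) (hp : IsPlaneCover p) {C : Set (Torus 2)}
    (hCc : IsClosed C) (hC' : IsConnected C) (hC : C ⊆ p '' (L ∪ P)ᶜ)
    (hs : (side 1 (p ⁻¹' C ∩ (L ∪ P)ᶜ) ∩ side (-1) (p ⁻¹' C ∩ (L ∪ P)ᶜ)).Nonempty) :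
    ¬IsEssentialT2 C := by
  set M := p ⁻¹' C ∩ (L ∪ P)ᶜ with hM
  have hMc : IsClosed M := (hCc.preimage hp.continuous).inter h.isClosed_compl_union
  have hMp : ∀ z ∈ M, ∀ j : ℤ, z + j ∈ M := fun z hz j =>
    ⟨by rw [mem_preimage, hp.map_add_intCast]; exact hz.1, h.add_intCast_mem hz.2 j⟩
  obtain ⟨c, hc⟩ := h.exists_abs_im_le
  have htop : ∀ z ∈ M, z.im < (⟨0, c + 1⟩ : ℂ).im := fun z hz => by
    have := (abs_le.1 (hc z hz.2)).2
    simp only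
    linarith
  have hbot : ∀ z ∈ M, (⟨0, -c - 1⟩ : ℂ).im < z.im := fun z hz => by
    have := (abs_le.1 (hc z hz.2)).1
    simp only
    linarith
  have hj := joinedIn_of_side_inter hMc
    (mem_side_of_forall_le (one_pow 2) (fun hx => lt_irrefl _ (htop _ hx))
      (fun z hz => by linarith [htop z hz]))
    (mem_side_of_forall_le neg_one_sq_real (fun hx => lt_irrefl _ (hbot _ hx))
      (fun z hz => by linarith [hbot z hz])) hs
  obtain ⟨d, hdc, hd1, hdp⟩ := exists_index one_pos
    (fun z hz j => by simpa using hMp z hz j) htop hbot hj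
  have hdj : ∀ z ∈ M, ∀ j : ℤ, d (z + j) = d z + j * (2 * Real.pi * I) := fun z hz j =>
    map_add_intCast_of_map_add_one hMp hdp hz j
  set K := M ∩ d ⁻¹' {0} with hK
  have hKc : IsClosed K := hdc.preimage_isClosed_of_isClosed hMc isClosed_singleton
  have hKb : Bornology.IsBounded K := by
    have h1 : IsCompact ((Icc (0:ℝ) 1 ×ℂ Icc (-c) c) ∩ M) :=
      (isCompact_Icc.reProdIm isCompact_Icc).inter_right hMc
    obtain ⟨B, hB⟩ := h1.exists_bound_of_continuousOn (hdc.mono inter_subset_right)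
    have h2 : IsCompact (Icc (-B) (B + 1) ×ℂ Icc (-c) c) := isCompact_Icc.reProdIm isCompact_Icc
    refine h2.isBounded.subset fun z hz => ?_
    have h3 := hB (z + (-⌊z.re⌋ : ℤ)) ⟨?_, hMp z hz.1 _⟩
    · rw [hdj z hz.1, show d z = 0 from hz.2, zero_add, norm_mul, norm_mul, norm_mul, norm_I,
        norm_real, Real.norm_of_nonneg Real.pi_pos.le, Complex.norm_intCast] at h3
      rw [Complex.mem_reProdIm]
      have h4 : |((-⌊z.re⌋ : ℤ) : ℝ)| ≤ B := by
        simp at h3 ⊢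
        nlinarith [Real.pi_gt_three, abs_nonneg (⌊z.re⌋ : ℝ)]
      rw [abs_le] at h4
      push_cast at h4
      exact ⟨⟨by linarith [Int.floor_le z.re], by linarith [Int.lt_floor_add_one z.re]⟩,
        abs_le.1 (hc z hz.1.2)⟩
    · rw [Complex.mem_reProdIm]
      constructor
      · simp only [add_re, intCast_re, mem_Icc]
        push_cast
        constructor <;> linarith [Int.floor_le z.re, Int.lt_floor_add_one z.re]
      · simpa using abs_le.1 (hc z hz.1.2)
  have hKcomp : IsCompact K := Metric.isCompact_of_isClosed_isBounded hKc hKb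
  have hinj : InjOn p K := by
    intro z hz w hw hzw
    obtain ⟨a, b, rfl⟩ := (hp.eq_iff _ _).1 hzw
    obtain rfl := h.eq_zero_of_mem_compl hz.1.2 hw.1.2
    have h1 : d (z + a) = 0 := by simpa using hw.2
    rw [hdj z hz.1, show d z = 0 from hz.2, zero_add] at h1
    have h2 := (mul_eq_zero.1 h1).resolve_right two_pi_I_ne_zero
    simp [h2]
  have himg : p '' K = C := by
    apply subset_antisymm
    · rintro _ ⟨z, hz, rfl⟩
      exact hz.1.1
    · intro x hx
      obtain ⟨z, hz, rfl⟩ := hC hx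
      have hzM : z ∈ M := ⟨hx, hz⟩
      obtain ⟨n, hn⟩ := Complex.exp_eq_one_iff.1 (hd1 z hzM)
      refine ⟨z + (-n : ℤ), ⟨hMp z hzM _, ?_⟩, hp.map_add_intCast _ _⟩
      rw [mem_preimage, hdj z hzM, hn]
      simp
  have hKconn : IsConnected K := by
    refine ⟨?_, ?_⟩
    · rw [← himg] at hC'
      exact hC'.nonempty.of_image
    · have : CompactSpace K := isCompact_iff_compactSpace.1 hKcomp
      have hemb : IsClosedEmbedding (K.domRestrict p) :=
        (hp.continuous.comp continuous_subtype_val).isClosedEmbedding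
          (injOn_iff_injective.1 hinj)
      rw [isPreconnected_iff_preconnectedSpace]
      refine ⟨hemb.isInducing.isPreconnected_image.1 ?_⟩
      rw [image_univ, range_domRestrict, himg]
      exact hC'.isPreconnected
  rw [← himg]
  exact hp.not_isEssential_image hKcomp hKconn hinj

theorem not_isPreconnected_compl (h : IsSplit L P) (hp : IsPlaneCover p) {C : Set (Torus 2)}
    (hCc : IsClosed C) (hC : C ⊆ p '' (L ∪ P)ᶜ)
    (hs : Disjoint (side 1 (p ⁻¹' C ∩ (L ∪ P)ᶜ)) (side (-1) (p ⁻¹' C ∩ (L ∪ P)ᶜ)))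
    {x : ℂ} (hx : x ∈ (L ∪ P)ᶜ) (hxC : p x ∉ C) : ¬IsPreconnected Cᶜ := by
  set M := p ⁻¹' C ∩ (L ∪ P)ᶜ with hM
  have hMc : IsClosed M := (hCc.preimage hp.continuous).inter h.isClosed_compl_union
  obtain ⟨c, hc, hc'⟩ := h.bound
  have hL : L ⊆ side (-1) M := halfPlane_subset_side (r := c) h.preL
    (Set.disjoint_left.2 fun z hz hzM => hzM.2 (Or.inl hz))
    (fun w hw => hc w (by have : c < -1 * w.im := hw; linarith))
  have hP : P ⊆ side 1 M := halfPlane_subset_side (r := c) h.preP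
    (Set.disjoint_left.2 fun z hz hzM => hzM.2 (Or.inr hz))
    (fun w hw => hc' w (by have : c < 1 * w.im := hw; linarith))
  have hL' : side (-1) M ⊆ L := by
    refine (halfPlane_subset_side (isPreconnected_side neg_one_sq_real M) ?_ (r := c) ?_).trans h.sideL
    · exact ((hs.symm.mono_right hP).closure_right (isOpen_side hMc))
    · exact fun w hw => hL (hc w (by have : c < -1 * w.im := hw; linarith))
  have hP' : side 1 M ⊆ P := by
    refine (halfPlane_subset_side (isPreconnected_side (one_pow 2) M) ?_ (r := c) ?_).trans h.sideP
    · exact ((hs.mono_right hL).closure_right (isOpen_side hMc))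
    · exact fun w hw => hP (hc' w (by have : c < 1 * w.im := hw; linarith))
  have hxM : x ∈ Mᶜ := fun hxM => hxC hxM.1
  set Q := connectedComponentIn Mᶜ x with hQ
  have hQo : IsOpen Q := hMc.isOpen_compl.connectedComponentIn
  have hxQ : x ∈ Q := mem_connectedComponentIn hxM
  have hQM : Disjoint Q M := subset_compl_iff_disjoint_right.1 (connectedComponentIn_subset _ _)
  have hQC : Q ⊆ (L ∪ P)ᶜ := by
    rintro z hz (hzL | hzP)
    · exact hx (Or.inl (hL' (subset_side isPreconnected_connectedComponentIn hQM
        ⟨z, hz, hL hzL⟩ hxQ)))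
    · exact hx (Or.inr (hP' (subset_side isPreconnected_connectedComponentIn hQM
        ⟨z, hz, hP hzP⟩ hxQ)))
  have hpQ : p '' Q ⊆ Cᶜ := by
    rintro _ ⟨z, hz, rfl⟩ hzC
    exact Set.disjoint_left.1 hQM hz ⟨hzC, hQC hz⟩
  have hopen : IsOpen (p ⁻¹' (Cᶜ \ p '' Q)) := by
    rw [Metric.isOpen_iff]
    rintro z ⟨hz, hzQ⟩
    obtain ⟨r, hr, hB⟩ := Metric.isOpen_iff.1 (hCc.isOpen_compl.preimage hp.continuous) z hz
    refine ⟨r, hr, fun w hw => ⟨hB hw, ?_⟩⟩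
    rintro ⟨q, hq, hqw⟩
    obtain ⟨a, b, rfl⟩ := (hp.eq_iff _ _).1 hqw.symm
    have hmap : ∀ v : ℂ, p (v + (a + b * I)) = p v := fun v => by
      rw [← add_assoc, hp.map_add]
    have h1 : (fun v => v + (a + b * I)) '' ball z r ⊆ Q := by
      rw [hQ, connectedComponentIn_eq hq]
      refine ((convex_ball z r).isPreconnected.image _ (by fun_prop)).subset_connectedComponentIn
        ⟨w, hw, by ring⟩ ?_
      rintro _ ⟨v, hv, rfl⟩ hvM
      refine hB hv ?_
      rw [← hmap]
      exact hvM.1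
    exact hzQ ⟨_, h1 ⟨z, mem_ball_self hr, rfl⟩, hmap z⟩
  have hopen' : IsOpen (Cᶜ \ p '' Q) := by
    rw [← image_preimage_eq (Cᶜ \ p '' Q) hp.surjective]
    exact hp.isOpenMap _ hopen
  intro hpre
  obtain ⟨g, hg⟩ := h.nonempty_gap
  have hgC : p g ∉ p '' (L ∪ P)ᶜ := by
    change p g ∈ (p '' (L ∪ P)ᶜ)ᶜ
    rw [h.compl_image_eq hp]
    exact ⟨g, hg, rfl⟩
  obtain ⟨y, -, hy, hy'⟩ := hpre (p '' Q) (Cᶜ \ p '' Q) (hp.isOpenMap _ hQo) hopen'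
    (fun y hy => by
      by_cases h1 : y ∈ p '' Q
      · exact Or.inl h1
      · exact Or.inr ⟨hy, h1⟩)
    ⟨p x, hxC, ⟨x, hxQ, rfl⟩⟩
    ⟨p g, fun h1 => hgC (hC h1), fun h1 => hgC (hC h1), fun h1 => hgC (image_mono hQC h1)⟩
  exact hy'.2 hy

theorem isCircloid (h : IsSplit L P) (hp : IsPlaneCover p) : IsCircloidT2 (p '' (L ∪ P)ᶜ) := by
  obtain ⟨Γ, hΓ, hΓ', hΓe⟩ := h.exists_curve hp
  refine ⟨⟨h.isCompact_image hp, h.isConnected_image hp, h.isEssential_image hp, ?_, Γ, ?_, hΓ', hΓe⟩,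
    ?_⟩
  · rw [h.compl_image_eq hp]
    exact ⟨h.nonempty_gap.image p, h.isPreconnected_gap.image p hp.continuous.continuousOn⟩
  · rwa [h.compl_image_eq hp]
  · rintro C hC ⟨hCc, hC', hCe, hCcompl, -⟩
    refine subset_antisymm hC ?_
    rintro _ ⟨x, hx, rfl⟩
    by_contra hxC
    by_cases hs : Disjoint (side 1 (p ⁻¹' C ∩ (L ∪ P)ᶜ)) (side (-1) (p ⁻¹' C ∩ (L ∪ P)ᶜ))
    · exact h.not_isPreconnected_compl hp hCc.isClosed hC hs hx hxC hCcompl.isPreconnected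
    · rw [Set.not_disjoint_iff_nonempty_inter] at hs
      exact h.not_isEssential_of_sides hp hCc.isClosed hC' hC hs hCe

end IsSplit

end Circloid

end TorusCircloid

namespace TorusCircloid

section Dynamics

open Set Filter Topology

variable {X : Type*}

theorem exists_finset_returns [TopologicalSpace X] {f : X → X} (hf : Continuous f)
    (h : NonWandering f) (K : ℕ) :
    ∀ U : Set X, IsOpen U → U.Nonempty →
      ∃ (T : Finset ℕ) (x : X), T.card = K + 1 ∧ ∀ t ∈ T, f^[t] x ∈ U := by
  induction K with
  | zero =>
    rintro U - ⟨x, hx⟩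
    exact ⟨{0}, x, by simp, by simpa using hx⟩
  | succ K ih =>
    intro U hU hne
    obtain ⟨n, hn, -, ⟨x, hx, rfl⟩, hx'⟩ := h U hU hne
    obtain ⟨T, y, hT, hy⟩ := ih (U ∩ f^[n] ⁻¹' U) (hU.inter (hU.preimage (hf.iterate n)))
      ⟨x, hx, hx'⟩
    have hTne : T.Nonempty := Finset.card_pos.1 (by omega)
    have hmax : T.max' hTne + n ∉ T := fun hm => by
      have := T.le_max' _ hm
      omega
    refine ⟨insert (T.max' hTne + n) T, y, by rw [Finset.card_insert_of_notMem hmax, hT], ?_⟩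
    intro t ht
    rcases Finset.mem_insert.1 ht with rfl | ht
    · rw [add_comm, Function.iterate_add_apply]
      exact (hy _ (T.max'_mem hTne)).2
    · exact (hy t ht).1

/-- A non-wandering map has returns to open sets at times divisible by a given integer. -/
theorem NonWandering.exists_mul_return [TopologicalSpace X] {f : X → X} (h : NonWandering f)
    (hf : Continuous f) {U : Set X} (hU : IsOpen U) (hne : U.Nonempty) {n : ℕ} (hn : 1 ≤ n) :
    ∃ j : ℕ, 1 ≤ j ∧ ∃ x ∈ U, f^[n * j] x ∈ U := by
  obtain ⟨T, x, hT, hx⟩ := exists_finset_returns hf h n U hU hne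
  obtain ⟨s, hs, t, ht, hst, hmod⟩ := Finset.exists_ne_map_eq_of_card_lt_of_maps_to
    (s := T) (t := Finset.range n) (f := fun t => t % n) (by simp [hT])
    (fun t _ => by simpa using Nat.mod_lt t hn)
  wlog hlt : s < t generalizing s t
  · exact this t ht s hs hst.symm hmod.symm (by omega)
  obtain ⟨j, hj⟩ := (Nat.modEq_iff_dvd' hlt.le).1 hmod
  refine ⟨j, ?_, f^[s] x, hx s hs, ?_⟩
  · rcases Nat.eq_zero_or_pos j with rfl | hj0
    · omega
    · exact hj0
  · rw [← hj, ← Function.iterate_add_apply, Nat.sub_add_cancel hlt.le]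
    exact hx t ht

/-- The saturation of a set under the orbit relation of an injective map. -/
def orbitSaturation (f : X → X) (U : Set X) : Set X := {x | ∃ a b : ℕ, ∃ u ∈ U, f^[a] x = f^[b] u}

theorem exists_homeomorph_eq_iterate [TopologicalSpace X] (g : X ≃ₜ X) (n : ℕ) :
    ∃ h : X ≃ₜ X, ⇑h = (⇑g)^[n] := by
  induction n with
  | zero => exact ⟨Homeomorph.refl X, rfl⟩
  | succ n ih =>
    obtain ⟨h, hh⟩ := ih
    refine ⟨g.trans h, ?_⟩
    funext x
    rw [Homeomorph.trans_apply, hh, Function.iterate_succ_apply]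

theorem isOpen_orbitSaturation [TopologicalSpace X] (f : X ≃ₜ X) {U : Set X} (hU : IsOpen U) :
    IsOpen (orbitSaturation f U) := by
  have h1 : orbitSaturation f U = ⋃ a : ℕ, ⋃ b : ℕ, (⇑f)^[a] ⁻¹' ((⇑f)^[b] '' U) := by
    ext x
    simp [orbitSaturation, eq_comm]
  rw [h1]
  refine isOpen_iUnion fun a => isOpen_iUnion fun b => ?_
  obtain ⟨h, hh⟩ := exists_homeomorph_eq_iterate f b
  rw [← hh]
  exact (h.isOpenMap _ hU).preimage (f.continuous.iterate a)

theorem subset_orbitSaturation (f : X → X) (U : Set X) : U ⊆ orbitSaturation f U :=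
  fun x hx => ⟨0, 0, x, hx, rfl⟩

theorem map_mem_orbitSaturation_iff {f : X → X} {U : Set X} {x : X} :
    f x ∈ orbitSaturation f U ↔ x ∈ orbitSaturation f U := by
  constructor
  · rintro ⟨a, b, u, hu, h⟩
    exact ⟨a + 1, b, u, hu, h⟩
  · rintro ⟨a, b, u, hu, h⟩
    refine ⟨a, b + 1, u, hu, ?_⟩
    rw [← Function.iterate_succ_apply, Function.iterate_succ_apply', h,
      Function.iterate_succ_apply']

/-- A non-wandering homeomorphism that is not transitive has disjoint invariant open sets. -/
theorem NonWandering.exists_disjoint_invariant [TopologicalSpace X] {f : X ≃ₜ X} (h : NonWandering f)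
    (ht : ¬TopTransitive f) :
    ∃ U V : Set X, IsOpen U ∧ IsOpen V ∧ U.Nonempty ∧ V.Nonempty ∧ Disjoint U V ∧
      (∀ x, f x ∈ U ↔ x ∈ U) ∧ ∀ x, f x ∈ V ↔ x ∈ V := by
  unfold TopTransitive at ht
  push Not at ht
  obtain ⟨U, V, hU, hV, hUne, hVne, hUV⟩ := ht
  have hpos : ∀ n : ℕ, 1 ≤ n → ∀ u ∈ U, (⇑f)^[n] u ∉ V := fun n hn u hu hv => by
    have h1 : (⇑f)^[n] u ∈ (⇑f)^[n] '' U ∩ V := ⟨⟨u, hu, rfl⟩, hv⟩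
    rw [hUV n hn] at h1
    exact h1
  have hneg : ∀ n : ℕ, ∀ v ∈ V, (⇑f)^[n] v ∉ U := fun n v hv hu => by
    obtain ⟨j, hj, y, hy, hy'⟩ := NonWandering.exists_mul_return h f.continuous
      (hV.inter (hU.preimage (f.continuous.iterate n))) ⟨v, hv, hu⟩ (Nat.succ_pos n)
    have h1 : n + 1 ≤ (n + 1) * j := Nat.le_mul_of_pos_right _ hj
    refine hpos ((n + 1) * j - n) (by omega) _ hy.2 ?_
    rw [← Function.iterate_add_apply, Nat.sub_add_cancel (by omega)]
    exact hy'.1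
  have hpos' : ∀ n : ℕ, ∀ u ∈ U, (⇑f)^[n] u ∉ V := fun n u hu hv => by
    rcases Nat.eq_zero_or_pos n with rfl | hn
    · exact hneg 0 u hv hu
    · exact hpos n hn u hu hv
  refine ⟨orbitSaturation f U, orbitSaturation f V, isOpen_orbitSaturation f hU,
    isOpen_orbitSaturation f hV, hUne.mono (subset_orbitSaturation f U),
    hVne.mono (subset_orbitSaturation f V), ?_, fun x => map_mem_orbitSaturation_iff,
    fun x => map_mem_orbitSaturation_iff⟩
  rw [Set.disjoint_left]
  rintro x ⟨a, b, u, hu, hxu⟩ ⟨c, d, v, hv, hxv⟩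
  have h1 : (⇑f)^[c + b] u = (⇑f)^[a + d] v := by
    rw [Function.iterate_add_apply, ← hxu, Function.iterate_add_apply, ← hxv,
      ← Function.iterate_add_apply, ← Function.iterate_add_apply, add_comm]
  rcases le_total (c + b) (a + d) with hle | hle
  · obtain ⟨n, hn⟩ := Nat.exists_eq_add_of_le hle
    rw [hn, Function.iterate_add_apply _ (c + b) n] at h1
    have h2 := f.injective.iterate _ h1
    exact hneg n v hv (h2 ▸ hu)
  · obtain ⟨n, hn⟩ := Nat.exists_eq_add_of_le hle
    rw [hn, Function.iterate_add_apply _ (a + d) n] at h1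
    have h2 := f.injective.iterate _ h1
    exact hpos' n u hu (h2 ▸ hv)

end Dynamics

end TorusCircloid

namespace TorusCircloid

section Components

open Set Filter Topology Complex Metric

/-- `X` is a connected component of the open set `W`. -/
structure IsOpenComponent (W X : Set ℂ) : Prop where
  isOpen : IsOpen X
  conn : IsConnected X
  sub : X ⊆ W
  maximal : ∀ S, IsPreconnected S → S ⊆ W → (S ∩ X).Nonempty → S ⊆ X

variable {W X Y : Set ℂ}

theorem exists_isOpenComponent (hW : IsOpen W) {z : ℂ} (hz : z ∈ W) :
    ∃ X, IsOpenComponent W X ∧ z ∈ X := by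
  refine ⟨connectedComponentIn W z, ⟨hW.connectedComponentIn,
    isConnected_connectedComponentIn_iff.2 hz, connectedComponentIn_subset W z, ?_⟩,
    mem_connectedComponentIn hz⟩
  rintro S hS hSW ⟨w, hwS, hwX⟩
  rw [connectedComponentIn_eq hwX]
  exact hS.subset_connectedComponentIn hwS hSW

theorem IsOpenComponent.eq_of_inter (hX : IsOpenComponent W X) (hY : IsOpenComponent W Y)
    (h : (X ∩ Y).Nonempty) : X = Y :=
  (hY.maximal X hX.conn.isPreconnected hX.sub h).antisymm
    (hX.maximal Y hY.conn.isPreconnected hY.sub (by rwa [inter_comm]))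

theorem IsOpenComponent.image (hX : IsOpenComponent W X) (h : ℂ ≃ₜ ℂ)
    (hW : ∀ z, h z ∈ W ↔ z ∈ W) : IsOpenComponent W (h '' X) where
  isOpen := h.isOpenMap _ hX.isOpen
  conn := hX.conn.image _ h.continuous.continuousOn
  sub := by
    rintro _ ⟨z, hz, rfl⟩
    exact (hW z).2 (hX.sub hz)
  maximal := by
    rintro S hS hSW ⟨_, hwS, z, hz, rfl⟩
    have h1 : h.symm '' S ⊆ X := by
      refine hX.maximal _ (hS.image _ h.symm.continuous.continuousOn) ?_
        ⟨z, ⟨h z, hwS, h.symm_apply_apply z⟩, hz⟩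
      rintro _ ⟨w, hw, rfl⟩
      rw [← hW, h.apply_symm_apply]
      exact hSW hw
    intro w hw
    exact ⟨h.symm w, h1 ⟨w, hw, rfl⟩, h.apply_symm_apply w⟩

/-- `g` lifts `f` through the covering `p` and commutes with the deck transformations. -/
structure IsCoverLift (f : Torus 2 ≃ₜ Torus 2) (p : ℂ → Torus 2) (g : ℂ ≃ₜ ℂ) : Prop where
  cover : IsPlaneCover p
  comm : ∀ z (m n : ℤ), g (z + m + n * I) = g z + m + n * I
  semi : ∀ z, p (g z) = f (p z)

theorem isCoverLift_latticeChart {f : Torus 2 ≃ₜ Torus 2} {F : Rd 2 ≃ₜ Rd 2} (hF : IsLift f F)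
    (a b c d : ℤ) (h : a * d - b * c = 1) :
    IsCoverLift f (projT ∘ latticeChart a b c d h)
      ((latticeChart a b c d h).trans (F.trans (latticeChart a b c d h).symm)) where
  cover := isPlaneCover_latticeChart a b c d h
  comm z m n := by
    apply (latticeChart a b c d h).injective
    rw [latticeChart_add]
    simp [latticeChart_add, hF.2]
  semi z := by simp [hF.1]

/-- The set `U` contains a loop in the homotopy class of the deck transformation `v`. -/
def IsLoop (p : ℂ → Torus 2) (U : Set (Torus 2)) (v : ℂ) : Prop :=
  ∃ S, IsPreconnected S ∧ S ⊆ p ⁻¹' U ∧ ∃ z ∈ S, z + v ∈ S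

theorem IsLoop.change_chart {U : Set (Torus 2)} {a b c d a' b' c' d' : ℤ}
    (h : a * d - b * c = 1) (h' : a' * d' - b' * c' = 1) {m n m' n' : ℤ}
    (hl : IsLoop (projT ∘ latticeChart a' b' c' d' h') U (m' + n' * I))
    (h1 : a * m + b * n = a' * m' + b' * n') (h2 : c * m + d * n = c' * m' + d' * n') :
    IsLoop (projT ∘ latticeChart a b c d h) U (m + n * I) := by
  obtain ⟨S, hS, hSU, z, hz, hz'⟩ := hl
  let χ := (latticeChart a' b' c' d' h').trans (latticeChart a b c d h).symm
  refine ⟨χ '' S, hS.image _ χ.continuous.continuousOn, ?_, χ z, ⟨z, hz, rfl⟩, _, hz', ?_⟩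
  · rintro _ ⟨w, hw, rfl⟩
    simpa [χ] using hSU hw
  · apply (latticeChart a b c d h).injective
    rw [← add_assoc, ← add_assoc, latticeChart_add]
    simp [χ, latticeChart_add, h1, h2]

variable {f : Torus 2 ≃ₜ Torus 2} {p : ℂ → Torus 2} {g : ℂ ≃ₜ ℂ} {U : Set (Torus 2)}

theorem IsCoverLift.semi_iterate (hg : IsCoverLift f p g) (n : ℕ) (z : ℂ) :
    p (g^[n] z) = f^[n] (p z) :=
  (Function.Semiconj.iterate_right (show Function.Semiconj p g f from hg.semi) n) z

theorem IsCoverLift.comm_iterate (hg : IsCoverLift f p g) (k : ℕ) (z : ℂ) (m n : ℤ) :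
    g^[k] (z + m + n * I) = g^[k] z + m + n * I := by
  induction k with
  | zero => rfl
  | succ k ih => rw [Function.iterate_succ_apply', ih, hg.comm, Function.iterate_succ_apply']

theorem iterate_mem_iff (hU : ∀ x, f x ∈ U ↔ x ∈ U) (n : ℕ) (x : Torus 2) :
    (⇑f)^[n] x ∈ U ↔ x ∈ U := by
  induction n with
  | zero => rfl
  | succ n ih => rw [Function.iterate_succ_apply', hU, ih]

theorem IsOpenComponent.translate (hp : IsPlaneCover p) (hX : IsOpenComponent (p ⁻¹' U) X)
    (m n : ℤ) : IsOpenComponent (p ⁻¹' U) ((fun x => x + ((m : ℂ) + n * I)) '' X) :=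
  hX.image (Homeomorph.addRight ((m : ℂ) + n * I)) fun z => by
    simp only [Homeomorph.coe_addRight, mem_preimage, ← add_assoc, hp.map_add]

/-- A component of the lift of an invariant open set is periodic up to a deck transformation. -/
theorem IsOpenComponent.exists_return (hg : IsCoverLift f p g) (hnw : NonWandering f)
    (hU : ∀ x, f x ∈ U ↔ x ∈ U) (hX : IsOpenComponent (p ⁻¹' U) X) :
    ∃ N : ℕ, 1 ≤ N ∧ ∃ m n : ℤ, g^[N] '' X = (fun x => x + ((m : ℂ) + n * I)) '' X := by
  obtain ⟨N, hN, -, ⟨-, ⟨z, hz, rfl⟩, rfl⟩, w, hw, hwz⟩ :=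
    hnw (p '' X) (hg.cover.isOpenMap _ hX.isOpen) (hX.conn.nonempty.image p)
  rw [← hg.semi_iterate, hg.cover.eq_iff] at hwz
  obtain ⟨m, n, hmn⟩ := hwz
  obtain ⟨h, hh⟩ := exists_homeomorph_eq_iterate g N
  refine ⟨N, hN, m, n, ?_⟩
  rw [← hh]
  refine (hX.image h fun z => ?_).eq_of_inter (hX.translate hg.cover m n)
    ⟨h z, ⟨z, hz, rfl⟩, w, hw, ?_⟩
  · rw [mem_preimage, mem_preimage, hh, hg.semi_iterate, iterate_mem_iff hU]
  · rw [hh, hmn, add_assoc]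

/-- A nonempty invariant open set contains an essential loop unless there is a periodic point. -/
theorem IsCoverLift.exists_isLoop (hg : IsCoverLift f p g) (hnw : NonWandering f)
    (hper : ¬HasPeriodicPoint f) (hUo : IsOpen U) (hne : U.Nonempty)
    (hU : ∀ x, f x ∈ U ↔ x ∈ U) :
    ∃ m n : ℤ, (m ≠ 0 ∨ n ≠ 0) ∧ IsLoop p U (m + n * I) := by
  obtain ⟨u, hu⟩ := hne
  obtain ⟨z₀, rfl⟩ := hg.cover.surjective u
  obtain ⟨X, hX, hz₀⟩ := exists_isOpenComponent (hUo.preimage hg.cover.continuous) hu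
  obtain ⟨N, hN, m, n, hret⟩ := hX.exists_return hg hnw hU
  obtain ⟨h, hh⟩ := exists_homeomorph_eq_iterate g N
  let G : ℂ ≃ₜ ℂ := h.trans (Homeomorph.addRight (-((m : ℂ) + n * I)))
  have hG : ∀ z, G z = g^[N] z + (-m : ℤ) + (-n : ℤ) * I := fun z => by
    simp only [G, Homeomorph.trans_apply, hh, Homeomorph.coe_addRight]
    push_cast
    ring
  have hGcomm : ∀ z (a b : ℤ), G (z + a + b * I) = G z + a + b * I := fun z a b => by
    rw [hG, hG, hg.comm_iterate]
    ring
  have hGp : ∀ z, p (G z) = f^[N] (p z) := fun z => by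
    rw [hG, hg.cover.map_add, hg.semi_iterate]
  have hGit : ∀ j z, p (G^[j] z) = f^[N * j] (p z) := fun j z => by
    rw [Function.iterate_mul]
    exact (Function.Semiconj.iterate_right (show Function.Semiconj p G (f^[N]) from hGp) j) z
  have hfix : ∀ z, G z ≠ z := fun z hz => hper ⟨p z, N, hN, by rw [← hGp, hz]⟩
  have hGX : ∀ z ∈ X, G z ∈ X := fun z hz => by
    have h1 : g^[N] z ∈ (fun x => x + ((m : ℂ) + n * I)) '' X := hret ▸ ⟨z, hz, rfl⟩
    obtain ⟨w, hw, hwz⟩ := h1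
    rw [hG, ← hwz]
    push_cast
    convert hw using 1
    ring
  obtain ⟨r, hr, hrX, hrw⟩ := exists_wandering_ball (bddDisp_of_commute hGcomm) hfix z₀
    (hX.isOpen.mem_nhds hz₀)
  obtain ⟨j, hj, x, ⟨z, hz, rfl⟩, w, hw, hwz⟩ := NonWandering.exists_mul_return hnw f.continuous
    (hg.cover.isOpenMap _ isOpen_ball) ((nonempty_ball.2 hr).image p) hN (U := p '' ball z₀ r)
  rw [← hGit, hg.cover.eq_iff] at hwz
  obtain ⟨a, b, hab⟩ := hwz
  refine ⟨a, b, ?_, X, hX.conn.isPreconnected, hX.sub, w, hrX hw, ?_⟩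
  · by_contra! h0
    obtain ⟨rfl, rfl⟩ := h0
    refine hrw j hj z hz ?_
    rw [hab]
    simpa using hw
  · rw [← add_assoc, ← hab]
    exact (show MapsTo G X X from hGX).iterate j (hrX hz)

end Components

end TorusCircloid

namespace TorusCircloid

section Circloids

open Set Filter Topology Complex Metric

variable {f : Torus 2 ≃ₜ Torus 2} {p : ℂ → Torus 2} {g : ℂ ≃ₜ ℂ} {U V : Set (Torus 2)}
  {X Y : Set ℂ}

theorem add_int_mul_mem_of_image_eq {v : ℂ} (h : (fun x => x + v) '' X = X) {z : ℂ} (hz : z ∈ X)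
    (j : ℤ) : z + j * v ∈ X := by
  have hadd : ∀ w ∈ X, w + v ∈ X := fun w hw => by
    rw [← h]
    exact ⟨w, hw, rfl⟩
  have hsub : ∀ w ∈ X, w - v ∈ X := fun w hw => by
    rw [← h] at hw
    obtain ⟨y, hy, rfl⟩ := hw
    simpa using hy
  induction j using Int.induction_on with
  | zero => simpa using hz
  | succ j ih =>
    have h1 := hadd _ ih
    convert h1 using 1
    push_cast
    ring
  | pred j ih =>
    have h1 := hsub _ ih
    convert h1 using 1
    push_cast
    ring

theorem IsLoop.exists_component (hp : IsPlaneCover p) (hU : IsOpen U) {m n : ℤ}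
    (h : IsLoop p U (m + n * I)) :
    ∃ X, IsOpenComponent (p ⁻¹' U) X ∧ ∀ z ∈ X, ∀ j : ℤ, z + j * ((m : ℂ) + n * I) ∈ X := by
  obtain ⟨S, hS, hSU, z, hz, hz'⟩ := h
  obtain ⟨X, hX, hzX⟩ := exists_isOpenComponent (hU.preimage hp.continuous) (hSU hz)
  have hSX := hX.maximal S hS hSU ⟨z, hz, hzX⟩
  exact ⟨X, hX, fun w hw => add_int_mul_mem_of_image_eq
    ((hX.translate hp m n).eq_of_inter hX ⟨_, ⟨z, hzX, rfl⟩, hSX hz'⟩) hw⟩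

/-- A connected set disjoint from a line cannot extend from above its top to below its bottom. -/
theorem IsLine.not_crosses {k : ℝ} {l S : Set ℂ} {P Q z w : ℂ} (hk : 0 < k) (hl : IsLine k l P Q)
    (hS : IsPreconnected S) (hd : Disjoint S l) (hz : z ∈ S) (hw : w ∈ S) (hPz : P.im ≤ z.im) :
    Q.im < w.im := by
  by_contra! hwQ
  have h1 : z ∈ side 1 l := mem_side_of_forall_le (one_pow 2) (Set.disjoint_left.1 hd hz)
    fun y hy => by linarith [hl.le_top y hy]
  have h2 : w ∈ side (-1) l := mem_side_of_forall_le neg_one_sq_real (Set.disjoint_left.1 hd hw)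
    fun y hy => by linarith [hl.bot_le y hy]
  exact Set.disjoint_left.1 (hl.disjoint_sides hk) (subset_side hS hd ⟨z, hz, h1⟩ hw) h2

theorem disjoint_components (hUV : Disjoint U V) (hX : X ⊆ p ⁻¹' U) (hY : Y ⊆ p ⁻¹' V) :
    Disjoint X Y :=
  (hUV.preimage p).mono hX hY

theorem IsOpenComponent.exists_isLine (hX : IsOpenComponent (p ⁻¹' U) X) {k : ℤ} (hk : 1 ≤ k)
    (hper : ∀ z ∈ X, ∀ j : ℤ, z + j * (k : ℂ) ∈ X) :
    ∃ l P Q, IsLine (k : ℝ) l P Q ∧ l ⊆ X :=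
  TorusCircloid.exists_isLine hX.isOpen hX.conn (by exact_mod_cast hk)
    fun z hz j => by simpa using hper z hz j

theorem IsOpenComponent.isBand (hp : IsPlaneCover p) (hUV : Disjoint U V)
    (hX : IsOpenComponent (p ⁻¹' U) X) (hY : IsOpenComponent (p ⁻¹' V) Y) {k k' : ℤ}
    (hk : 1 ≤ k) (hk' : 1 ≤ k') (hXper : ∀ z ∈ X, ∀ j : ℤ, z + j * (k : ℂ) ∈ X)
    (hYper : ∀ z ∈ Y, ∀ j : ℤ, z + j * (k' : ℂ) ∈ Y) :
    IsBand X ∧ Disjoint X ((· + I) '' X) := by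
  obtain ⟨l, P, Q, hl, hlX⟩ := hX.exists_isLine hk hXper
  obtain ⟨l', P', Q', hl', hlY⟩ := hY.exists_isLine hk' hYper
  have hk0 : (0 : ℝ) < k := by exact_mod_cast hk
  have hk0' : (0 : ℝ) < k' := by exact_mod_cast hk'
  obtain ⟨z₀, hz₀⟩ := hX.conn.nonempty
  have hcross : ∀ (n : ℤ), ∀ z ∈ X, ∀ w ∈ X, P'.im ≤ z.im + n → Q'.im < w.im + n := by
    intro n z hz w hw hzP
    have hXn := hX.translate hp 0 n
    have := hl'.not_crosses hk0' hXn.conn.isPreconnected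
      (disjoint_components hUV hXn.sub (hlY.trans hY.sub)) ⟨z, hz, rfl⟩ ⟨w, hw, rfl⟩
      (by simpa using hzP)
    simpa using this
  have hbdd : ∃ c, ∀ z ∈ X, |z.im| ≤ c := by
    obtain ⟨n, hn⟩ := exists_int_gt (P'.im - z₀.im)
    obtain ⟨n', hn'⟩ := exists_int_lt (Q'.im - z₀.im)
    refine ⟨max (P'.im - n') (n - Q'.im), fun z hz => abs_le'.2 ⟨?_, ?_⟩⟩
    · refine le_max_of_le_left ?_
      by_contra! h
      linarith [hcross n' z hz z₀ hz₀ (by linarith)]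
    · refine le_max_of_le_right ?_
      linarith [hcross n z₀ hz₀ z hz (by linarith)]
  have hXone := hX.translate hp 1 0
  have hone : (fun x => x + (((1 : ℤ) : ℂ) + ((0 : ℤ) : ℂ) * I)) '' X = X := by
    by_contra hne
    have hd : Disjoint ((fun x => x + (((1 : ℤ) : ℂ) + ((0 : ℤ) : ℂ) * I)) '' X) X :=
      Set.disjoint_iff_inter_eq_empty.2
        (not_nonempty_iff_eq_empty.1 fun h => hne (hXone.eq_of_inter hX h))
    have := hl.not_crosses hk0 hXone.conn.isPreconnected (hd.mono_right hlX)
      ⟨P, hlX hl.top, rfl⟩ ⟨Q, hlX hl.bot, rfl⟩ (by simp)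
    simp at this
  refine ⟨⟨hX.isOpen, hX.conn, fun z hz j => ?_, hbdd⟩, ?_⟩
  · simpa using add_int_mul_mem_of_image_eq hone hz j
  · rw [Set.disjoint_iff_inter_eq_empty, ← not_nonempty_iff_eq_empty]
    intro h
    have hI : (fun x => x + (((0 : ℤ) : ℂ) + ((1 : ℤ) : ℂ) * I)) '' X = X :=
      (hX.translate hp 0 1).eq_of_inter hX (by simpa [inter_comm] using h)
    obtain ⟨c, hc⟩ := hbdd
    obtain ⟨n, hn⟩ := exists_int_gt (c - z₀.im)
    have h1 := (le_abs_self _).trans (hc _ (add_int_mul_mem_of_image_eq hI hz₀ n))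
    simp at h1
    linarith

/-- The image in the torus of the circloid at the top of a band. -/
def bandCircloid (p : ℂ → Torus 2) (X : Set ℂ) : Set (Torus 2) :=
  p '' (lowerDomain X ∪ upperDomain X)ᶜ

theorem image_compl_domains {h : ℂ ≃ₜ ℂ} (hh : BddDisp h) (X : Set ℂ) :
    h '' (lowerDomain X ∪ upperDomain X)ᶜ = (lowerDomain (h '' X) ∪ upperDomain (h '' X))ᶜ := by
  rw [image_compl_eq h.bijective, image_union, image_lowerDomain hh, image_upperDomain hh]

theorem bandCircloid_translate (hp : IsPlaneCover p) (X : Set ℂ) (m n : ℤ) :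
    bandCircloid p ((fun x => x + ((m : ℂ) + n * I)) '' X) = bandCircloid p X := by
  have h1 := image_compl_domains (bddDisp_addRight ((m : ℂ) + n * I)) X
  rw [Homeomorph.coe_addRight] at h1
  rw [bandCircloid, ← h1, image_image, bandCircloid]
  simp only [← add_assoc, hp.map_add]

theorem bandCircloid_image_iterate (hg : IsCoverLift f p g) {N : ℕ} {m n : ℤ}
    (hret : g^[N] '' X = (fun x => x + ((m : ℂ) + n * I)) '' X) :
    (⇑f)^[N] '' bandCircloid p X = bandCircloid p X := by
  obtain ⟨h, hh⟩ := exists_homeomorph_eq_iterate g N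
  have hb : BddDisp h := bddDisp_of_commute fun z m n => by rw [hh, hg.comm_iterate]
  rw [← hh] at hret
  calc (⇑f)^[N] '' bandCircloid p X
      = p '' (h '' (lowerDomain X ∪ upperDomain X)ᶜ) := by
        simp only [bandCircloid, image_image, hh, hg.semi_iterate]
    _ = bandCircloid p (h '' X) := by rw [image_compl_domains hb, bandCircloid]
    _ = bandCircloid p X := by rw [hret, bandCircloid_translate hg.cover]

theorem bandCircloid_inter_eq_empty (hp : IsPlaneCover p) (hUV : Disjoint U V)
    (hX : IsOpenComponent (p ⁻¹' U) X) (hY : IsOpenComponent (p ⁻¹' V) Y) (hXb : IsBand X)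
    (hYb : IsBand Y) : bandCircloid p X ∩ bandCircloid p Y = ∅ := by
  rw [← Set.disjoint_iff_inter_eq_empty, Set.disjoint_left]
  rintro _ ⟨z, hz, rfl⟩ ⟨w, hw, hwz⟩
  obtain ⟨m, n, rfl⟩ := (hp.eq_iff w z).1 hwz
  have h1 := image_compl_domains (bddDisp_addRight ((m : ℂ) + n * I)) Y
  rw [Homeomorph.coe_addRight] at h1
  refine Set.disjoint_left.1 (disjoint_of_disjoint_bands hXb (hYb.translate ((m : ℂ) + n * I))
    (disjoint_components hUV hX.sub (hY.translate hp m n).sub)) hz ?_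
  rw [← h1]
  exact ⟨w, hw, (add_assoc _ _ _).symm⟩

/-- Disjoint invariant open sets containing essential loops give disjoint periodic circloids. -/
theorem IsCoverLift.exists_circloids (hg : IsCoverLift f p g) (hnw : NonWandering f)
    (hUo : IsOpen U) (hVo : IsOpen V) (hUV : Disjoint U V) (hU : ∀ x, f x ∈ U ↔ x ∈ U)
    (hV : ∀ x, f x ∈ V ↔ x ∈ V) {k a b : ℤ} (hk : 1 ≤ k) (hlU : IsLoop p U (k + (0 : ℤ) * I))
    (hlV : IsLoop p V (a + b * I)) (hab : a ≠ 0 ∨ b ≠ 0) :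
    ∃ (C₁ C₂ : Set (Torus 2)) (q₁ q₂ : ℕ), IsCircloidT2 C₁ ∧ IsCircloidT2 C₂ ∧
      C₁ ∩ C₂ = ∅ ∧ 1 ≤ q₁ ∧ 1 ≤ q₂ ∧ (⇑f)^[q₁] '' C₁ = C₁ ∧ (⇑f)^[q₂] '' C₂ = C₂ := by
  obtain ⟨X, hX, hXper⟩ := hlU.exists_component hg.cover hUo
  obtain ⟨Y, hY, hYper⟩ := hlV.exists_component hg.cover hVo
  have hXk : ∀ z ∈ X, ∀ j : ℤ, z + j * (k : ℂ) ∈ X := fun z hz j => by simpa using hXper z hz j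
  have hb : b = 0 := by
    by_contra hb
    obtain ⟨l, P, Q, hl, hlX⟩ := hX.exists_isLine hk hXk
    obtain ⟨y, hy⟩ := hY.conn.nonempty
    have hreach : ∀ t : ℝ, (∃ z ∈ Y, t ≤ z.im) ∧ ∃ z ∈ Y, z.im ≤ t := fun t => by
      obtain ⟨n, hn⟩ := exists_int_gt |t - y.im|
      have hb2 : (1 : ℝ) ≤ b * b := by
        have : 0 < b * b := mul_self_pos.2 hb
        exact_mod_cast this
      have hn0 : (0 : ℝ) < n := (abs_nonneg _).trans_lt hn
      have h1 : (n : ℝ) ≤ n * b * b := by nlinarith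
      have h2 := abs_lt.1 hn
      refine ⟨⟨_, hYper y hy (n * b), ?_⟩, _, hYper y hy (-(n * b)), ?_⟩
      · simp
        linarith
      · simp
        linarith
    obtain ⟨z, hz, hz'⟩ := (hreach P.im).1
    obtain ⟨w, hw, hw'⟩ := (hreach Q.im).2
    exact hw'.not_gt (hl.not_crosses (by exact_mod_cast hk) hY.conn.isPreconnected
      (disjoint_components hUV.symm hY.sub (hlX.trans hX.sub)) hz hw hz')
  subst hb
  have ha : a ≠ 0 := by simpa using hab
  have hYk : ∀ z ∈ Y, ∀ j : ℤ, z + j * ((|a| : ℤ) : ℂ) ∈ Y := fun z hz j => by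
    rcases abs_choice a with h | h
    · rw [h]
      simpa using hYper z hz j
    · rw [h]
      simpa using hYper z hz (-j)
  have hk' : 1 ≤ |a| := Int.one_le_abs ha
  obtain ⟨hXb, hXI⟩ := hX.isBand hg.cover hUV hY hk hk' hXk hYk
  obtain ⟨hYb, hYI⟩ := hY.isBand hg.cover hUV.symm hX hk' hk hYk hXk
  obtain ⟨q₁, hq₁, _, _, hret₁⟩ := hX.exists_return hg hnw hU
  obtain ⟨q₂, hq₂, _, _, hret₂⟩ := hY.exists_return hg hnw hV
  exact ⟨bandCircloid p X, bandCircloid p Y, q₁, q₂, (hXb.isSplit hXI).isCircloid hg.cover,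
    (hYb.isSplit hYI).isCircloid hg.cover, bandCircloid_inter_eq_empty hg.cover hUV hX hY hXb hYb,
    hq₁, hq₂, bandCircloid_image_iterate hg hret₁, bandCircloid_image_iterate hg hret₂⟩

end Circloids

end TorusCircloid

open TorusCircloid

/-- **Theorem D.**  A non-wandering homeomorphism of `𝕋²` homotopic to the identity is
topologically transitive, or has two disjoint periodic circloids, or has a periodic
point. -/
theorem statement7 (f : Torus 2 ≃ₜ Torus 2) (F : Rd 2 ≃ₜ Rd 2) (hF : IsLift f F)
    (hnw : NonWandering (⇑f)) :
    TopTransitive (⇑f) ∨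
    (∃ (C₁ C₂ : Set (Torus 2)) (q₁ q₂ : ℕ), IsCircloidT2 C₁ ∧ IsCircloidT2 C₂ ∧
      C₁ ∩ C₂ = ∅ ∧ 1 ≤ q₁ ∧ 1 ≤ q₂ ∧ (⇑f)^[q₁] '' C₁ = C₁ ∧ (⇑f)^[q₂] '' C₂ = C₂) ∨
    HasPeriodicPoint (⇑f) := by
  by_cases ht : TopTransitive f
  · exact .inl ht
  by_cases hper : HasPeriodicPoint f
  · exact .inr (.inr hper)
  refine .inr (.inl ?_)
  obtain ⟨U, V, hUo, hVo, hUne, hVne, hUV, hU, hV⟩ :=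
    TorusCircloid.NonWandering.exists_disjoint_invariant hnw ht
  have hg := isCoverLift_latticeChart hF 1 0 0 1 (by norm_num)
  obtain ⟨m, n, hmn, hlU⟩ := hg.exists_isLoop hnw hper hUo hUne hU
  obtain ⟨m', n', hmn', hlV⟩ := hg.exists_isLoop hnw hper hVo hVne hV
  have hgcd : 0 < Int.gcd m n := Int.gcd_pos_iff.2 hmn
  obtain ⟨a, c, hac, hm, hn⟩ := Int.exists_gcd_one hgcd
  obtain ⟨u, v, huv⟩ := Int.isCoprime_iff_gcd_eq_one.2 hac
  have hdet : a * u - -v * c = 1 := by linear_combination huv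
  refine (isCoverLift_latticeChart hF a (-v) c u hdet).exists_circloids hnw hUo hVo hUV hU hV
    (k := Int.gcd m n) (a := u * m' + v * n') (b := a * n' - c * m') (by exact_mod_cast hgcd)
    (hlU.change_chart hdet _ ?_ ?_) (hlV.change_chart hdet _ ?_ ?_) ?_
  · linear_combination -hm
  · linear_combination -hn
  · linear_combination m' * huv
  · linear_combination n' * huv
  · by_contra! h0
    have h1 : m' = 0 := by linear_combination (-m') * huv + a * h0.1 - v * h0.2
    have h2 : n' = 0 := by linear_combination (-n') * huv + c * h0.1 + u * h0.2
    omega
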